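/- Let Δ ⊂ ℝ² be a (closed, nondegenerate) triangle, let θ ∈ (0, π/3] satisfy sin φ ≥ sin θ for every angle φ of Δ, let 0 < m₁ ≤ m₂ be, respectively, a lower and an upper bound for the side lengths of Δ, and let 0 < l₁ ≤ l₂. Let M be a 1-dimensional complex with ⋃M = ∂Δ and with l₁ ≤ |e| ≤ l₂ for every edge e of M, and let h : ∂Δ → ℝ² be a homeomorphism onto its image that is piecewise affine over M. Then there exist a triangulation K of Δ and a homeomorphism f : Δ → f(Δ) ⊂ ℝ², piecewise affine over K, such that: every face of M is a face of K; the vertices of K lying on ∂Δ are exactly the vertices of M; the edges of K contained in ∂Δ are exactly the edges of M; f restricted to ∂Δ equals h; sin φ ≥ (1/144) · l₁² m₁² (sin θ)⁴ / m₂⁴ for every angle φ of every triangular face of K; and (1/12) · l₁ m₁ (sin θ)² / m₂ ≤ |e| ≤ m₂ for every edge e of K. -/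

import Mathlib

open Set Geometry EuclideanGeometry Metric Real

noncomputable section

abbrev E2 : Type := EuclideanSpace ℝ (Fin 2)

/-- The set of Hölder ratios of exponent `α` of `u` on `S`. -/
def holderRatioSet (α : ℝ) (S : Set E2) (u : E2 → E2) : Set ℝ :=
  {c | ∃ x ∈ S, ∃ y ∈ S, x ≠ y ∧ c = ‖u x - u y‖ / ‖x - y‖ ^ α}

/-- The Hölder seminorm of exponent `α` of `u` on `S`. -/
def holderSeminorm (α : ℝ) (S : Set E2) (u : E2 → E2) : ℝ :=
  sSup (holderRatioSet α S u)

/-- The supremum norm of `u` on `S`. -/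
def supNorm (S : Set E2) (u : E2 → E2) : ℝ :=
  sSup ((fun x => ‖u x‖) '' S)

/-- `f` is a homeomorphism of `S` onto its image `f '' S`. -/
def IsHomeoOn (f : E2 → E2) (S : Set E2) : Prop :=
  ContinuousOn f S ∧ Set.InjOn f S ∧ ContinuousOn (Function.invFunOn f S) (f '' S)

/-- `K` is a triangulation of `Ω`. -/
def IsTriangulation (K : SimplicialComplex ℝ E2) (Ω : Set E2) : Prop :=
  K.faces.Finite ∧ (∀ s ∈ K.faces, s.card ≤ 3) ∧ K.space = Ω ∧
    ∀ s ∈ K.faces, ∃ t ∈ K.faces, s ⊆ t ∧ t.card = 3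

/-- A closed polygon: a compact set admitting a triangulation. -/
def IsClosedPolygon (Ω : Set E2) : Prop :=
  IsCompact Ω ∧ ∃ K : SimplicialComplex ℝ E2, IsTriangulation K Ω

/-- `f` is piecewise affine over the simplicial complex `K`. -/
def PiecewiseAffineOn (f : E2 → E2) (K : SimplicialComplex ℝ E2) : Prop :=
  ∀ s ∈ K.faces, ∃ A : E2 →ᵃ[ℝ] E2, ∀ x ∈ convexHull ℝ (s : Set E2), f x = A x

/-- Every angle of every triangular face of `K` has sine at least `c`. -/
def AngleLB (K : SimplicialComplex ℝ E2) (c : ℝ) : Prop :=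
  ∀ s ∈ K.faces, ∀ p ∈ s, ∀ q ∈ s, ∀ r ∈ s,
    p ≠ q → q ≠ r → p ≠ r → c ≤ Real.sin (∠ p q r)

/-- Length of an edge (a two-element face). -/
def edgeLen (e : Finset E2) : ℝ := Metric.diam (e : Set E2)

/-- `o` is the incenter of the triangle `p₁p₂p₃` with inradius `r`. -/
def IsIncenter (p₁ p₂ p₃ o : E2) (r : ℝ) : Prop :=
  o ∈ interior (convexHull ℝ {p₁, p₂, p₃}) ∧
  Metric.infDist o (affineSpan ℝ ({p₁, p₂} : Set E2) : Set E2) = r ∧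
  Metric.infDist o (affineSpan ℝ ({p₂, p₃} : Set E2) : Set E2) = r ∧
  Metric.infDist o (affineSpan ℝ ({p₃, p₁} : Set E2) : Set E2) = r


/-- The determinant of two plane vectors. -/
def det2 (u v : E2) : ℝ := u 0 * v 1 - u 1 * v 0

/-- The dot product of two plane vectors, in coordinates. -/
def dot2 (u v : E2) : ℝ := u 0 * v 0 + u 1 * v 1

/-- Twice the signed area of the triangle `abc`. -/
def orient (a b c : E2) : ℝ := det2 (b - a) (c - a)

/-- The signed angle from `u` to `v`. -/
def turn (u v : E2) : ℝ := Complex.arg ⟨dot2 u v, det2 u v⟩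

/-- The signed angle under which the oriented segment `ab` is seen from `x`. -/
def viewAngle (a b x : E2) : ℝ := turn (a - x) (b - x)

/-- A plane vector as a complex number. -/
def toC (u : E2) : ℂ := ⟨u 0, u 1⟩

lemma toC_eq_zero {u : E2} : toC u = 0 ↔ u = 0 := by
  constructor
  · intro h
    have h0 := congrArg Complex.re h
    have h1 := congrArg Complex.im h
    ext i
    fin_cases i
    · simpa [toC] using h0
    · simpa [toC] using h1
  · rintro rfl
    simp [toC, Complex.ext_iff]

lemma conj_toC_mul (u v : E2) :
    (starRingEnd ℂ) (toC u) * toC v = ⟨dot2 u v, det2 u v⟩ := by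
  apply Complex.ext <;> simp [toC, dot2, det2] <;> ring

lemma turn_coe {u v : E2} (hu : u ≠ 0) (hv : v ≠ 0) :
    ((turn u v : ℝ) : Real.Angle) = (Complex.arg (toC v) : Real.Angle) - Complex.arg (toC u) := by
  have hu' : toC u ≠ 0 := fun h => hu (toC_eq_zero.1 h)
  have hv' : toC v ≠ 0 := fun h => hv (toC_eq_zero.1 h)
  rw [turn, ← conj_toC_mul, Complex.arg_mul_coe_angle (by simpa using hu') hv',
    Complex.arg_conj_coe_angle]
  abel

lemma turn_mem_Ioc (u v : E2) : turn u v ∈ Set.Ioc (-π) π := Complex.arg_mem_Ioc _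

lemma turn_pos {u v : E2} (h : 0 < det2 u v) : 0 < turn u v := by
  have h1 : 0 ≤ turn u v := Complex.arg_nonneg_iff.2 h.le
  rcases h1.lt_or_eq with h2 | h2
  · exact h2
  · exact absurd (Complex.arg_eq_zero_iff.1 h2.symm).2 h.ne'

lemma turn_lt_pi {u v : E2} (h : 0 < det2 u v) : turn u v < π := by
  rcases (turn_mem_Ioc u v).2.lt_or_eq with h2 | h2
  · exact h2
  · exact absurd (Complex.arg_eq_pi_iff.1 h2).2 h.ne'

lemma pi_div_two_lt_turn {u v : E2} (h : 0 < det2 u v) (h' : dot2 u v < 0) : π / 2 < turn u v := by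
  by_contra hc
  rcases Complex.arg_le_pi_div_two_iff.1 (not_lt.1 hc) with h1 | h1
  · exact absurd h1 (not_le.2 h')
  · exact absurd h1 (not_lt.2 h.le)

lemma det2_swap (u v : E2) : det2 v u = -det2 u v := by simp [det2]; ring
lemma dot2_comm (u v : E2) : dot2 v u = dot2 u v := by simp [dot2]; ring
@[simp] lemma det2_self (u : E2) : det2 u u = 0 := by simp [det2]; ring

lemma det2_add_left (u u' v : E2) : det2 (u + u') v = det2 u v + det2 u' v := by
  simp [det2]; ring
lemma det2_add_right (u v v' : E2) : det2 u (v + v') = det2 u v + det2 u v' := by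
  simp [det2]; ring
lemma det2_sub_left (u u' v : E2) : det2 (u - u') v = det2 u v - det2 u' v := by
  simp [det2]; ring
lemma det2_smul_left (c : ℝ) (u v : E2) : det2 (c • u) v = c * det2 u v := by
  simp [det2]; ring
lemma det2_smul_right (c : ℝ) (u v : E2) : det2 u (c • v) = c * det2 u v := by
  simp [det2]; ring

lemma mem_segment_iff {a b x : E2} :
    x ∈ segment ℝ a b ↔ det2 (a - x) (b - x) = 0 ∧ dot2 (a - x) (b - x) ≤ 0 := by
  constructor
  · rintro ⟨s, t, hs, ht, hst, rfl⟩
    obtain rfl : s = 1 - t := by linarith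
    constructor
    · simp [det2]; ring
    · have : dot2 (a - ((1 - t) • a + t • b)) (b - ((1 - t) • a + t • b)) =
          -(((1 - t) * t) * ((a 0 - b 0) ^ 2 + (a 1 - b 1) ^ 2)) := by simp [dot2]; ring
      rw [this]
      have := mul_nonneg (mul_nonneg hs ht)
        (add_nonneg (sq_nonneg (a 0 - b 0)) (sq_nonneg (a 1 - b 1)))
      linarith
  · rintro ⟨h1, h2⟩
    set N := (a 0 - b 0) ^ 2 + (a 1 - b 1) ^ 2 with hN
    by_cases hab : N = 0
    · have e0 : a 0 = b 0 := by nlinarith [sq_nonneg (a 0 - b 0), sq_nonneg (a 1 - b 1)]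
      have e1 : a 1 = b 1 := by nlinarith [sq_nonneg (a 0 - b 0), sq_nonneg (a 1 - b 1)]
      simp only [det2, dot2, PiLp.sub_apply] at h1 h2
      rw [e0, e1] at h2
      have f0 : x 0 = b 0 := by nlinarith [sq_nonneg (b 0 - x 0), sq_nonneg (b 1 - x 1)]
      have f1 : x 1 = b 1 := by nlinarith [sq_nonneg (b 0 - x 0), sq_nonneg (b 1 - x 1)]
      have : x = b := by ext i; fin_cases i <;> assumption
      exact this ▸ right_mem_segment ℝ a b
    · have hNp : 0 < N := lt_of_le_of_ne (by positivity) (Ne.symm hab)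
      simp only [det2, dot2, PiLp.sub_apply] at h1 h2
      set t := ((x 0 - a 0) * (b 0 - a 0) + (x 1 - a 1) * (b 1 - a 1)) / N with ht
      have htN : t * N = (x 0 - a 0) * (b 0 - a 0) + (x 1 - a 1) * (b 1 - a 1) := by
        rw [ht]; field_simp
      have hA : (a 0 - x 0) ^ 2 + (a 1 - x 1) ^ 2 ≥ 0 := by positivity
      have hB : (b 0 - x 0) ^ 2 + (b 1 - x 1) ^ 2 ≥ 0 := by positivity
      have ht0 : 0 ≤ t := by
        apply div_nonneg _ hNp.le
        nlinarith
      have ht1 : t ≤ 1 := by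
        rw [ht, div_le_one hNp]
        nlinarith
      refine ⟨1 - t, t, by linarith, ht0, by ring, ?_⟩
      ext i
      fin_cases i
      · simp only [Fin.zero_eta, PiLp.add_apply, PiLp.smul_apply, smul_eq_mul]
        apply mul_right_cancel₀ hab
        linear_combination (b 0 - a 0) * htN + a 0 * hN - a 0 * hN + (b 1 - a 1) * h1
      · simp only [Fin.mk_one, PiLp.add_apply, PiLp.smul_apply, smul_eq_mul]
        apply mul_right_cancel₀ hab
        linear_combination (b 1 - a 1) * htN - (b 0 - a 0) * h1

lemma slit_of_notMem_segment {a b x : E2} (h : x ∉ segment ℝ a b) :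
    (⟨dot2 (a - x) (b - x), det2 (a - x) (b - x)⟩ : ℂ) ∈ Complex.slitPlane := by
  rw [mem_segment_iff, not_and_or, not_le] at h
  rw [Complex.mem_slitPlane_iff]
  exact h.symm

lemma viewAngle_swap {a b x : E2} (h : x ∉ segment ℝ a b) :
    viewAngle b a x = -viewAngle a b x := by
  have h' := slit_of_notMem_segment h
  have : (⟨dot2 (b - x) (a - x), det2 (b - x) (a - x)⟩ : ℂ) =
      (starRingEnd ℂ) ⟨dot2 (a - x) (b - x), det2 (a - x) (b - x)⟩ := by
    apply Complex.ext <;> simp [dot2_comm (a - x), det2_swap (a - x)]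
  rw [viewAngle, turn, this, Complex.arg_conj, if_neg (Complex.slitPlane_arg_ne_pi h')]
  rfl

lemma continuous_det2 {X : Type*} [TopologicalSpace X] {f g : X → E2} (hf : Continuous f)
    (hg : Continuous g) : Continuous fun x => det2 (f x) (g x) := by
  unfold det2; fun_prop

lemma continuous_dot2 {X : Type*} [TopologicalSpace X] {f g : X → E2} (hf : Continuous f)
    (hg : Continuous g) : Continuous fun x => dot2 (f x) (g x) := by
  unfold dot2; fun_prop

lemma viewAngle_continuousAt {a b x : E2} (h : x ∉ segment ℝ a b) :
    ContinuousAt (fun y => viewAngle a b y) x := by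
  have h' := slit_of_notMem_segment h
  have hc : Continuous fun y : E2 => (⟨dot2 (a - y) (b - y), det2 (a - y) (b - y)⟩ : ℂ) := by
    have h1 : Continuous fun y : E2 => dot2 (a - y) (b - y) :=
      continuous_dot2 (by fun_prop) (by fun_prop)
    have h2 : Continuous fun y : E2 => det2 (a - y) (b - y) :=
      continuous_det2 (by fun_prop) (by fun_prop)
    have h3 : Continuous fun y : E2 => ((dot2 (a - y) (b - y) : ℝ) : ℂ) +
        ((det2 (a - y) (b - y) : ℝ) : ℂ) * Complex.I := by fun_prop
    convert h3 using 2 with y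
    exact Complex.mk_eq_add_mul_I _ _
  exact ContinuousAt.comp (f := fun y : E2 => (⟨dot2 (a - y) (b - y), det2 (a - y) (b - y)⟩ : ℂ))
    (Complex.continuousAt_arg h') hc.continuousAt

lemma orient_eq_view (a b x : E2) : orient a b x = det2 (a - x) (b - x) := by
  simp [orient, det2]; ring

lemma orient_rotate (a b c : E2) : orient b c a = orient a b c := by
  simp [orient, det2]; ring

lemma orient_swap (a b c : E2) : orient b a c = -orient a b c := by
  simp [orient, det2]; ring

lemma viewAngle_coe {a b x : E2} (ha : x ≠ a) (hb : x ≠ b) :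
    ((viewAngle a b x : ℝ) : Real.Angle) =
      (Complex.arg (toC (b - x)) : Real.Angle) - Complex.arg (toC (a - x)) :=
  turn_coe (sub_ne_zero.2 ha.symm) (sub_ne_zero.2 hb.symm)

lemma exists_int_of_coe_eq_zero {t : ℝ} (h : (t : Real.Angle) = 0) : ∃ k : ℤ, t = k * (2 * π) := by
  rw [← Real.Angle.coe_zero, Real.Angle.angle_eq_iff_two_pi_dvd_sub] at h
  obtain ⟨k, hk⟩ := h
  exact ⟨k, by linarith⟩

/-- A multiple of `2π` strictly between `-2π` and `2π` vanishes. -/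
lemma eq_zero_of_coe_eq_zero {t : ℝ} (h : (t : Real.Angle) = 0) (h1 : -(2 * π) < t)
    (h2 : t < 2 * π) : t = 0 := by
  obtain ⟨k, rfl⟩ := exists_int_of_coe_eq_zero h
  have hk1 : (-1 : ℝ) < k := by nlinarith [pi_pos]
  have hk2 : (k : ℝ) < 1 := by nlinarith [pi_pos]
  have : k = 0 := by
    have : (-1 : ℤ) < k := by exact_mod_cast hk1
    have : k < (1 : ℤ) := by exact_mod_cast hk2
    omega
  simp [this]

lemma eq_two_pi_of_coe_eq_zero {t : ℝ} (h : (t : Real.Angle) = 0) (h1 : 0 < t)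
    (h2 : t < 4 * π) : t = 2 * π := by
  have := eq_zero_of_coe_eq_zero (t := t - 2 * π) (by simp [h])
    (by linarith) (by linarith)
  linarith

section Chains

variable {V : Type*}

/-- The consecutive pairs of a list. -/
def pathEdges (l : List V) : List (V × V) := l.zip l.tail

/-- The cyclically consecutive pairs of a list. -/
def cyc : List V → List (V × V)
  | [] => []
  | v :: l => pathEdges (v :: (l ++ [v]))

@[simp] lemma pathEdges_nil : pathEdges ([] : List V) = [] := rfl
@[simp] lemma pathEdges_singleton (a : V) : pathEdges [a] = [] := rfl
@[simp] lemma pathEdges_cons_cons (a b : V) (l : List V) :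
    pathEdges (a :: b :: l) = (a, b) :: pathEdges (b :: l) := rfl

lemma cyc_cons (v : V) (l : List V) : cyc (v :: l) = pathEdges (v :: (l ++ [v])) := rfl

lemma pathEdges_append (l₁ l₂ : List V) (z : V) :
    pathEdges (l₁ ++ z :: l₂) = pathEdges (l₁ ++ [z]) ++ pathEdges (z :: l₂) := by
  induction l₁ with
  | nil => simp
  | cons a l ih =>
    cases l with
    | nil => simp
    | cons b l => simpa using ih

lemma cyc_split (v z : V) (l₁ l₂ : List V) :
    cyc (v :: l₁ ++ z :: l₂) = pathEdges (v :: l₁ ++ [z]) ++ pathEdges (z :: l₂ ++ [v]) := by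
  have := pathEdges_append (v :: l₁) (l₂ ++ [v]) z
  simpa [cyc_cons] using this

lemma cyc_perm_append (l₁ l₂ : List V) : (cyc (l₁ ++ l₂)).Perm (cyc (l₂ ++ l₁)) := by
  cases l₁ with
  | nil => simp
  | cons v l₁ =>
    cases l₂ with
    | nil => simp
    | cons z l₂ =>
      rw [cyc_split, cyc_split]
      exact List.perm_append_comm

lemma mem_of_mem_pathEdges {l : List V} {e : V × V} (h : e ∈ pathEdges l) : e.1 ∈ l ∧ e.2 ∈ l := by
  obtain ⟨h1, h2⟩ := List.of_mem_zip h
  exact ⟨h1, List.mem_of_mem_tail h2⟩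

lemma mem_of_mem_cyc {l : List V} {e : V × V} (h : e ∈ cyc l) : e.1 ∈ l ∧ e.2 ∈ l := by
  cases l with
  | nil => simp [cyc] at h
  | cons v l =>
    obtain ⟨h1, h2⟩ := mem_of_mem_pathEdges h
    simp at h1 h2 ⊢
    tauto

/-- The total angle under which a list of oriented edges is seen from `x`. -/
def winding (q : V → E2) (E : List (V × V)) (x : E2) : ℝ :=
  (E.map fun e => viewAngle (q e.1) (q e.2) x).sum

/-- The point `x` lies on none of the segments of the edge list `E`. -/
def OffSegs (q : V → E2) (E : List (V × V)) (x : E2) : Prop :=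
  ∀ e ∈ E, x ∉ segment ℝ (q e.1) (q e.2)

@[simp] lemma winding_nil (q : V → E2) (x : E2) : winding q [] x = 0 := rfl
@[simp] lemma winding_cons (q : V → E2) (e : V × V) (E : List (V × V)) (x : E2) :
    winding q (e :: E) x = viewAngle (q e.1) (q e.2) x + winding q E x := by simp [winding]
@[simp] lemma winding_append (q : V → E2) (E F : List (V × V)) (x : E2) :
    winding q (E ++ F) x = winding q E x + winding q F x := by simp [winding]

lemma winding_perm (q : V → E2) {E F : List (V × V)} (h : E.Perm F) (x : E2) :
    winding q E x = winding q F x := (h.map _).sum_eq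

lemma winding_continuousAt {q : V → E2} {E : List (V × V)} {x : E2} (h : OffSegs q E x) :
    ContinuousAt (winding q E) x := by
  induction E with
  | nil => exact continuousAt_const
  | cons e E ih =>
    have h1 := viewAngle_continuousAt (h e (by simp))
    have h2 := ih fun e' he' => h e' (by simp [he'])
    have : winding q (e :: E) = fun y => viewAngle (q e.1) (q e.2) y + winding q E y := by
      ext y; simp
    rw [this]
    exact h1.add h2

lemma isClosed_segment (a b : E2) : IsClosed (segment ℝ a b) := by
  rw [← convexHull_pair]
  exact Set.Finite.isClosed_convexHull ℝ (Set.toFinite {a, b})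

lemma offSegs_eventually {q : V → E2} {E : List (V × V)} {x : E2} (h : OffSegs q E x) :
    ∀ᶠ y in nhds x, OffSegs q E y := by
  induction E with
  | nil => exact Filter.Eventually.of_forall fun y e he => by simp at he
  | cons e E ih =>
    have h1 : ∀ᶠ y in nhds x, y ∉ segment ℝ (q e.1) (q e.2) :=
      (isClosed_segment _ _).isOpen_compl.mem_nhds (h e (by simp))
    filter_upwards [h1, ih fun e' he' => h e' (by simp [he'])] with y hy1 hy2 e' he'
    rcases List.mem_cons.1 he' with rfl | h3
    · exact hy1
    · exact hy2 e' h3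

lemma winding_path_coe {q : V → E2} {x : E2} : ∀ (a : V) (l : List V),
    (∀ v ∈ a :: l, x ≠ q v) → ((winding q (pathEdges (a :: l)) x : ℝ) : Real.Angle) =
      (Complex.arg (toC (q ((a :: l).getLast (by simp)) - x)) : Real.Angle) -
        Complex.arg (toC (q a - x))
  | a, [], _ => by simp
  | a, b :: l, h => by
    rw [pathEdges_cons_cons, winding_cons, Real.Angle.coe_add,
      winding_path_coe b l fun v hv => h v (List.mem_cons_of_mem _ hv),
      viewAngle_coe (h a (by simp)) (h b (by simp)), List.getLast_cons_cons]
    abel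

lemma winding_cyc_coe {q : V → E2} {x : E2} (l : List V) (h : ∀ v ∈ l, x ≠ q v) :
    ((winding q (cyc l) x : ℝ) : Real.Angle) = 0 := by
  cases l with
  | nil => simp [cyc]
  | cons v l =>
    rw [cyc_cons, winding_path_coe]
    · simp
    · intro w hw
      apply h
      simp at hw ⊢
      tauto

lemma offSegs_ne {q : V → E2} {l : List V} {x : E2} (h : OffSegs q (cyc l) x) :
    ∀ v ∈ l, x ≠ q v := by
  rintro v hv rfl
  have : ∃ e ∈ cyc l, e.1 = v := by
    obtain ⟨l₁, l₂, rfl⟩ := List.append_of_mem hv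
    cases l₂ with
    | nil =>
      cases l₁ with
      | nil => exact ⟨(v, v), by simp [cyc_cons], rfl⟩
      | cons a l₁ =>
        refine ⟨(v, a), ?_, rfl⟩
        rw [cyc_split]
        simp
    | cons b l₂ =>
      refine ⟨(v, b), (cyc_perm_append l₁ (v :: b :: l₂)).mem_iff.2 ?_, rfl⟩
      simp [cyc_cons]
  obtain ⟨e, he, rfl⟩ := this
  exact h e he (left_mem_segment ℝ _ _)

lemma const_of_coe_eq_zero {S : Set E2} (hS : IsPreconnected S) {f : E2 → ℝ}
    (hf : ContinuousOn f S) (hz : ∀ x ∈ S, ((f x : ℝ) : Real.Angle) = 0) {x y : E2}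
    (hx : x ∈ S) (hy : y ∈ S) : f x = f y := by
  have key : ∀ x ∈ S, ∀ y ∈ S, ¬ f x < f y := by
    intro x hx y hy hlt
    obtain ⟨k, hk⟩ := exists_int_of_coe_eq_zero (hz x hx)
    obtain ⟨m, hm⟩ := exists_int_of_coe_eq_zero (hz y hy)
    have hkm : k < m := by
      have : (k : ℝ) < m := by
        rw [hk, hm] at hlt
        exact lt_of_mul_lt_mul_right hlt (by positivity)
      exact_mod_cast this
    have hkm' : (k : ℝ) + 1 ≤ m := by exact_mod_cast hkm
    have : f x + π ∈ Set.Icc (f x) (f y) := by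
      constructor
      · linarith [pi_pos]
      · rw [hk, hm]
        nlinarith [pi_pos]
    obtain ⟨z, hz', hzf⟩ := hS.intermediate_value hx hy hf this
    obtain ⟨j, hj⟩ := exists_int_of_coe_eq_zero (hz z hz')
    rw [hj, hk] at hzf
    have h2 : (2 * j : ℝ) = 2 * k + 1 := by
      have : (2 * j - 2 * k - 1 : ℝ) * π = 0 := by linarith
      rcases mul_eq_zero.1 this with h | h
      · linarith
      · exact absurd h pi_pos.ne'
    have : 2 * j = 2 * k + 1 := by exact_mod_cast h2
    omega
  exact le_antisymm (not_lt.1 (key y hy x hx)) (not_lt.1 (key x hx y hy))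

lemma winding_cyc_const {q : V → E2} {l : List V} {S : Set E2} (hS : IsPreconnected S)
    (hoff : ∀ x ∈ S, OffSegs q (cyc l) x) {x y : E2} (hx : x ∈ S) (hy : y ∈ S) :
    winding q (cyc l) x = winding q (cyc l) y :=
  const_of_coe_eq_zero hS (fun z hz => (winding_continuousAt (hoff z hz)).continuousWithinAt)
    (fun z hz => winding_cyc_coe l (offSegs_ne (hoff z hz))) hx hy

lemma turn_sub {d a b : E2} (ha : 0 < det2 d a) (hb : 0 < det2 d b) :
    turn a b = turn d b - turn d a := by
  have hd : d ≠ 0 := by rintro rfl; simp [det2] at ha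
  have ha' : a ≠ 0 := by rintro rfl; simp [det2] at ha
  have hb' : b ≠ 0 := by rintro rfl; simp [det2] at hb
  have h1 := turn_pos ha
  have h2 := turn_lt_pi ha
  have h3 := turn_pos hb
  have h4 := turn_lt_pi hb
  have h5 := turn_mem_Ioc a b
  have := eq_zero_of_coe_eq_zero (t := turn a b - (turn d b - turn d a)) (by
    rw [Real.Angle.coe_sub, Real.Angle.coe_sub, turn_coe ha' hb', turn_coe hd hb', turn_coe hd ha']
    abel) (by linarith [h5.1]) (by linarith [h5.2])
  linarith

lemma winding_path_halfPlane {q : V → E2} {x d : E2} : ∀ (a : V) (l : List V),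
    (∀ v ∈ a :: l, 0 < det2 d (q v - x)) → winding q (pathEdges (a :: l)) x =
      turn d (q ((a :: l).getLast (by simp)) - x) - turn d (q a - x)
  | a, [], _ => by simp
  | a, b :: l, h => by
    rw [pathEdges_cons_cons, winding_cons,
      winding_path_halfPlane b l fun v hv => h v (List.mem_cons_of_mem _ hv),
      List.getLast_cons_cons, viewAngle, turn_sub (h a (by simp)) (h b (by simp))]
    ring

lemma winding_halfPlane {q : V → E2} {x d : E2} (l : List V)
    (h : ∀ v ∈ l, 0 < det2 d (q v - x)) : winding q (cyc l) x = 0 := by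
  cases l with
  | nil => simp [cyc]
  | cons v l =>
    rw [cyc_cons, winding_path_halfPlane (d := d)]
    · simp
    · intro w hw
      apply h
      simp at hw ⊢
      tauto

lemma offSegs_halfPlane {q : V → E2} {x d : E2} (E : List (V × V))
    (h : ∀ e ∈ E, 0 < det2 d (q e.1 - x) ∧ 0 < det2 d (q e.2 - x)) : OffSegs q E x := by
  rintro e he ⟨s, t, hs, ht, hst, hx⟩
  obtain ⟨h1, h2⟩ := h e he
  have h3 : s * det2 d (q e.1 - x) + t * det2 d (q e.2 - x) = 0 := by
    rw [← det2_smul_right, ← det2_smul_right, ← det2_add_right]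
    have : s • (q e.1 - x) + t • (q e.2 - x) = 0 := by
      rw [smul_sub, smul_sub, sub_add_sub_comm, hx, ← add_smul, hst, one_smul, sub_self]
    rw [this]; simp [det2]
  rcases hs.lt_or_eq with hs | rfl
  · nlinarith [mul_pos hs h1, mul_nonneg ht h2.le]
  · obtain rfl : t = 1 := by linarith
    linarith

end Chains

/-- The total angle under which the triangle `abc` is seen from `x`. -/
def triW (a b c x : E2) : ℝ := viewAngle a b x + viewAngle b c x + viewAngle c a x

lemma triW_rotate (a b c x : E2) : triW b c a x = triW a b c x := by
  unfold triW; ring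

lemma triW_eq_winding (a b c x : E2) : triW a b c x = winding id (cyc [a, b, c]) x := by
  simp [triW, cyc_cons]; ring

lemma triW_halfPlane {a b c x d : E2} (ha : 0 < det2 d (a - x)) (hb : 0 < det2 d (b - x))
    (hc : 0 < det2 d (c - x)) : triW a b c x = 0 := by
  rw [triW_eq_winding]
  apply winding_halfPlane (d := d)
  simp [ha, hb, hc]

lemma triW_coe {a b c x : E2} (ha : x ≠ a) (hb : x ≠ b) (hc : x ≠ c) :
    ((triW a b c x : ℝ) : Real.Angle) = 0 := by
  rw [triW_eq_winding]
  apply winding_cyc_coe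
  simp [ha, hb, hc]

lemma triW_continuousAt {a b c x : E2} (hab : x ∉ segment ℝ a b) (hbc : x ∉ segment ℝ b c)
    (hca : x ∉ segment ℝ c a) : ContinuousAt (triW a b c) x :=
  ((viewAngle_continuousAt hab).add (viewAngle_continuousAt hbc)).add (viewAngle_continuousAt hca)

lemma orient_sub_smul (a b x d : E2) (t : ℝ) :
    orient a b (x - t • d) = orient a b x - t * det2 (b - a) d := by
  simp [orient, det2]; ring

lemma triW_eq_zero_aux {a b c x : E2} (h : 0 < orient a b c) (hab : x ∉ segment ℝ a b)
    (hbc : x ∉ segment ℝ b c) (hca : x ∉ segment ℝ c a) (hx : orient a b x ≤ 0) :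
    triW a b c x = 0 := by
  have key : ∀ t : ℝ, 0 < t → triW a b c (x - t • (c - a)) = 0 := by
    intro t ht
    have h1 : orient a b (x - t • (c - a)) < 0 := by
      rw [orient_sub_smul]
      have : 0 < t * det2 (b - a) (c - a) := mul_pos ht h
      linarith
    set y := x - t • (c - a)
    apply triW_halfPlane (d := b - a)
    · have : det2 (b - a) (a - y) = -orient a b y := by simp [orient, det2]; ring
      linarith
    · have : det2 (b - a) (b - y) = -orient a b y := by simp [orient, det2]; ring
      linarith
    · have : det2 (b - a) (c - y) = orient a b c - orient a b y := by simp [orient, det2]; ring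
      linarith
  have h1 : Filter.Tendsto (fun t : ℝ => triW a b c (x - t • (c - a))) (nhdsWithin 0 (Ioi 0))
      (nhds (triW a b c x)) := by
    have h2 : ContinuousAt (fun t : ℝ => triW a b c (x - t • (c - a))) 0 := by
      apply ContinuousAt.comp (g := triW a b c)
      · simpa using triW_continuousAt hab hbc hca
      · fun_prop
    have h3 := h2.tendsto
    simp only [zero_smul, sub_zero] at h3
    exact h3.mono_left nhdsWithin_le_nhds
  have h2 : Filter.Tendsto (fun t : ℝ => triW a b c (x - t • (c - a))) (nhdsWithin 0 (Ioi 0))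
      (nhds 0) := by
    apply tendsto_const_nhds.congr'
    filter_upwards [self_mem_nhdsWithin] with t ht
    exact (key t ht).symm
  exact tendsto_nhds_unique h1 h2

lemma triW_eq_zero {a b c x : E2} (h : 0 < orient a b c) (hab : x ∉ segment ℝ a b)
    (hbc : x ∉ segment ℝ b c) (hca : x ∉ segment ℝ c a)
    (hx : ¬ (0 < orient a b x ∧ 0 < orient b c x ∧ 0 < orient c a x)) :
    triW a b c x = 0 := by
  rw [not_and_or, not_and_or, not_lt, not_lt, not_lt] at hx
  rcases hx with hx | hx | hx
  · exact triW_eq_zero_aux h hab hbc hca hx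
  · rw [← triW_rotate]
    exact triW_eq_zero_aux (by rwa [orient_rotate]) hbc hca hab hx
  · rw [← triW_rotate, ← triW_rotate]
    exact triW_eq_zero_aux (by rwa [orient_rotate, orient_rotate]) hca hab hbc hx

lemma ne_of_orient_pos {a b x : E2} (h : 0 < orient a b x) : x ≠ a ∧ x ≠ b := by
  constructor
  · rintro rfl; simp [orient, det2] at h
  · rintro rfl; simp [orient] at h

lemma triW_eq_two_pi {a b c x : E2} (h1 : 0 < orient a b x) (h2 : 0 < orient b c x)
    (h3 : 0 < orient c a x) : triW a b c x = 2 * π := by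
  obtain ⟨ha, hb⟩ := ne_of_orient_pos h1
  obtain ⟨-, hc⟩ := ne_of_orient_pos h2
  rw [orient_eq_view] at h1 h2 h3
  have a1 := turn_pos h1
  have a2 := turn_pos h2
  have a3 := turn_pos h3
  have b1 := turn_lt_pi h1
  have b2 := turn_lt_pi h2
  have b3 := turn_lt_pi h3
  apply eq_two_pi_of_coe_eq_zero (triW_coe ha hb hc)
  · unfold triW viewAngle; linarith
  · unfold triW viewAngle; linarith

lemma triW_nonneg {a b c x : E2} (h : 0 < orient a b c) (hab : x ∉ segment ℝ a b)
    (hbc : x ∉ segment ℝ b c) (hca : x ∉ segment ℝ c a) : 0 ≤ triW a b c x := by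
  by_cases hx : 0 < orient a b x ∧ 0 < orient b c x ∧ 0 < orient c a x
  · rw [triW_eq_two_pi hx.1 hx.2.1 hx.2.2]; positivity
  · rw [triW_eq_zero h hab hbc hca hx]

section Loops

variable {V : Type*}

/-- The closed polygon through the points `q v`, `v ∈ l`, has no self-intersections. -/
structure SimpleLoop (q : V → E2) (l : List V) : Prop where
  nodup : l.Nodup
  inj : ∀ a ∈ l, ∀ b ∈ l, q a = q b → a = b
  inter : ∀ e ∈ cyc l, ∀ e' ∈ cyc l, e ≠ e' → ∀ x ∈ segment ℝ (q e.1) (q e.2),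
    x ∈ segment ℝ (q e'.1) (q e'.2) →
      ∃ v, (v = e.1 ∨ v = e.2) ∧ (v = e'.1 ∨ v = e'.2) ∧ x = q v

/-- The sum of `α` over the three oriented edges of a triple. -/
def bdry (α : V → V → ℝ) (t : V × V × V) : ℝ := α t.1 t.2.1 + α t.2.1 t.2.2 + α t.2.2 t.1

/-- The triangles of `T` triangulate the polygon `l` with the orientation `σ`. -/
structure Triangulates (q : V → E2) (l : List V) (σ : ℝ) (T : List (V × V × V)) : Prop where
  bdry_sum : ∀ α : V → V → ℝ, (∀ a b, α b a = -α a b) →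
    (T.map (bdry α)).sum = ((cyc l).map fun e => α e.1 e.2).sum
  orient_pos : ∀ t ∈ T, 0 < σ * orient (q t.1) (q t.2.1) (q t.2.2)
  sublist : ∀ t ∈ T, ∃ s : List V, s ~r [t.1, t.2.1, t.2.2] ∧ s.Sublist l
  winding : ∀ x, OffSegs q (cyc l) x → winding q (cyc l) x = 0 ∨ winding q (cyc l) x = 2 * π * σ

/-- The polygon `l` has a triangulation by diagonals. -/
def Triangulable (q : V → E2) (l : List V) : Prop :=
  ∃ σ : ℝ, (σ = 1 ∨ σ = -1) ∧ ∃ T, Triangulates q l σ T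

lemma SimpleLoop.rotate {q : V → E2} {l₁ l₂ : List V} (h : SimpleLoop q (l₁ ++ l₂)) :
    SimpleLoop q (l₂ ++ l₁) := by
  have hp := cyc_perm_append l₁ l₂
  have hl : (l₁ ++ l₂).Perm (l₂ ++ l₁) := List.perm_append_comm
  refine ⟨hl.nodup_iff.1 h.nodup, fun a ha b hb => h.inj a (hl.mem_iff.2 ha) b (hl.mem_iff.2 hb),
    fun e he e' he' => h.inter e (hp.mem_iff.2 he) e' (hp.mem_iff.2 he')⟩

lemma offSegs_perm {q : V → E2} {E F : List (V × V)} (h : E.Perm F) {x : E2}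
    (hx : OffSegs q E x) : OffSegs q F x := fun e he => hx e (h.mem_iff.2 he)

lemma Triangulable.rotate {q : V → E2} {l₁ l₂ : List V} (h : Triangulable q (l₁ ++ l₂)) :
    Triangulable q (l₂ ++ l₁) := by
  obtain ⟨σ, hσ, T, hT⟩ := h
  have hp := cyc_perm_append l₁ l₂
  refine ⟨σ, hσ, T, ?_, hT.orient_pos, ?_, ?_⟩
  · intro α hα
    rw [hT.bdry_sum α hα]
    exact (hp.map _).sum_eq
  · intro t ht
    obtain ⟨s, hs, hsl⟩ := hT.sublist t ht
    obtain ⟨s₁, s₂, rfl, h1, h2⟩ := List.sublist_append_iff.1 hsl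
    exact ⟨s₂ ++ s₁, List.isRotated_append.trans hs, h2.append h1⟩
  · intro x hx
    rw [← winding_perm q hp]
    exact hT.winding x (offSegs_perm hp.symm hx)

lemma exists_mem_segment_of_collinear {a b c : E2} (h : orient a b c = 0) :
    b ∈ segment ℝ a c ∨ a ∈ segment ℝ b c ∨ c ∈ segment ℝ a b := by
  by_contra hcon
  push Not at hcon
  obtain ⟨h1, h2, h3⟩ := hcon
  rw [mem_segment_iff, not_and, not_le] at h1 h2 h3
  have e1 := h1 (by rw [← neg_eq_zero, ← h]; simp [orient, det2]; ring)
  have e2 := h2 (by rw [← h]; simp [orient, det2])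
  have e3 := h3 (by rw [← h]; simp [orient, det2]; ring)
  simp only [dot2, orient, det2, PiLp.sub_apply] at *
  set u0 := b 0 - a 0
  set u1 := b 1 - a 1
  set w0 := c 0 - a 0
  set w1 := c 1 - a 1
  have f1 : 0 < u0 ^ 2 + u1 ^ 2 - (u0 * w0 + u1 * w1) := by simp only [u0, u1, w0, w1]; linarith
  have f3 : 0 < w0 ^ 2 + w1 ^ 2 - (u0 * w0 + u1 * w1) := by simp only [u0, u1, w0, w1]; linarith
  have f4 : (u0 * w0 + u1 * w1) ^ 2 + (u0 * w1 - u1 * w0) ^ 2 =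
    (u0 ^ 2 + u1 ^ 2) * (w0 ^ 2 + w1 ^ 2) := by ring
  rw [h] at f4
  nlinarith [mul_pos f1 f3, mul_pos f1 e2, mul_pos f3 e2]

lemma SimpleLoop.orient_ne_zero {q : V → E2} {a b c : V} (h : SimpleLoop q [a, b, c]) :
    orient (q a) (q b) (q c) ≠ 0 := by
  intro h0
  have hn := h.nodup
  simp only [List.nodup_cons, List.mem_cons, List.not_mem_nil, or_false, not_or,
    not_false_eq_true, List.nodup_nil, and_true] at hn
  obtain ⟨⟨hab, hac⟩, hbc⟩ := hn
  have hi := h.inj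
  have hx := h.inter
  simp only [cyc_cons, List.cons_append, List.nil_append, pathEdges_cons_cons,
    pathEdges_singleton, List.mem_cons, List.not_mem_nil, or_false] at hi hx
  have nab : q a ≠ q b := fun he => hab (hi a (by simp) b (by simp) he)
  have nac : q a ≠ q c := fun he => hac (hi a (by simp) c (by simp) he)
  have nbc : q b ≠ q c := fun he => hbc (hi b (by simp) c (by simp) he)
  rcases exists_mem_segment_of_collinear h0 with h1 | h1 | h1
  · obtain ⟨x, h2, h3, h4⟩ := hx (a, b) (by simp) (c, a) (by simp)
      (by simp [hac]) (q b) (right_mem_segment ℝ _ _) (by rwa [segment_symm])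
    simp only at h2 h3
    rcases h2 with rfl | rfl
    · exact nab h4.symm
    · rcases h3 with rfl | rfl
      · exact hbc rfl
      · exact hab rfl
  · obtain ⟨x, h2, h3, h4⟩ := hx (a, b) (by simp) (b, c) (by simp)
      (by simp [hab]) (q a) (left_mem_segment ℝ _ _) h1
    simp only at h2 h3
    rcases h2 with rfl | rfl
    · rcases h3 with rfl | rfl
      · exact hab rfl
      · exact hac rfl
    · exact nab h4
  · obtain ⟨x, h2, h3, h4⟩ := hx (b, c) (by simp) (a, b) (by simp)
      (by simp [Ne.symm hab]) (q c) (right_mem_segment ℝ _ _) h1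
    simp only at h2 h3
    rcases h2 with rfl | rfl
    · exact nbc h4.symm
    · rcases h3 with rfl | rfl
      · exact hac rfl
      · exact hbc rfl

lemma segment_mid_subset {a b x : E2} (hx : x ∈ segment ℝ a b) :
    segment ℝ x (midpoint ℝ a b) ⊆ insert x (openSegment ℝ a b) := by
  rintro y ⟨s, t, hs, ht, hst, rfl⟩
  obtain ⟨s', t', hs', ht', hst', rfl⟩ := hx
  rcases ht.lt_or_eq with ht | rfl
  · right
    refine ⟨s * s' + t * ⅟2, s * t' + t * ⅟2, ?_, ?_, ?_, ?_⟩
    · rw [invOf_eq_inv]; positivity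
    · rw [invOf_eq_inv]; positivity
    · have : s * s' + t * ⅟2 + (s * t' + t * ⅟2) = s * (s' + t') + t := by
        rw [invOf_eq_inv]; ring
      rw [this, hst', mul_one, hst]
    · rw [midpoint_eq_smul_add]
      module
  · left
    obtain rfl : s = 1 := by linarith
    simp

lemma path_const {q : V → E2} {f : E2 → ℝ} {O : Set E2}
    (hO : ∀ S ⊆ O, Convex ℝ S → ∀ x ∈ S, ∀ y ∈ S, f x = f y) (v : V) (l : List V) : ∀ z : V,
    (∀ e ∈ pathEdges (z :: (l ++ [v])), openSegment ℝ (q e.1) (q e.2) ⊆ O) →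
    (∀ c ∈ l, q c ∈ O) →
    ∀ e ∈ pathEdges (z :: (l ++ [v])), ∀ e' ∈ pathEdges (z :: (l ++ [v])),
    ∀ x ∈ segment ℝ (q e.1) (q e.2), x ∈ O → ∀ y ∈ segment ℝ (q e'.1) (q e'.2), y ∈ O →
      f x = f y := by
  have mid : ∀ a b : V, openSegment ℝ (q a) (q b) ⊆ O → ∀ x ∈ segment ℝ (q a) (q b), x ∈ O →
      f x = f (midpoint ℝ (q a) (q b)) := by
    intro a b hab x hx hxO
    exact hO _ ((segment_mid_subset hx).trans (insert_subset hxO hab)) (convex_segment _ _)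
      x (left_mem_segment ℝ _ _) _ (right_mem_segment ℝ _ _)
  suffices H : ∀ z : V,
      (∀ e ∈ pathEdges (z :: (l ++ [v])), openSegment ℝ (q e.1) (q e.2) ⊆ O) →
      (∀ c ∈ l, q c ∈ O) →
      ∃ t : ℝ, ∀ e ∈ pathEdges (z :: (l ++ [v])), ∀ x ∈ segment ℝ (q e.1) (q e.2), x ∈ O →
        f x = t by
    intro z h1 h2 e he e' he' x hx hxO y hy hyO
    obtain ⟨t, ht⟩ := H z h1 h2
    rw [ht e he x hx hxO, ht e' he' y hy hyO]
  induction l with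
  | nil =>
    intro z h1 _
    refine ⟨f (midpoint ℝ (q z) (q v)), ?_⟩
    intro e he x hx hxO
    simp only [List.nil_append, pathEdges_cons_cons, pathEdges_singleton, List.mem_cons,
      List.not_mem_nil, or_false] at he h1
    subst he
    exact mid z v (h1 _ rfl) x hx hxO
  | cons c l ih =>
    intro z h1 h2
    obtain ⟨t, ht⟩ := ih c (fun e he => h1 e (by
      rw [List.cons_append, pathEdges_cons_cons]; exact List.mem_cons_of_mem _ he))
      fun c' hc' => h2 c' (List.mem_cons_of_mem _ hc')
    refine ⟨t, ?_⟩
    have hd : ∃ d, (c, d) ∈ pathEdges (c :: (l ++ [v])) := by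
      cases l with
      | nil => exact ⟨v, by simp⟩
      | cons d l => exact ⟨d, by simp⟩
    obtain ⟨d, hd⟩ := hd
    have hc : f (q c) = t := ht _ hd _ (left_mem_segment ℝ _ _) (h2 c (by simp))
    intro e he x hx hxO
    rw [List.cons_append, pathEdges_cons_cons] at he
    rcases List.mem_cons.1 he with rfl | he
    · have hzc : openSegment ℝ (q z) (q c) ⊆ O := h1 (z, c) (by simp)
      rw [mid z c hzc x hx hxO, ← mid z c hzc (q c)
        (right_mem_segment ℝ _ _) (h2 c (by simp)), hc]
    · exact ht e he x hx hxO

end Loops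

section Diagonals

variable {V : Type*}

lemma pathEdges_map_fst (l : List V) (x : V) : (pathEdges (l ++ [x])).map Prod.fst = l := by
  induction l with
  | nil => simp
  | cons a l ih =>
    cases l with
    | nil => simp
    | cons b l =>
      simp only [List.cons_append, pathEdges_cons_cons, List.map_cons] at ih ⊢
      rw [ih]

lemma cyc_map_fst (l : List V) : (cyc l).map Prod.fst = l := by
  cases l with
  | nil => rfl
  | cons v l => exact pathEdges_map_fst (v :: l) v

lemma exists_fst_of_mem_cyc {l : List V} {v : V} (hv : v ∈ l) : ∃ e ∈ cyc l, e.1 = v := by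
  rw [← cyc_map_fst l] at hv
  simpa using hv

lemma pathEdges_ne {l : List V} (hl : l.Nodup) : ∀ e ∈ pathEdges l, e.1 ≠ e.2 := by
  induction l with
  | nil => simp
  | cons a l ih =>
    cases l with
    | nil => simp
    | cons b l =>
      intro e he
      rw [pathEdges_cons_cons] at he
      rcases List.mem_cons.1 he with rfl | he
      · rintro (rfl : a = b)
        simp at hl
      · exact ih hl.of_cons e he

lemma cyc_nodup {l : List V} (hl : l.Nodup) : (cyc l).Nodup := by
  apply List.Nodup.of_map Prod.fst
  rwa [cyc_map_fst]

lemma SimpleLoop.vertex_on_edge {q : V → E2} {l : List V} (h : SimpleLoop q l) {v : V}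
    (hv : v ∈ l) {e : V × V} (he : e ∈ cyc l) (hx : q v ∈ segment ℝ (q e.1) (q e.2)) :
    v = e.1 ∨ v = e.2 := by
  obtain ⟨e', he', rfl⟩ := exists_fst_of_mem_cyc hv
  by_cases hee : e' = e
  · exact Or.inl (by rw [hee])
  obtain ⟨w, -, h2, h3⟩ := h.inter e' he' e he hee _ (left_mem_segment ℝ _ _) hx
  have hwl : w ∈ l := by
    rcases h2 with rfl | rfl
    · exact (mem_of_mem_cyc he).1
    · exact (mem_of_mem_cyc he).2
  rwa [h.inj _ hv w hwl h3]

lemma winding_eventually_eq {q : V → E2} {l : List V} {x : E2} (hx : OffSegs q (cyc l) x) :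
    ∀ᶠ y in nhds x, winding q (cyc l) y = winding q (cyc l) x := by
  obtain ⟨ε, hε, hball⟩ := Metric.eventually_nhds_iff_ball.1 (offSegs_eventually hx)
  filter_upwards [Metric.ball_mem_nhds x hε] with y hy
  exact winding_cyc_const (convex_ball x ε).isPreconnected hball hy (Metric.mem_ball_self hε)

/-- The vector `u` rotated by a quarter turn. -/
def rot (u : E2) : E2 := !₂[-u 1, u 0]

/-- The square length in coordinates. -/
def nsq (u : E2) : ℝ := u 0 ^ 2 + u 1 ^ 2

lemma det2_rot (u : E2) : det2 u (rot u) = nsq u := by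
  simp [det2, rot, nsq]; ring

lemma nsq_pos {u : E2} (h : u ≠ 0) : 0 < nsq u := by
  have h0 : 0 ≤ nsq u := by unfold nsq; positivity
  rcases h0.lt_or_eq with h1 | h1
  · exact h1
  · exfalso
    apply h
    unfold nsq at h1
    have e0 : u 0 = 0 := by nlinarith [sq_nonneg (u 0), sq_nonneg (u 1)]
    have e1 : u 1 = 0 := by nlinarith [sq_nonneg (u 0), sq_nonneg (u 1)]
    ext i; fin_cases i <;> simp [e0, e1]

lemma orient_add_smul (a b x d : E2) (t : ℝ) :
    orient a b (x + t • d) = orient a b x + t * det2 (b - a) d := by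
  simp [orient, det2]; ring

lemma exists_near_orient_ne {a b x : E2} (hab : a ≠ b) {P : E2 → Prop}
    (hP : ∀ᶠ y in nhds x, P y) : ∃ y, P y ∧ orient a b y ≠ 0 := by
  by_cases h0 : orient a b x = 0
  · have hN := nsq_pos (sub_ne_zero.2 hab.symm)
    have ht : Filter.Tendsto (fun t : ℝ => x + t • rot (b - a)) (nhdsWithin 0 (Ioi 0))
        (nhds x) := by
      have : ContinuousAt (fun t : ℝ => x + t • rot (b - a)) 0 := by fun_prop
      have := this.tendsto
      simp only [zero_smul, add_zero] at this
      exact this.mono_left nhdsWithin_le_nhds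
    obtain ⟨t, h1, h2⟩ := ((ht.eventually hP).and self_mem_nhdsWithin).exists
    refine ⟨_, h1, ?_⟩
    rw [orient_add_smul, h0, det2_rot, zero_add]
    exact (mul_pos h2 hN).ne'
  · exact ⟨x, hP.self_of_nhds, h0⟩

lemma orient_eq_zero_of_mem_segment {a b x : E2} (h : x ∈ segment ℝ a b) : orient a b x = 0 := by
  rw [orient_eq_view]
  exact (mem_segment_iff.1 h).1

lemma exists_le_of_list (l : List V) (f : V → ℝ) : ∃ B, ∀ v ∈ l, f v ≤ B := by
  obtain ⟨B, hB⟩ := ((List.finite_toSet l).image f).bddAbove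
  exact ⟨B, fun v hv => hB ⟨v, hv, rfl⟩⟩

/-- The segment from `q v` to `q z` is a diagonal of the simple polygon `v, l₁, z, l₂`. -/
structure Diagonal (q : V → E2) (v z : V) (l₁ l₂ : List V) : Prop where
  simple : SimpleLoop q (v :: l₁ ++ z :: l₂)
  diag : ∀ e ∈ cyc (v :: l₁ ++ z :: l₂), ∀ x ∈ segment ℝ (q v) (q z),
    x ∈ segment ℝ (q e.1) (q e.2) → x = q v ∨ x = q z

namespace Diagonal

variable {q : V → E2} {v z : V} {l₁ l₂ : List V}

lemma symm (h : Diagonal q v z l₁ l₂) : Diagonal q z v l₂ l₁ := by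
  refine ⟨SimpleLoop.rotate (l₁ := v :: l₁) h.simple, fun e he x hx hxe => ?_⟩
  rw [segment_symm] at hx
  exact (h.diag e ((cyc_perm_append (v :: l₁) (z :: l₂)).mem_iff.2 he) x hx hxe).symm

lemma mem_cyc_iff {e : V × V} : e ∈ cyc (v :: l₁ ++ z :: l₂) ↔
    e ∈ pathEdges (v :: l₁ ++ [z]) ∨ e ∈ pathEdges (z :: l₂ ++ [v]) := by
  rw [cyc_split, List.mem_append]

lemma mem_cycA_iff {e : V × V} : e ∈ cyc (v :: z :: l₂) ↔
    e = (v, z) ∨ e ∈ pathEdges (z :: l₂ ++ [v]) := by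
  rw [cyc_cons]; simp

lemma ne (h : Diagonal q v z l₁ l₂) : v ≠ z := by
  have := h.simple.nodup
  simp at this
  tauto

lemma q_ne (h : Diagonal q v z l₁ l₂) : q v ≠ q z := fun he =>
  h.ne (h.simple.inj v (by simp) z (by simp) he)

lemma diag' (h : Diagonal q v z l₁ l₂) {e : V × V} (he : e ∈ cyc (v :: l₁ ++ z :: l₂)) {x : E2}
    (hx : x ∈ segment ℝ (q v) (q z)) (hxe : x ∈ segment ℝ (q e.1) (q e.2)) :
    ∃ w, (w = v ∨ w = z) ∧ (w = e.1 ∨ w = e.2) ∧ x = q w := by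
  rcases h.diag e he x hx hxe with rfl | rfl
  · exact ⟨v, Or.inl rfl, h.simple.vertex_on_edge (by simp) he hxe, rfl⟩
  · exact ⟨z, Or.inr rfl, h.simple.vertex_on_edge (by simp) he hxe, rfl⟩

lemma simpleA (h : Diagonal q v z l₁ l₂) : SimpleLoop q (v :: z :: l₂) := by
  have hsub : (v :: z :: l₂).Sublist (v :: l₁ ++ z :: l₂) := by simp
  refine ⟨h.simple.nodup.sublist hsub, fun a ha b hb => h.simple.inj a (hsub.subset ha) b
    (hsub.subset hb), ?_⟩
  intro e he e' he' hee x hx hx'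
  rw [mem_cycA_iff] at he he'
  rcases he with rfl | he
  · rcases he' with rfl | he'
    · exact absurd rfl hee
    · exact h.diag' (mem_cyc_iff.2 (Or.inr he')) hx hx'
  · rcases he' with rfl | he'
    · obtain ⟨w, h1, h2, h3⟩ := h.diag' (mem_cyc_iff.2 (Or.inr he)) hx' hx
      exact ⟨w, h2, h1, h3⟩
    · exact h.simple.inter e (mem_cyc_iff.2 (Or.inr he)) e'
        (mem_cyc_iff.2 (Or.inr he')) hee x hx hx'

lemma offA (h : Diagonal q v z l₁ l₂) {e : V × V} (he : e ∈ pathEdges (v :: l₁ ++ [z])) {x : E2}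
    (hx : x ∈ segment ℝ (q e.1) (q e.2)) (hv : x ≠ q v) (hz : x ≠ q z) :
    OffSegs q (cyc (v :: z :: l₂)) x := by
  intro e' he' hx'
  have hel := mem_cyc_iff (l₂ := l₂).2 (Or.inl he)
  rw [mem_cycA_iff] at he'
  rcases he' with rfl | he'
  · rcases h.diag e hel x hx' hx with h1 | h1
    · exact hv h1
    · exact hz h1
  · have hnd := cyc_nodup h.simple.nodup
    rw [cyc_split] at hnd
    have hee : e ≠ e' := by
      rintro rfl
      exact (List.disjoint_of_nodup_append hnd) he he'
    obtain ⟨w, h1, h2, h3⟩ := h.simple.inter e hel e'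
        (mem_cyc_iff.2 (Or.inr he')) hee x hx hx'
    have m1 : w ∈ v :: l₁ ++ [z] := by
      rcases h1 with rfl | rfl
      · exact (mem_of_mem_pathEdges he).1
      · exact (mem_of_mem_pathEdges he).2
    have m2 : w ∈ z :: l₂ ++ [v] := by
      rcases h2 with rfl | rfl
      · exact (mem_of_mem_pathEdges he').1
      · exact (mem_of_mem_pathEdges he').2
    have hwv : w ≠ v := by rintro rfl; exact hv h3
    have hwz : w ≠ z := by rintro rfl; exact hz h3
    simp [hwv, hwz] at m1 m2
    have hn := List.disjoint_of_nodup_append h.simple.nodup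
    exact hn (List.mem_cons_of_mem v m1) (List.mem_cons_of_mem z m2)

lemma nodup_path (h : Diagonal q v z l₁ l₂) : (v :: l₁ ++ [z]).Nodup := by
  refine List.Nodup.sublist ?_ h.simple.nodup
  simp

lemma zero_on_path (h : Diagonal q v z l₁ l₂)
    (hA : ∃ e ∈ pathEdges (v :: l₁ ++ [z]), ∃ x ∈ segment ℝ (q e.1) (q e.2),
      OffSegs q (cyc (v :: z :: l₂)) x ∧ winding q (cyc (v :: z :: l₂)) x = 0)
    {e : V × V} (he : e ∈ pathEdges (v :: l₁ ++ [z])) {x : E2}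
    (hx : x ∈ segment ℝ (q e.1) (q e.2)) (hv : x ≠ q v) (hz : x ≠ q z) :
    winding q (cyc (v :: z :: l₂)) x = 0 := by
  obtain ⟨e', he', x', hx', hoff, hzero⟩ := hA
  rw [← hzero]
  refine path_const (f := winding q (cyc (v :: z :: l₂)))
    (O := {x | OffSegs q (cyc (v :: z :: l₂)) x}) ?_ z l₁ v ?_ ?_ e he e' he' x hx
    (h.offA he hx hv hz) x' hx' hoff
  · intro S hS hc x hx y hy
    exact winding_cyc_const hc.isPreconnected hS hx hy
  · intro e he x hx
    have hne := pathEdges_ne h.nodup_path e he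
    have hel := mem_cyc_iff (l₂ := l₂).2 (Or.inl he)
    have hqne : q e.1 ≠ q e.2 := fun h' =>
      hne (h.simple.inj _ (mem_of_mem_cyc hel).1 _ (mem_of_mem_cyc hel).2 h')
    have key : ∀ w ∈ v :: l₁ ++ z :: l₂, x ≠ q w := by
      rintro w hw rfl
      rcases h.simple.vertex_on_edge hw hel (openSegment_subset_segment _ _ _ hx) with rfl | rfl
      · exact hqne (left_mem_openSegment_iff.1 hx)
      · exact hqne (right_mem_openSegment_iff.1 hx)
    exact h.offA he (openSegment_subset_segment _ _ _ hx) (key v (by simp)) (key z (by simp))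
  · intro c hc
    have : c ∈ v :: l₁ := List.mem_cons_of_mem _ hc
    rw [← pathEdges_map_fst (v :: l₁) z, List.mem_map] at this
    obtain ⟨e, he, rfl⟩ := this
    have hel := mem_cyc_iff (l₂ := l₂).2 (Or.inl he)
    have hnd := h.nodup_path
    refine h.offA he (left_mem_segment ℝ _ _) ?_ ?_
    · intro heq
      have := h.simple.inj _ (mem_of_mem_cyc hel).1 v (by simp) heq
      rw [this] at hc
      simp [hc] at hnd
    · intro heq
      have := h.simple.inj _ (mem_of_mem_cyc hel).1 z (by simp) heq
      rw [this] at hc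
      rw [List.cons_append, List.nodup_cons] at hnd
      exact List.disjoint_of_nodup_append hnd.2 hc (by simp)

lemma overlap_aux (h : Diagonal q v z l₁ l₂)
    (hA : ∃ e ∈ pathEdges (v :: l₁ ++ [z]), ∃ x ∈ segment ℝ (q e.1) (q e.2),
      OffSegs q (cyc (v :: z :: l₂)) x ∧ winding q (cyc (v :: z :: l₂)) x = 0)
    (hB : ∃ e ∈ pathEdges (z :: l₂ ++ [v]), ∃ x ∈ segment ℝ (q e.1) (q e.2),
      OffSegs q (cyc (z :: v :: l₁)) x ∧ winding q (cyc (z :: v :: l₁)) x = 0)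
    {x : E2} (hg : orient (q v) (q z) x ≠ 0) :
    winding q (cyc (v :: z :: l₂)) x = 0 ∨ winding q (cyc (z :: v :: l₁)) x = 0 := by
  set E := q z - q v with hE
  set g := orient (q v) (q z) x with hgdef
  have hN := nsq_pos (sub_ne_zero.2 h.q_ne.symm)
  rw [← hE] at hN
  set R : ℝ → E2 := fun t => x + t • (g • rot E) with hR
  have hR0 : R 0 = x := by simp [hR]
  have hRc : Continuous R := by simp only [hR]; fun_prop
  have hRo : ∀ t, orient (q v) (q z) (R t) = g * (1 + t * nsq E) := by
    intro t
    simp only [hR]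
    rw [orient_add_smul, ← hE, det2_smul_right, det2_rot, ← hgdef]
    ring
  have hRo' : ∀ t, 0 ≤ t → orient (q v) (q z) (R t) ≠ 0 := by
    intro t ht
    rw [hRo]
    have : 0 < 1 + t * nsq E := by positivity
    exact mul_ne_zero hg this.ne'
  have hRD : ∀ t, 0 ≤ t → R t ∉ segment ℝ (q v) (q z) := fun t ht hm =>
    hRo' t ht (orient_eq_zero_of_mem_segment hm)
  have hRv : ∀ t, 0 ≤ t → R t ≠ q v := by
    intro t ht he
    exact hRD t ht (he ▸ left_mem_segment ℝ _ _)
  have hRz : ∀ t, 0 ≤ t → R t ≠ q z := by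
    intro t ht he
    exact hRD t ht (he ▸ right_mem_segment ℝ _ _)
  set S : Set ℝ := {t | 0 ≤ t ∧ ∃ e ∈ cyc (v :: l₁ ++ z :: l₂), R t ∈ segment ℝ (q e.1) (q e.2)}
    with hS
  have offA' : ∀ t, 0 ≤ t → t ∉ S → OffSegs q (cyc (v :: z :: l₂)) (R t) := by
    intro t ht hts e he hme
    rcases mem_cycA_iff.1 he with rfl | he
    · exact hRD t ht hme
    · exact hts ⟨ht, e, mem_cyc_iff.2 (Or.inr he), hme⟩
  have offB' : ∀ t, 0 ≤ t → t ∉ S → OffSegs q (cyc (z :: v :: l₁)) (R t) := by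
    intro t ht hts e he hme
    rcases mem_cycA_iff.1 he with rfl | he
    · rw [segment_symm] at hme
      exact hRD t ht hme
    · exact hts ⟨ht, e, mem_cyc_iff.2 (Or.inl he), hme⟩
  rcases S.eq_empty_or_nonempty with hemp | hne
  · left
    obtain ⟨B, hB⟩ := exists_le_of_list (v :: z :: l₂) fun w => g * det2 E (q w - x)
    set t := (|B| + 1) / (g ^ 2 * nsq E) with ht
    have hg2 : 0 < g ^ 2 * nsq E := by positivity
    have ht0 : 0 ≤ t := by positivity
    have h1 : winding q (cyc (v :: z :: l₂)) (R t) = 0 := by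
      apply winding_halfPlane (d := -(g • E))
      intro w hw
      have h2 := hB w hw
      have h3 : det2 (-(g • E)) (q w - R t) = t * (g ^ 2 * nsq E) - g * det2 E (q w - x) := by
        rw [← det2_rot]
        simp only [hR]
        simp [det2]
        ring
      rw [h3, ht, div_mul_cancel₀ _ hg2.ne']
      have := le_abs_self B
      linarith
    rw [← h1, ← hR0]
    refine winding_cyc_const (S := R '' (Ici 0)) ?_ ?_ ⟨0, by simp, rfl⟩ ⟨t, ht0, rfl⟩
    · exact (convex_Ici 0).isPreconnected.image _ hRc.continuousOn
    · rintro _ ⟨s, hs, rfl⟩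
      exact offA' s hs (by simp [hemp])
  · have hcl : IsClosed S := by
      have : S = Ici 0 ∩ R ⁻¹' (⋃ e ∈ {e | e ∈ cyc (v :: l₁ ++ z :: l₂)},
          segment ℝ (q e.1) (q e.2)) := by
        ext t; simp [hS]
      rw [this]
      exact isClosed_Ici.inter (((List.finite_toSet _).isClosed_biUnion
        fun e _ => isClosed_segment _ _).preimage hRc)
    have hbd : BddBelow S := ⟨0, fun t ht => ht.1⟩
    obtain ⟨ht0, e, he, hme⟩ := hcl.csInf_mem hne hbd
    set t := sInf S
    have hlt : ∀ s, s < t → s ∉ S := fun s hs => notMem_of_lt_csInf hs hbd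
    have hpre : IsPreconnected (R '' Icc 0 t) :=
      (convex_Icc 0 t).isPreconnected.image _ hRc.continuousOn
    rcases mem_cyc_iff.1 he with he | he
    · left
      rw [← h.zero_on_path hA he hme (hRv t ht0) (hRz t ht0), ← hR0]
      refine winding_cyc_const hpre ?_ ⟨0, by simp [ht0], rfl⟩ ⟨t, by simp [ht0], rfl⟩
      rintro _ ⟨s, hs, rfl⟩
      rcases hs.2.lt_or_eq with hs' | rfl
      · exact offA' s hs.1 (hlt s hs')
      · exact h.offA he hme (hRv _ ht0) (hRz _ ht0)
    · right
      rw [← h.symm.zero_on_path hB he hme (hRz t ht0) (hRv t ht0), ← hR0]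
      refine winding_cyc_const hpre ?_ ⟨0, by simp [ht0], rfl⟩ ⟨t, by simp [ht0], rfl⟩
      rintro _ ⟨s, hs, rfl⟩
      rcases hs.2.lt_or_eq with hs' | rfl
      · exact offB' s hs.1 (hlt s hs')
      · exact h.symm.offA he hme (hRz _ ht0) (hRv _ ht0)

lemma overlap (h : Diagonal q v z l₁ l₂)
    (hA : ∃ e ∈ pathEdges (v :: l₁ ++ [z]), ∃ x ∈ segment ℝ (q e.1) (q e.2),
      OffSegs q (cyc (v :: z :: l₂)) x ∧ winding q (cyc (v :: z :: l₂)) x = 0)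
    (hB : ∃ e ∈ pathEdges (z :: l₂ ++ [v]), ∃ x ∈ segment ℝ (q e.1) (q e.2),
      OffSegs q (cyc (z :: v :: l₁)) x ∧ winding q (cyc (z :: v :: l₁)) x = 0)
    {x : E2} (hxA : OffSegs q (cyc (v :: z :: l₂)) x) (hxB : OffSegs q (cyc (z :: v :: l₁)) x) :
    winding q (cyc (v :: z :: l₂)) x = 0 ∨ winding q (cyc (z :: v :: l₁)) x = 0 := by
  obtain ⟨y, ⟨h1, h2⟩, h5⟩ := exists_near_orient_ne h.q_ne
    ((winding_eventually_eq hxA).and (winding_eventually_eq hxB))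
  rw [← h1, ← h2]
  exact h.overlap_aux hA hB h5

lemma offSegs_mid (h : Diagonal q v z l₁ l₂) :
    OffSegs q (cyc (v :: l₁ ++ z :: l₂)) (midpoint ℝ (q v) (q z)) := by
  intro e he hm
  rcases h.diag e he _ (midpoint_mem_segment _ _) hm with h1 | h1
  · rw [midpoint_eq_left_iff] at h1
    exact h.q_ne h1
  · rw [midpoint_eq_right_iff] at h1
    exact h.q_ne h1

lemma viewAngle_near_mid (h : Diagonal q v z l₁ l₂) : ∃ δ₀ > 0, ∀ δ : ℝ, 0 < δ → δ < δ₀ →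
    π / 2 < viewAngle (q v) (q z) (midpoint ℝ (q v) (q z) + δ • rot (q z - q v)) ∧
    viewAngle (q v) (q z) (midpoint ℝ (q v) (q z) + δ • rot (q z - q v)) < π := by
  have hN := nsq_pos (sub_ne_zero.2 h.q_ne.symm)
  refine ⟨1 / 2, by norm_num, fun δ h0 h1 => ?_⟩
  have hdet : det2 (q v - (midpoint ℝ (q v) (q z) + δ • rot (q z - q v)))
      (q z - (midpoint ℝ (q v) (q z) + δ • rot (q z - q v))) = δ * nsq (q z - q v) := by
    simp [midpoint_eq_smul_add, det2, rot, nsq]; ring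
  have hdot : dot2 (q v - (midpoint ℝ (q v) (q z) + δ • rot (q z - q v)))
      (q z - (midpoint ℝ (q v) (q z) + δ • rot (q z - q v))) =
      (δ ^ 2 - 1 / 4) * nsq (q z - q v) := by
    simp [midpoint_eq_smul_add, dot2, rot, nsq]; ring
  have hpos : 0 < det2 (q v - (midpoint ℝ (q v) (q z) + δ • rot (q z - q v)))
      (q z - (midpoint ℝ (q v) (q z) + δ • rot (q z - q v))) := by rw [hdet]; positivity
  refine ⟨pi_div_two_lt_turn hpos ?_, turn_lt_pi hpos⟩
  rw [hdot]
  have : δ ^ 2 < 1 / 4 := by nlinarith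
  nlinarith

end Diagonal

end Diagonals

section Split

variable {V : Type*}

lemma winding_cycA (q : V → E2) (v z : V) (l : List V) (x : E2) :
    winding q (cyc (v :: z :: l)) x =
      viewAngle (q v) (q z) x + winding q (pathEdges (z :: l ++ [v])) x := by
  rw [cyc_cons]; simp

namespace Diagonal

variable {q : V → E2} {v z : V} {l₁ l₂ : List V}

lemma offSegs_iff {x : E2} (hx : x ∉ segment ℝ (q v) (q z)) :
    OffSegs q (cyc (v :: l₁ ++ z :: l₂)) x ↔
      OffSegs q (cyc (v :: z :: l₂)) x ∧ OffSegs q (cyc (z :: v :: l₁)) x := by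
  constructor
  · intro h
    constructor
    · intro e he
      rcases mem_cycA_iff.1 he with rfl | he
      · exact hx
      · exact h e (mem_cyc_iff.2 (Or.inr he))
    · intro e he
      rcases mem_cycA_iff.1 he with rfl | he
      · rwa [segment_symm]
      · exact h e (mem_cyc_iff.2 (Or.inl he))
  · rintro ⟨hA, hB⟩ e he
    rcases mem_cyc_iff.1 he with he | he
    · exact hB e (mem_cycA_iff.2 (Or.inr he))
    · exact hA e (mem_cycA_iff.2 (Or.inr he))

lemma winding_add {x : E2} (hx : x ∉ segment ℝ (q v) (q z)) :
    winding q (cyc (v :: l₁ ++ z :: l₂)) x =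
      winding q (cyc (v :: z :: l₂)) x + winding q (cyc (z :: v :: l₁)) x := by
  rw [cyc_split, winding_append, winding_cycA, winding_cycA, viewAngle_swap hx]
  ring

lemma jump (h : Diagonal q v z l₁ l₂) : ∃ x y, OffSegs q (cyc (v :: z :: l₂)) x ∧
    OffSegs q (cyc (z :: v :: l₁)) x ∧ OffSegs q (cyc (v :: z :: l₂)) y ∧
    OffSegs q (cyc (z :: v :: l₁)) y ∧
    winding q (cyc (v :: z :: l₂)) x = winding q (cyc (v :: z :: l₂)) y + 2 * π ∧
    winding q (cyc (z :: v :: l₁)) x = winding q (cyc (z :: v :: l₁)) y - 2 * π := by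
  set m := midpoint ℝ (q v) (q z) with hm
  set N := rot (q z - q v) with hNdef
  have hN := nsq_pos (sub_ne_zero.2 h.q_ne.symm)
  have hoff := h.offSegs_mid
  have hA : OffSegs q (pathEdges (z :: l₂ ++ [v])) m := fun e he =>
    hoff e (mem_cyc_iff.2 (Or.inr he))
  have hB : OffSegs q (pathEdges (v :: l₁ ++ [z])) m := fun e he =>
    hoff e (mem_cyc_iff.2 (Or.inl he))
  have near : ∀ᶠ y in nhds m, OffSegs q (cyc (v :: l₁ ++ z :: l₂)) y ∧
      |winding q (pathEdges (z :: l₂ ++ [v])) y -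
        winding q (pathEdges (z :: l₂ ++ [v])) m| < π / 2 ∧
      |winding q (pathEdges (v :: l₁ ++ [z])) y - winding q (pathEdges (v :: l₁ ++ [z])) m|
        < π / 2 := by
    refine (offSegs_eventually hoff).and (Filter.Eventually.and ?_ ?_)
    · have := Metric.tendsto_nhds.1 (winding_continuousAt hA).tendsto (π / 2) (by positivity)
      simpa [Real.dist_eq] using this
    · have := Metric.tendsto_nhds.1 (winding_continuousAt hB).tendsto (π / 2) (by positivity)
      simpa [Real.dist_eq] using this
  obtain ⟨δ₁, hδ₁, hv1⟩ := h.viewAngle_near_mid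
  obtain ⟨δ₂, hδ₂, hv2⟩ := h.symm.viewAngle_near_mid
  have t1 : Filter.Tendsto (fun t : ℝ => m + t • N) (nhdsWithin 0 (Ioi 0)) (nhds m) := by
    have : ContinuousAt (fun t : ℝ => m + t • N) 0 := by fun_prop
    have := this.tendsto
    simp only [zero_smul, add_zero] at this
    exact this.mono_left nhdsWithin_le_nhds
  have t2 : Filter.Tendsto (fun t : ℝ => m - t • N) (nhdsWithin 0 (Ioi 0)) (nhds m) := by
    have : ContinuousAt (fun t : ℝ => m - t • N) 0 := by fun_prop
    have := this.tendsto
    simp only [zero_smul, sub_zero] at this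
    exact this.mono_left nhdsWithin_le_nhds
  have hlt : ∀ᶠ t : ℝ in nhdsWithin 0 (Ioi 0), t < min δ₁ δ₂ :=
    nhdsWithin_le_nhds (Iio_mem_nhds (lt_min hδ₁ hδ₂))
  obtain ⟨δ, ⟨⟨⟨hx0, hxA, hxB⟩, hy0, hyA, hyB⟩, hδ⟩, hδ0⟩ :=
    ((((t1.eventually near).and (t2.eventually near)).and hlt).and self_mem_nhdsWithin).exists
  have hδ0 : 0 < δ := hδ0
  have a1 := hv1 δ hδ0 (hδ.trans_le (min_le_left _ _))
  have a2 := hv2 δ hδ0 (hδ.trans_le (min_le_right _ _))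
  have hrot : midpoint ℝ (q z) (q v) + δ • rot (q v - q z) = m - δ • N := by
    have hneg : rot (q v - q z) = -N := by
      ext i; fin_cases i <;> simp [rot, hNdef]
    rw [midpoint_comm, ← hm, hneg, smul_neg, ← sub_eq_add_neg]
  rw [← hm, ← hNdef] at a1
  rw [hrot] at a2
  set x := m + δ • N with hx
  set y := m - δ • N with hy
  have ox : orient (q v) (q z) x ≠ 0 := by
    rw [hx, orient_add_smul, det2_rot, orient_eq_zero_of_mem_segment (midpoint_mem_segment _ _),
      zero_add]
    positivity
  have oy : orient (q v) (q z) y ≠ 0 := by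
    rw [hy, orient_sub_smul, det2_rot, orient_eq_zero_of_mem_segment (midpoint_mem_segment _ _),
      zero_sub]
    have : 0 < δ * nsq (q z - q v) := by positivity
    linarith [neg_ne_zero.2 this.ne']
  have sx : x ∉ segment ℝ (q v) (q z) := fun hh => ox (orient_eq_zero_of_mem_segment hh)
  have sy : y ∉ segment ℝ (q v) (q z) := fun hh => oy (orient_eq_zero_of_mem_segment hh)
  obtain ⟨xA, xB⟩ := (offSegs_iff sx).1 hx0
  obtain ⟨yA, yB⟩ := (offSegs_iff sy).1 hy0
  have cxA := winding_cyc_coe _ (offSegs_ne xA)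
  have cxB := winding_cyc_coe _ (offSegs_ne xB)
  have cyA := winding_cyc_coe _ (offSegs_ne yA)
  have cyB := winding_cyc_coe _ (offSegs_ne yB)
  have vy : viewAngle (q v) (q z) y = - viewAngle (q z) (q v) y :=
    viewAngle_swap (by rwa [segment_symm])
  have vx : viewAngle (q z) (q v) x = - viewAngle (q v) (q z) x := viewAngle_swap sx
  refine ⟨x, y, xA, xB, yA, yB, ?_, ?_⟩
  · have := eq_two_pi_of_coe_eq_zero (t := winding q (cyc (v :: z :: l₂)) x -
      winding q (cyc (v :: z :: l₂)) y) (by rw [Real.Angle.coe_sub, cxA, cyA, sub_zero])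
      (by rw [winding_cycA, winding_cycA, vy]; linarith [abs_lt.1 hxA, abs_lt.1 hyA])
      (by rw [winding_cycA, winding_cycA, vy]; linarith [abs_lt.1 hxA, abs_lt.1 hyA, pi_pos])
    linarith
  · have := eq_two_pi_of_coe_eq_zero (t := winding q (cyc (z :: v :: l₁)) y -
      winding q (cyc (z :: v :: l₁)) x) (by rw [Real.Angle.coe_sub, cxB, cyB, sub_zero])
      (by rw [winding_cycA, winding_cycA, vx]; linarith [abs_lt.1 hxB, abs_lt.1 hyB])
      (by rw [winding_cycA, winding_cycA, vx]; linarith [abs_lt.1 hxB, abs_lt.1 hyB, pi_pos])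
    linarith

lemma triangulable (h : Diagonal q v z l₁ l₂)
    (hA : ∃ e ∈ pathEdges (v :: l₁ ++ [z]), ∃ x ∈ segment ℝ (q e.1) (q e.2),
      OffSegs q (cyc (v :: z :: l₂)) x ∧ winding q (cyc (v :: z :: l₂)) x = 0)
    (hB : ∃ e ∈ pathEdges (z :: l₂ ++ [v]), ∃ x ∈ segment ℝ (q e.1) (q e.2),
      OffSegs q (cyc (z :: v :: l₁)) x ∧ winding q (cyc (z :: v :: l₁)) x = 0)
    (gA : Triangulable q (v :: z :: l₂)) (gB : Triangulable q (z :: v :: l₁)) :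
    Triangulable q (v :: l₁ ++ z :: l₂) := by
  obtain ⟨σ, hσ, TA, hTA⟩ := gA
  obtain ⟨σ', hσ', TB, hTB⟩ := gB
  have hss : σ' = σ := by
    obtain ⟨x, y, xA, xB, yA, yB, h1, h2⟩ := h.jump
    have o1 := h.overlap hA hB xA xB
    have o2 := h.overlap hA hB yA yB
    have b1 := hTA.winding x xA
    have b2 := hTA.winding y yA
    have b3 := hTB.winding x xB
    have b4 := hTB.winding y yB
    have hp := pi_pos
    rcases hσ with rfl | rfl <;> rcases hσ' with rfl | rfl <;> try rfl
    · exfalso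
      rcases o1 with o1 | o1 <;> rcases b1 with b1 | b1 <;> rcases b2 with b2 | b2 <;>
        rcases b3 with b3 | b3 <;> rcases b4 with b4 | b4 <;> linarith
    · exfalso
      rcases o2 with o2 | o2 <;> rcases b1 with b1 | b1 <;> rcases b2 with b2 | b2 <;>
        rcases b3 with b3 | b3 <;> rcases b4 with b4 | b4 <;> linarith
  subst hss
  refine ⟨σ', hσ, TA ++ TB, ?_, ?_, ?_, ?_⟩
  · intro α hα
    rw [List.map_append, List.sum_append, hTA.bdry_sum α hα, hTB.bdry_sum α hα, cyc_split,
      cyc_cons, cyc_cons]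
    simp [hα v z]
    ring
  · intro t ht
    rcases List.mem_append.1 ht with ht | ht
    · exact hTA.orient_pos t ht
    · exact hTB.orient_pos t ht
  · intro t ht
    rcases List.mem_append.1 ht with ht | ht
    · obtain ⟨s, hs, hsl⟩ := hTA.sublist t ht
      exact ⟨s, hs, hsl.trans (by simp)⟩
    · obtain ⟨s, hs, hsl⟩ := hTB.sublist t ht
      obtain ⟨s₁, s₂, rfl, h1, h2⟩ := List.sublist_append_iff.1
        (show s.Sublist ([z] ++ (v :: l₁)) from hsl)
      exact ⟨s₂ ++ s₁, List.isRotated_append.trans hs, h2.append (h1.trans (by simp))⟩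
  · have main : ∀ x, x ∉ segment ℝ (q v) (q z) → OffSegs q (cyc (v :: l₁ ++ z :: l₂)) x →
        winding q (cyc (v :: l₁ ++ z :: l₂)) x = 0 ∨
        winding q (cyc (v :: l₁ ++ z :: l₂)) x = 2 * π * σ' := by
      intro x hx hoff
      obtain ⟨xA, xB⟩ := (offSegs_iff hx).1 hoff
      rw [winding_add hx]
      rcases h.overlap hA hB xA xB with h0 | h0
      · rw [h0, zero_add]
        exact hTB.winding x xB
      · rw [h0, add_zero]
        exact hTA.winding x xA
    intro x hoff
    obtain ⟨y, ⟨h1, h2⟩, h3⟩ := exists_near_orient_ne h.q_ne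
      ((winding_eventually_eq hoff).and (offSegs_eventually hoff))
    rw [← h1]
    exact main y (fun hh => h3 (orient_eq_zero_of_mem_segment hh)) h2

end Diagonal

end Split

section Bary

/-- The barycentric coordinate of `x` with respect to `u` in the triangle `v u w`. -/
def bary (v u w x : E2) : ℝ := det2 (x - v) (w - v) / det2 (u - v) (w - v)

lemma bary_comb (v u w a b : E2) {s t : ℝ} (h : s + t = 1) :
    bary v u w (s • a + t • b) = s * bary v u w a + t * bary v u w b := by
  obtain rfl : s = 1 - t := by linarith
  unfold bary
  rw [mul_div_assoc', mul_div_assoc', ← add_div]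
  congr 1
  simp [det2]
  ring

@[simp] lemma bary_base (v u w : E2) : bary v u w v = 0 := by simp [bary, det2]
@[simp] lemma bary_right (v u w : E2) : bary v u w w = 0 := by simp [bary]
lemma bary_left {v u w : E2} (h : det2 (u - v) (w - v) ≠ 0) : bary v u w u = 1 := div_self h

lemma bary_add_smul (v u w x d : E2) (t : ℝ) :
    bary v u w (x + t • d) = bary v u w x + t * (det2 d (w - v) / det2 (u - v) (w - v)) := by
  unfold bary
  rw [mul_div_assoc', ← add_div]
  congr 1
  simp [det2]
  ring

lemma eq_bary {v u w : E2} (h : det2 (u - v) (w - v) ≠ 0) (x : E2) :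
    x = v + (bary v u w x • (u - v) + bary v w u x • (w - v)) := by
  have h' : det2 (w - v) (u - v) ≠ 0 := by rw [det2_swap]; exact neg_ne_zero.2 h
  have e : det2 (w - v) (u - v) = -det2 (u - v) (w - v) := det2_swap _ _
  unfold bary
  rw [e]
  ext i
  fin_cases i
  · simp only [Fin.zero_eta, PiLp.add_apply, PiLp.smul_apply, PiLp.sub_apply, smul_eq_mul]
    field_simp
    simp [det2]
    ring
  · simp only [Fin.mk_one, PiLp.add_apply, PiLp.smul_apply, PiLp.sub_apply, smul_eq_mul]
    field_simp
    simp [det2]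
    ring

lemma mem_segment_of_bary {v u w x : E2} (h : det2 (u - v) (w - v) ≠ 0)
    (h0 : bary v w u x = 0) (h1 : 0 ≤ bary v u w x) (h2 : bary v u w x ≤ 1) :
    x ∈ segment ℝ v u := by
  refine ⟨1 - bary v u w x, bary v u w x, by linarith, h1, by ring, ?_⟩
  conv_rhs => rw [eq_bary h x, h0]
  module

lemma det2_ne_swap {a b : E2} (h : det2 a b ≠ 0) : det2 b a ≠ 0 := by
  rw [det2_swap]; exact neg_ne_zero.2 h

lemma exit_triangle {v u w x b : E2} (h : det2 (u - v) (w - v) ≠ 0)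
    (hu : 0 ≤ bary v u w x) (hw : 0 ≤ bary v w u x) (hl : bary v u w x + bary v w u x ≤ 1)
    (hb : bary v u w b + bary v w u b ≤ 1) (hb' : bary v u w b < 0 ∨ bary v w u b < 0) :
    ∃ y ∈ segment ℝ x b, y ∈ segment ℝ v u ∨ y ∈ segment ℝ v w := by
  have hR : ∀ t : ℝ, bary v u w ((1 - t) • x + t • b) =
      (1 - t) * bary v u w x + t * bary v u w b := fun t => bary_comb _ _ _ _ _ (by ring)
  have hR' : ∀ t : ℝ, bary v w u ((1 - t) • x + t • b) =
      (1 - t) * bary v w u x + t * bary v w u b := fun t => bary_comb _ _ _ _ _ (by ring)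
  obtain ⟨t, ht, hft⟩ : (0 : ℝ) ∈ (fun t : ℝ => min (bary v u w ((1 - t) • x + t • b))
      (bary v w u ((1 - t) • x + t • b))) '' Icc 0 1 := by
    apply intermediate_value_Icc' zero_le_one
    · simp only [hR, hR']
      fun_prop
    · simp only [hR, hR']
      constructor
      · simpa using hb'.imp le_of_lt le_of_lt
      · simp [hu, hw]
  have hlam : bary v u w ((1 - t) • x + t • b) + bary v w u ((1 - t) • x + t • b) ≤ 1 := by
    rw [hR, hR']
    nlinarith [ht.1, ht.2]
  refine ⟨(1 - t) • x + t • b, ⟨1 - t, t, by linarith [ht.2], ht.1, by ring, rfl⟩, ?_⟩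
  set y := (1 - t) • x + t • b
  rcases min_choice (bary v u w y) (bary v w u y) with h1 | h1
  · right
    have e1 : bary v u w y = 0 := by rw [← h1]; exact hft
    have e2 : 0 ≤ bary v w u y := by rw [← hft]; exact min_le_right _ _
    exact mem_segment_of_bary (det2_ne_swap h) e1 e2 (by linarith)
  · left
    have e1 : bary v w u y = 0 := by rw [← h1]; exact hft
    have e2 : 0 ≤ bary v u w y := by rw [← hft]; exact min_le_left _ _
    exact mem_segment_of_bary h e1 e2 (by linarith)

lemma eq_left_of_mem_segment {a b x : E2} (hx : x ∈ segment ℝ a b) (ha : a ∈ segment ℝ x b) :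
    x = a := by
  rw [mem_segment_iff_wbtw] at hx ha
  exact ((Wbtw.swap_left_iff hx).1 ha).symm

lemma det2_rot_left (p y : E2) : det2 (rot p) y = -dot2 y p := by
  simp [det2, rot, dot2]; ring

variable {V : Type*}

lemma wedge {q : V → E2} {L : List V} {p u w : E2} (hD : det2 (u - p) (w - p) ≠ 0)
    (hw : dot2 (w - p) p < 0) (hext : ∀ x ∈ L, dot2 (q x - p) p ≤ 0)
    (hseg : ∀ e ∈ cyc L, p ∉ segment ℝ (q e.1) (q e.2) ∨
      ∀ y ∈ segment ℝ (q e.1) (q e.2), 0 < bary p w u y ∨ bary p w u y = 0 ∧ bary p u w y ≤ 0) :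
    ∃ x ∈ segment ℝ p u, OffSegs q (cyc L) x ∧ winding q (cyc L) x = 0 := by
  classical
  have hoff : OffSegs q ((cyc L).filter fun e => p ∉ segment ℝ (q e.1) (q e.2)) p := by
    intro e he
    simpa using (List.mem_filter.1 he).2
  obtain ⟨r, hr, hball⟩ := Metric.eventually_nhds_iff_ball.1 (offSegs_eventually hoff)
  set B := ‖u - p‖ + ‖w - p‖ + 1 with hB
  have hBpos : 0 < B := by positivity
  set ε := min (1 / 2) (r / (2 * B)) with hε
  have hε0 : 0 < ε := by positivity
  have hε1 : ε ≤ 1 / 2 := min_le_left _ _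
  have hεB : ε * B < r := by
    have : ε * B ≤ r / (2 * B) * B := mul_le_mul_of_nonneg_right (min_le_right _ _) hBpos.le
    have h2 : r / (2 * B) * B = r / 2 := by field_simp
    linarith
  set γ : ℝ → E2 := fun t => p + ε • ((1 - t) • (u - p) - t • (w - p)) with hγ
  have hγc : Continuous γ := by simp only [hγ]; fun_prop
  have hbu : ∀ t, bary p u w (γ t) = ε * (1 - t) := by
    intro t
    simp only [hγ]
    rw [bary_add_smul, bary_base, det2_sub_left, det2_smul_left, det2_smul_left, det2_self]
    field_simp
    ring
  have hbw : ∀ t, bary p w u (γ t) = -(ε * t) := by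
    intro t
    have hD' := det2_ne_swap hD
    simp only [hγ]
    rw [bary_add_smul, bary_base, det2_sub_left, det2_smul_left, det2_smul_left, det2_self]
    field_simp
    ring
  have hγoff : ∀ t ∈ Icc (0 : ℝ) 1, OffSegs q (cyc L) (γ t) := by
    intro t ht e he hmem
    rcases hseg e he with h1 | h1
    · refine hball (γ t) ?_ e (List.mem_filter.2 ⟨he, by simpa using h1⟩) hmem
      rw [mem_ball_iff_norm, hγ]
      simp only [add_sub_cancel_left]
      rw [norm_smul, Real.norm_of_nonneg hε0.le]
      refine lt_of_le_of_lt (mul_le_mul_of_nonneg_left ?_ hε0.le) hεB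
      calc ‖(1 - t) • (u - p) - t • (w - p)‖ ≤ ‖(1 - t) • (u - p)‖ + ‖t • (w - p)‖ :=
            norm_sub_le _ _
        _ = (1 - t) * ‖u - p‖ + t * ‖w - p‖ := by
          rw [norm_smul, norm_smul, Real.norm_of_nonneg (by linarith [ht.2]),
            Real.norm_of_nonneg ht.1]
        _ ≤ B := by
          nlinarith [norm_nonneg (u - p), norm_nonneg (w - p), ht.1, ht.2]
    · rcases h1 _ hmem with h2 | ⟨h2, h3⟩
      · rw [hbw] at h2
        have := mul_nonneg hε0.le ht.1
        linarith
      · rw [hbw] at h2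
        rw [hbu] at h3
        have h4 : t = 0 := by
          have : ε * t = 0 := by linarith
          rcases mul_eq_zero.1 this with h | h
          · exact absurd h hε0.ne'
          · exact h
        rw [h4] at h3
        linarith
  refine ⟨γ 0, ?_, hγoff 0 (by simp), ?_⟩
  · refine ⟨1 - ε, ε, by linarith, hε0.le, by ring, ?_⟩
    simp only [hγ]
    module
  · have h1 : winding q (cyc L) (γ 1) = 0 := by
      apply winding_halfPlane (d := rot p)
      intro x hx
      have : det2 (rot p) (q x - γ 1) = -dot2 (q x - p) p - ε * dot2 (w - p) p := by
        rw [det2_rot_left]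
        simp [dot2, hγ]
        ring
      rw [this]
      nlinarith [hext x hx]
    refine Eq.trans ?_ h1
    refine winding_cyc_const (S := γ '' Icc 0 1)
      ((convex_Icc 0 1).isPreconnected.image _ hγc.continuousOn) ?_ ⟨0, by simp, rfl⟩
      ⟨1, by simp, rfl⟩
    rintro _ ⟨t, ht, rfl⟩
    exact hγoff t ht

end Bary

section Ears

variable {V : Type*}

lemma pathEdges_interior {w u : V} {l : List V} (hl : l ≠ []) {e : V × V}
    (he : e ∈ pathEdges (w :: l ++ [u])) : e.1 ∈ l ∨ e.2 ∈ l := by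
  cases l with
  | nil => exact absurd rfl hl
  | cons c l =>
    rw [List.cons_append, List.cons_append, pathEdges_cons_cons] at he
    rcases List.mem_cons.1 he with rfl | he
    · simp
    · left
      rw [← List.cons_append] at he
      rw [← pathEdges_map_fst (c :: l) u]
      exact List.mem_map_of_mem he

lemma triangulable_three {q : V → E2} {a b c : V} (h : SimpleLoop q [a, b, c]) :
    Triangulable q [a, b, c] := by
  have h0 := h.orient_ne_zero
  have hb : ∀ α : V → V → ℝ, ([(a, b, c)].map (bdry α)).sum =
      ((cyc [a, b, c]).map fun e => α e.1 e.2).sum := by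
    intro α
    simp [bdry, cyc_cons]
    ring
  have hs : ∀ t ∈ [(a, b, c)], ∃ s : List V, s ~r [t.1, t.2.1, t.2.2] ∧
      s.Sublist [a, b, c] := by
    intro t ht
    rw [List.mem_singleton] at ht
    subst ht
    exact ⟨_, List.IsRotated.refl _, List.Sublist.refl _⟩
  have hw : ∀ x, winding q (cyc [a, b, c]) x = triW (q a) (q b) (q c) x := by
    intro x
    simp [cyc_cons, triW]; ring
  have hoff : ∀ x, OffSegs q (cyc [a, b, c]) x → x ∉ segment ℝ (q a) (q b) ∧
      x ∉ segment ℝ (q b) (q c) ∧ x ∉ segment ℝ (q c) (q a) := by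
    intro x hx
    exact ⟨hx (a, b) (by simp [cyc_cons]), hx (b, c) (by simp [cyc_cons]),
      hx (c, a) (by simp [cyc_cons])⟩
  rcases lt_or_gt_of_ne h0 with h1 | h1
  · refine ⟨-1, Or.inr rfl, [(a, b, c)], fun α _ => hb α, ?_, hs, ?_⟩
    · intro t ht
      rw [List.mem_singleton] at ht
      subst ht
      linarith
    · intro x hx
      obtain ⟨x1, x2, x3⟩ := hoff x hx
      have e : triW (q a) (q b) (q c) x = -triW (q b) (q a) (q c) x := by
        unfold triW
        rw [viewAngle_swap x1, viewAngle_swap x2, viewAngle_swap x3]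
        ring
      have h2 : 0 < orient (q b) (q a) (q c) := by rw [orient_swap]; linarith
      rw [segment_symm] at x1 x2 x3
      rw [hw, e]
      by_cases hx : 0 < orient (q b) (q a) x ∧ 0 < orient (q a) (q c) x ∧ 0 < orient (q c) (q b) x
      · right
        rw [triW_eq_two_pi hx.1 hx.2.1 hx.2.2]
        ring
      · left
        rw [triW_eq_zero h2 x1 x3 x2 hx, neg_zero]
  · refine ⟨1, Or.inl rfl, [(a, b, c)], fun α _ => hb α, ?_, hs, ?_⟩
    · intro t ht
      rw [List.mem_singleton] at ht
      subst ht
      linarith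
    · intro x hx
      obtain ⟨x1, x2, x3⟩ := hoff x hx
      rw [hw]
      by_cases hx : 0 < orient (q a) (q b) x ∧ 0 < orient (q b) (q c) x ∧ 0 < orient (q c) (q a) x
      · right
        rw [triW_eq_two_pi hx.1 hx.2.1 hx.2.2]
        ring
      · left
        exact triW_eq_zero h1 x1 x2 x3 hx

lemma winding_eq_zero_of_halfPlane {q : V → E2} {x d : E2} (l : List V)
    (h : ∀ v ∈ l, 0 < det2 d (q v - x)) :
    OffSegs q (cyc l) x ∧ winding q (cyc l) x = 0 :=
  ⟨offSegs_halfPlane _ fun _ he => ⟨h _ (mem_of_mem_cyc he).1, h _ (mem_of_mem_cyc he).2⟩,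
    winding_halfPlane l h⟩

lemma exists_halfPlane_of_outside {v u w c : E2} (h : det2 (u - v) (w - v) ≠ 0)
    (hc : ¬ (0 ≤ bary v u w c ∧ 0 ≤ bary v w u c ∧ bary v u w c + bary v w u c ≤ 1)) :
    ∃ d, 0 < det2 d (v - c) ∧ 0 < det2 d (u - c) ∧ 0 < det2 d (w - c) := by
  have key : ∀ y, det2 ((-(1 / det2 (u - v) (w - v))) • (w - v)) (y - c) =
      bary v u w y - bary v u w c := by
    intro y
    unfold bary
    rw [← sub_div, det2_smul_left, div_eq_mul_one_div (_ - _)]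
    simp [det2]
    ring
  have key' : ∀ y, det2 ((-(1 / det2 (w - v) (u - v))) • (u - v)) (y - c) =
      bary v w u y - bary v w u c := by
    intro y
    unfold bary
    rw [← sub_div, det2_smul_left, div_eq_mul_one_div (_ - _)]
    simp [det2]
    ring
  have h' := det2_ne_swap h
  rw [not_and_or, not_and_or, not_le, not_le, not_le] at hc
  rcases hc with hc | hc | hc
  · refine ⟨(-(1 / det2 (u - v) (w - v))) • (w - v), ?_, ?_, ?_⟩
    all_goals rw [key]
    · simpa using hc
    · rw [bary_left h]; linarith
    · simpa using hc
  · refine ⟨(-(1 / det2 (w - v) (u - v))) • (u - v), ?_, ?_, ?_⟩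
    all_goals rw [key']
    · simpa using hc
    · simpa using hc
    · rw [bary_left h']; linarith
  · refine ⟨-((-(1 / det2 (u - v) (w - v))) • (w - v) + (-(1 / det2 (w - v) (u - v))) • (u - v)),
      ?_, ?_, ?_⟩
    all_goals
      rw [← neg_one_smul ℝ, det2_smul_left, det2_add_left, key, key']
    · simp; linarith
    · rw [bary_left h, bary_right]; linarith
    · rw [bary_left h', bary_right]; linarith

lemma ear_diagonal {q : V → E2} {u v w : V} {l : List V}
    (hs : SimpleLoop q (u :: [v] ++ w :: l)) (hl : l ≠ [])
    (hD : det2 (q u - q v) (q w - q v) ≠ 0)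
    (hout : ∀ c ∈ l, ¬ (0 ≤ bary (q v) (q u) (q w) (q c) ∧ 0 ≤ bary (q v) (q w) (q u) (q c) ∧
      bary (q v) (q u) (q w) (q c) + bary (q v) (q w) (q u) (q c) ≤ 1)) :
    Diagonal q u w [v] l := by
  refine ⟨hs, ?_⟩
  have hD' := det2_ne_swap hD
  have huv : (u, v) ∈ cyc (u :: [v] ++ w :: l) := Diagonal.mem_cyc_iff.2 (Or.inl (by simp))
  have hvw : (v, w) ∈ cyc (u :: [v] ++ w :: l) := Diagonal.mem_cyc_iff.2 (Or.inl (by simp))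
  have hnd := hs.nodup
  simp only [List.cons_append, List.nil_append, List.nodup_cons, List.mem_cons, not_or] at hnd
  obtain ⟨⟨nuv, nuw, nul⟩, ⟨nvw, nvl⟩, nwl, -⟩ := hnd
  intro e he x hx hxe
  by_contra hcon
  push Not at hcon
  obtain ⟨hxu, hxw⟩ := hcon
  obtain ⟨s, t, hs0, ht0, hst, hxst⟩ := hx
  have bu : bary (q v) (q u) (q w) x = s := by
    rw [← hxst, bary_comb _ _ _ _ _ hst, bary_left hD, bary_right]; ring
  have bw : bary (q v) (q w) (q u) x = t := by
    rw [← hxst, bary_comb _ _ _ _ _ hst, bary_left hD', bary_right]; ring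
  have hs1 : s ≠ 0 := by
    rintro rfl
    obtain rfl : t = 1 := by linarith
    exact hxw (by rw [← hxst]; simp)
  have ht1 : t ≠ 0 := by
    rintro rfl
    obtain rfl : s = 1 := by linarith
    exact hxu (by rw [← hxst]; simp)
  rcases Diagonal.mem_cyc_iff.1 he with he' | he'
  · simp only [List.cons_append, List.nil_append, pathEdges_cons_cons, pathEdges_singleton,
      List.mem_cons, List.not_mem_nil, or_false] at he'
    rcases he' with rfl | rfl
    · obtain ⟨s', t', -, -, hst', hx'⟩ := hxe
      apply ht1
      rw [← bw, ← hx', bary_comb _ _ _ _ _ hst']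
      simp
    · obtain ⟨s', t', -, -, hst', hx'⟩ := hxe
      apply hs1
      rw [← bu, ← hx', bary_comb _ _ _ _ _ hst']
      simp
  · have m1 : ∀ d, (d = e.1 ∨ d = e.2) → d = w ∨ d ∈ l ∨ d = u := by
      rintro d hd
      have h1 := mem_of_mem_pathEdges he'
      have : d ∈ w :: l ++ [u] := by
        rcases hd with rfl | rfl
        · exact h1.1
        · exact h1.2
      simpa [or_assoc] using this
    have claim : ∀ c d, c ∈ l → (d = w ∨ d ∈ l ∨ d = u) → x ∈ segment ℝ (q d) (q c) →
        bary (q v) (q u) (q w) (q c) + bary (q v) (q w) (q u) (q c) ≤ 1 ∨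
        (d ∈ l ∧ bary (q v) (q u) (q w) (q d) + bary (q v) (q w) (q u) (q d) ≤ 1) := by
      rintro c d hc hd ⟨s', t', hs', ht', hst', hx'⟩
      by_contra hcon
      rw [not_or, not_and, not_le] at hcon
      obtain ⟨h1, h2⟩ := hcon
      have f1 := bary_comb (q v) (q u) (q w) (q d) (q c) hst'
      have f2 := bary_comb (q v) (q w) (q u) (q d) (q c) hst'
      rw [hx', bu] at f1
      rw [hx', bw] at f2
      rcases hd with rfl | hd | rfl
      · rw [bary_right] at f1
        rw [bary_left hD'] at f2
        have : t' = 0 := by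
          by_contra h0
          have : 0 < t' := lt_of_le_of_ne ht' (Ne.symm h0)
          nlinarith
        subst this
        obtain rfl : s' = 1 := by linarith
        exact hxw (by rw [← hx']; simp)
      · have h3 := h2 hd
        rw [not_le] at h3
        have : s' = 0 := by
          by_contra h0
          have : 0 < s' := lt_of_le_of_ne hs' (Ne.symm h0)
          nlinarith
        subst this
        obtain rfl : t' = 1 := by linarith
        linarith
      · rw [bary_left hD] at f1
        rw [bary_right] at f2
        have : t' = 0 := by
          by_contra h0
          have : 0 < t' := lt_of_le_of_ne ht' (Ne.symm h0)
          nlinarith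
        subst this
        obtain rfl : s' = 1 := by linarith
        exact hxu (by rw [← hx']; simp)
    have final : ∀ a b, (a, b) = e ∨ (b, a) = e → b ∈ l →
        bary (q v) (q u) (q w) (q b) + bary (q v) (q w) (q u) (q b) ≤ 1 → False := by
      intro a b hab hb hlam
      have hxab : x ∈ segment ℝ (q a) (q b) := by
        rcases hab with rfl | rfl
        · exact hxe
        · rw [segment_symm]; exact hxe
      have hsub : segment ℝ x (q b) ⊆ segment ℝ (q e.1) (q e.2) := by
        have : segment ℝ x (q b) ⊆ segment ℝ (q a) (q b) :=
          (convex_segment _ _).segment_subset hxab (right_mem_segment ℝ _ _)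
        rcases hab with rfl | rfl
        · exact this
        · rw [segment_symm ℝ (q (b, a).1)]; exact this
      have hneg : bary (q v) (q u) (q w) (q b) < 0 ∨ bary (q v) (q w) (q u) (q b) < 0 := by
        have := hout b hb
        by_contra hcon
        rw [not_or, not_lt, not_lt] at hcon
        exact this ⟨hcon.1, hcon.2, hlam⟩
      have hends : ∀ k, (k = e.1 ∨ k = e.2) → k = a ∨ k = b := by
        rintro k hk
        rcases hab with rfl | rfl
        · exact hk
        · exact hk.symm
      have nve : ∀ k, (k = e.1 ∨ k = e.2) → k ≠ v := by
        rintro k hk rfl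
        rcases m1 k hk with h | h | h
        · exact nvw h
        · exact nvl h
        · exact nuv h.symm
      obtain ⟨y, hy, hyuw⟩ := exit_triangle hD (bu ▸ hs0) (bw ▸ ht0)
        (by rw [bu, bw]; exact hst.le) hlam hneg
      rcases hyuw with hy' | hy'
      · have hne : e ≠ (u, v) := by
          rintro rfl
          exact nve v (Or.inr rfl) rfl
        rw [segment_symm] at hy'
        obtain ⟨k, h1, h2, h3⟩ := hs.inter e he (u, v) huv hne y (hsub hy) hy'
        rcases h2 with rfl | rfl
        · rcases hends _ h1 with rfl | rfl
          · exact hxu (eq_left_of_mem_segment hxab (h3 ▸ hy))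
          · exact nul hb
        · exact nve _ h1 rfl
      · have hne : e ≠ (v, w) := by
          rintro rfl
          exact nve v (Or.inl rfl) rfl
        obtain ⟨k, h1, h2, h3⟩ := hs.inter e he (v, w) hvw hne y (hsub hy) hy'
        rcases h2 with rfl | rfl
        · exact nve _ h1 rfl
        · rcases hends _ h1 with rfl | rfl
          · exact hxw (eq_left_of_mem_segment hxab (h3 ▸ hy))
          · exact nwl hb
    rcases pathEdges_interior hl he' with hc | hc
    · rw [segment_symm] at hxe
      rcases claim e.1 e.2 hc (m1 _ (Or.inr rfl)) hxe with h1 | ⟨h1, h2⟩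
      · exact final e.2 e.1 (Or.inr rfl) hc h1
      · exact final e.1 e.2 (Or.inl rfl) h1 h2
    · rcases claim e.2 e.1 hc (m1 _ (Or.inl rfl)) hxe with h1 | ⟨h1, h2⟩
      · exact final e.1 e.2 (Or.inl rfl) hc h1
      · exact final e.2 e.1 (Or.inr rfl) h1 h2

lemma ear_triangulable {q : V → E2} {u v w : V} {l : List V}
    (hs : SimpleLoop q (u :: [v] ++ w :: l)) (hl : l ≠ [])
    (hD : det2 (q u - q v) (q w - q v) ≠ 0)
    (hext : ∀ x ∈ u :: [v] ++ w :: l, x ≠ v → dot2 (q x - q v) (q v) < 0)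
    (hout : ∀ c ∈ l, ¬ (0 ≤ bary (q v) (q u) (q w) (q c) ∧ 0 ≤ bary (q v) (q w) (q u) (q c) ∧
      bary (q v) (q u) (q w) (q c) + bary (q v) (q w) (q u) (q c) ≤ 1))
    (hA : Triangulable q (u :: w :: l)) (hB : Triangulable q (w :: u :: [v])) :
    Triangulable q (u :: [v] ++ w :: l) := by
  have hdiag := ear_diagonal hs hl hD hout
  have hnd := hs.nodup
  simp only [List.cons_append, List.nil_append, List.nodup_cons, List.mem_cons, not_or] at hnd
  obtain ⟨⟨nuv, nuw, nul⟩, ⟨nvw, nvl⟩, nwl, -⟩ := hnd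
  refine hdiag.triangulable ?_ ?_ hA hB
  · refine ⟨(u, v), by simp, q v, right_mem_segment ℝ _ _, ?_⟩
    apply winding_eq_zero_of_halfPlane (d := rot (q v))
    intro x hx
    rw [det2_rot_left, neg_pos]
    apply hext
    · simp at hx ⊢; tauto
    · rintro rfl
      simp only [List.mem_cons] at hx
      rcases hx with h | h | h
      · exact nuv h.symm
      · exact nvw h
      · exact nvl h
  · cases l with
    | nil => exact absurd rfl hl
    | cons c l =>
      obtain ⟨d, h1, h2, h3⟩ := exists_halfPlane_of_outside hD (hout c (by simp))
      refine ⟨(w, c), by simp, q c, right_mem_segment ℝ _ _, ?_⟩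
      apply winding_eq_zero_of_halfPlane (d := d)
      intro x hx
      simp only [List.mem_cons, List.not_mem_nil, or_false] at hx
      rcases hx with rfl | rfl | rfl <;> assumption

end Ears

section Chord

variable {V : Type*} {q : V → E2} {v u w z : V} {a b : List V}

lemma mem_pathEdges_chord_left {e : V × V} : e ∈ pathEdges (v :: (w :: a) ++ [z]) ↔
    e = (v, w) ∨ e ∈ pathEdges (w :: a ++ [z]) := by
  simp

lemma mem_pathEdges_chord_right {e : V × V} : e ∈ pathEdges (z :: (b ++ [u]) ++ [v]) ↔
    e = (u, v) ∨ e ∈ pathEdges (z :: b ++ [u]) := by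
  have := pathEdges_append (z :: b) [v] u
  simp only [List.cons_append, List.append_assoc, List.nil_append] at this ⊢
  rw [this]
  simp [or_comm]

lemma chord_diagonal (hs : SimpleLoop q (v :: (w :: a) ++ z :: (b ++ [u])))
    (hD : det2 (q u - q v) (q w - q v) ≠ 0)
    (hz1 : 0 < bary (q v) (q u) (q w) (q z)) (hz2 : 0 < bary (q v) (q w) (q u) (q z))
    (hz3 : bary (q v) (q u) (q w) (q z) + bary (q v) (q w) (q u) (q z) ≤ 1)
    (hmin : ∀ c ∈ a ++ b, 0 ≤ bary (q v) (q u) (q w) (q c) → 0 ≤ bary (q v) (q w) (q u) (q c) →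
      bary (q v) (q u) (q w) (q z) + bary (q v) (q w) (q u) (q z) ≤
        bary (q v) (q u) (q w) (q c) + bary (q v) (q w) (q u) (q c)) :
    Diagonal q v z (w :: a) (b ++ [u]) := by
  refine ⟨hs, ?_⟩
  have hD' := det2_ne_swap hD
  have hnd := hs.nodup
  simp only [List.cons_append, List.nodup_cons, List.mem_cons, List.mem_append, not_or] at hnd
  have nvw : v ≠ w := hnd.1.1
  have nvu : v ≠ u := by
    have := hnd.1.2.2.2.2
    tauto
  have nva : v ∉ a := hnd.1.2.1
  have nvz : v ≠ z := hnd.1.2.2.1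
  have nvb : v ∉ b := hnd.1.2.2.2.1
  have hvw : (v, w) ∈ cyc (v :: (w :: a) ++ z :: (b ++ [u])) :=
    Diagonal.mem_cyc_iff.2 (Or.inl (mem_pathEdges_chord_left.2 (Or.inl rfl)))
  have huv : (u, v) ∈ cyc (v :: (w :: a) ++ z :: (b ++ [u])) :=
    Diagonal.mem_cyc_iff.2 (Or.inr (mem_pathEdges_chord_right.2 (Or.inl rfl)))
  intro e he x hx hxe
  by_contra hcon
  push Not at hcon
  obtain ⟨hxv, hxz⟩ := hcon
  obtain ⟨s, t, hs0, ht0, hst, hxst⟩ := hx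
  have bu : bary (q v) (q u) (q w) x = t * bary (q v) (q u) (q w) (q z) := by
    rw [← hxst, bary_comb _ _ _ _ _ hst, bary_base]; ring
  have bw : bary (q v) (q w) (q u) x = t * bary (q v) (q w) (q u) (q z) := by
    rw [← hxst, bary_comb _ _ _ _ _ hst, bary_base]; ring
  have hs1 : 0 < s := by
    refine lt_of_le_of_ne hs0 ?_
    rintro rfl
    obtain rfl : t = 1 := by linarith
    exact hxz (by rw [← hxst]; simp)
  have ht1 : 0 < t := by
    refine lt_of_le_of_ne ht0 ?_
    rintro rfl
    obtain rfl : s = 1 := by linarith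
    exact hxv (by rw [← hxst]; simp)
  have main : (∀ d, (d = e.1 ∨ d = e.2) → d = w ∨ d = z ∨ d = u ∨ d ∈ a ++ b) → False := by
    intro hends
    have hlt : bary (q v) (q u) (q w) x + bary (q v) (q w) (q u) x <
        bary (q v) (q u) (q w) (q z) + bary (q v) (q w) (q u) (q z) := by
      rw [bu, bw]
      nlinarith
    obtain ⟨k, hk, hkσ⟩ : ∃ k, (k = e.1 ∨ k = e.2) ∧
        bary (q v) (q u) (q w) (q k) + bary (q v) (q w) (q u) (q k) ≤
          bary (q v) (q u) (q w) x + bary (q v) (q w) (q u) x := by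
      obtain ⟨s', t', hs', ht', hst', hx'⟩ := hxe
      by_contra hcon
      push Not at hcon
      have h1 := hcon e.1 (Or.inl rfl)
      have h2 := hcon e.2 (Or.inr rfl)
      have f1 := bary_comb (q v) (q u) (q w) (q e.1) (q e.2) hst'
      have f2 := bary_comb (q v) (q w) (q u) (q e.1) (q e.2) hst'
      rw [hx'] at f1 f2
      rcases hs'.lt_or_eq with h | h
      · nlinarith
      · subst h
        obtain rfl : t' = 1 := by linarith
        linarith
    have hkab : k ∈ a ++ b := by
      rcases hends k hk with rfl | rfl | rfl | h
      · rw [bary_left hD', bary_right] at hkσ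
        linarith
      · linarith
      · rw [bary_left hD, bary_right] at hkσ
        linarith
      · exact h
    have hneg : bary (q v) (q u) (q w) (q k) < 0 ∨ bary (q v) (q w) (q u) (q k) < 0 := by
      by_contra hcon
      rw [not_or, not_lt, not_lt] at hcon
      have := hmin k hkab hcon.1 hcon.2
      linarith
    have nve : ∀ k, (k = e.1 ∨ k = e.2) → k ≠ v := by
      rintro k hk rfl
      rcases hends k hk with h | h | h | h
      · exact nvw h
      · exact nvz h
      · exact nvu h
      · rcases List.mem_append.1 h with h | h
        · exact nva h
        · exact nvb h
    have hsub : segment ℝ x (q k) ⊆ segment ℝ (q e.1) (q e.2) := by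
      apply (convex_segment _ _).segment_subset hxe
      rcases hk with rfl | rfl
      · exact left_mem_segment ℝ _ _
      · exact right_mem_segment ℝ _ _
    obtain ⟨y, hy, hyuw⟩ := exit_triangle hD (by rw [bu]; positivity) (by rw [bw]; positivity)
      (by linarith) (by linarith) hneg
    have hyσ : bary (q v) (q u) (q w) y + bary (q v) (q w) (q u) y < 1 := by
      obtain ⟨s', t', hs', ht', hst', hy'⟩ := hy
      have f1 := bary_comb (q v) (q u) (q w) x (q k) hst'
      have f2 := bary_comb (q v) (q w) (q u) x (q k) hst'
      rw [hy'] at f1 f2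
      nlinarith
    rcases hyuw with hy' | hy'
    · have hne : e ≠ (u, v) := by
        rintro rfl
        exact nve v (Or.inr rfl) rfl
      rw [segment_symm] at hy'
      obtain ⟨c, h1, h2, h3⟩ := hs.inter e he (u, v) huv hne y (hsub hy) hy'
      rcases h2 with rfl | rfl
      · rw [h3, bary_left hD, bary_right] at hyσ
        linarith
      · exact nve _ h1 rfl
    · have hne : e ≠ (v, w) := by
        rintro rfl
        exact nve v (Or.inl rfl) rfl
      obtain ⟨c, h1, h2, h3⟩ := hs.inter e he (v, w) hvw hne y (hsub hy) hy'
      rcases h2 with rfl | rfl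
      · exact nve _ h1 rfl
      · rw [h3, bary_left hD', bary_right] at hyσ
        linarith
  rcases Diagonal.mem_cyc_iff.1 he with he' | he'
  · rcases mem_pathEdges_chord_left.1 he' with rfl | he'
    · obtain ⟨s', t', -, -, hst', hx'⟩ := hxe
      have : bary (q v) (q u) (q w) x = 0 := by
        rw [← hx', bary_comb _ _ _ _ _ hst']
        simp
      have h2 : 0 < bary (q v) (q u) (q w) x := by rw [bu]; positivity
      linarith
    · apply main
      rintro d hd
      have h1 := mem_of_mem_pathEdges he'
      have : d ∈ w :: a ++ [z] := by
        rcases hd with rfl | rfl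
        · exact h1.1
        · exact h1.2
      simp at this ⊢
      tauto
  · rcases mem_pathEdges_chord_right.1 he' with rfl | he'
    · obtain ⟨s', t', -, -, hst', hx'⟩ := hxe
      have : bary (q v) (q w) (q u) x = 0 := by
        rw [← hx', bary_comb _ _ _ _ _ hst']
        simp
      have h2 : 0 < bary (q v) (q w) (q u) x := by rw [bw]; positivity
      linarith
    · apply main
      rintro d hd
      have h1 := mem_of_mem_pathEdges he'
      have : d ∈ z :: b ++ [u] := by
        rcases hd with rfl | rfl
        · exact h1.1
        · exact h1.2
      simp at this ⊢
      tauto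

lemma chord_triangulable (hs : SimpleLoop q (v :: (w :: a) ++ z :: (b ++ [u])))
    (hD : det2 (q u - q v) (q w - q v) ≠ 0)
    (hext : ∀ x ∈ v :: (w :: a) ++ z :: (b ++ [u]), x ≠ v → dot2 (q x - q v) (q v) < 0)
    (hz1 : 0 < bary (q v) (q u) (q w) (q z)) (hz2 : 0 < bary (q v) (q w) (q u) (q z))
    (hz3 : bary (q v) (q u) (q w) (q z) + bary (q v) (q w) (q u) (q z) ≤ 1)
    (hmin : ∀ c ∈ a ++ b, 0 ≤ bary (q v) (q u) (q w) (q c) → 0 ≤ bary (q v) (q w) (q u) (q c) →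
      bary (q v) (q u) (q w) (q z) + bary (q v) (q w) (q u) (q z) ≤
        bary (q v) (q u) (q w) (q c) + bary (q v) (q w) (q u) (q c))
    (hA : Triangulable q (v :: z :: (b ++ [u]))) (hB : Triangulable q (z :: v :: (w :: a))) :
    Triangulable q (v :: (w :: a) ++ z :: (b ++ [u])) := by
  have hD' := det2_ne_swap hD
  have hdiag := chord_diagonal hs hD hz1 hz2 hz3 hmin
  have hnd := hs.nodup
  simp only [List.cons_append, List.nodup_cons, List.mem_cons, List.mem_append, not_or] at hnd
  have nvw : v ≠ w := hnd.1.1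
  have nvu : v ≠ u := by
    have := hnd.1.2.2.2.2
    tauto
  have nva : v ∉ a := hnd.1.2.1
  have nvz : v ≠ z := hnd.1.2.2.1
  have nvb : v ∉ b := hnd.1.2.2.2.1
  have hext0 : ∀ x ∈ v :: (w :: a) ++ z :: (b ++ [u]), dot2 (q x - q v) (q v) ≤ 0 := by
    intro x hx
    by_cases hxv : x = v
    · subst hxv; simp [dot2]
    · exact (hext x hx hxv).le
  refine hdiag.triangulable ?_ ?_ hA hB
  · refine ⟨(v, w), by simp, wedge hD' (hext u (by simp) nvu.symm) ?_ ?_⟩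
    · intro x hx
      apply hext0
      simp at hx ⊢
      tauto
    · intro e he
      rcases Diagonal.mem_cycA_iff.1 he with rfl | he'
      · right
        rintro y ⟨s, t, hs0, ht0, hst, rfl⟩
        rw [bary_comb _ _ _ _ _ hst, bary_comb _ _ _ _ _ hst, bary_base, bary_base]
        rcases ht0.lt_or_eq with ht | rfl
        · left; simp; positivity
        · right; simp
      · rcases mem_pathEdges_chord_right.1 he' with rfl | he''
        · right
          rintro y ⟨s, t, hs0, ht0, hst, rfl⟩
          rw [bary_comb _ _ _ _ _ hst, bary_comb _ _ _ _ _ hst, bary_base, bary_base,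
            bary_left hD, bary_right]
          rcases hs0.lt_or_eq with ht | rfl
          · left; simp; positivity
          · right; simp
        · left
          intro hmem
          have h1 := mem_of_mem_pathEdges he''
          have : v ∈ z :: b ++ [u] := by
            rcases hs.vertex_on_edge (v := v) (by simp) (Diagonal.mem_cyc_iff.2 (Or.inr he')) hmem
              with h | h
            · exact h ▸ h1.1
            · exact h ▸ h1.2
          simp at this
          tauto
  · refine ⟨(u, v), by rw [mem_pathEdges_chord_right]; simp, ?_⟩
    have := wedge (q := q) (L := z :: v :: (w :: a)) hD (hext w (by simp) nvw.symm) ?_ ?_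
    · obtain ⟨x, hx, h⟩ := this
      exact ⟨x, by rw [segment_symm]; exact hx, h⟩
    · intro x hx
      apply hext0
      simp at hx ⊢
      tauto
    · intro e he
      rcases Diagonal.mem_cycA_iff.1 he with rfl | he'
      · right
        rintro y ⟨s, t, hs0, ht0, hst, rfl⟩
        rw [bary_comb _ _ _ _ _ hst, bary_comb _ _ _ _ _ hst, bary_base, bary_base]
        rcases hs0.lt_or_eq with ht | rfl
        · left; simp; positivity
        · right; simp
      · rcases mem_pathEdges_chord_left.1 he' with rfl | he''
        · right
          rintro y ⟨s, t, hs0, ht0, hst, rfl⟩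
          rw [bary_comb _ _ _ _ _ hst, bary_comb _ _ _ _ _ hst, bary_base, bary_base,
            bary_left hD', bary_right]
          rcases ht0.lt_or_eq with ht | rfl
          · left; simp; positivity
          · right; simp
        · left
          intro hmem
          have h1 := mem_of_mem_pathEdges he''
          have : v ∈ w :: a ++ [z] := by
            rcases hs.vertex_on_edge (by simp) (Diagonal.mem_cyc_iff.2 (Or.inl he')) hmem
              with h | h
            · exact h ▸ h1.1
            · exact h ▸ h1.2
          simp at this
          tauto

lemma extreme_vertex (q : V → E2) {l : List V} (hl : l ≠ [])
    (hinj : ∀ a ∈ l, ∀ b ∈ l, q a = q b → a = b) :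
    ∃ v ∈ l, ∀ x ∈ l, x ≠ v → dot2 (q x - q v) (q v) < 0 := by
  obtain ⟨v, hv, hmax⟩ := Set.exists_max_image {x | x ∈ l} (fun x => nsq (q x))
    (List.finite_toSet l) (by
      obtain ⟨x, hx⟩ := List.exists_mem_of_ne_nil l hl
      exact ⟨x, hx⟩)
  refine ⟨v, hv, fun x hx hxv => ?_⟩
  have h1 := hmax x hx
  have h2 : 0 < nsq (q x - q v) := nsq_pos (sub_ne_zero.2 fun h => hxv (hinj _ hx _ hv h))
  simp only [nsq, dot2, PiLp.sub_apply] at *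
  nlinarith

lemma det2_ne_zero_of_extreme {p x y : E2} (hx : dot2 (x - p) p < 0) (hy : dot2 (y - p) p < 0)
    (h1 : y ∉ segment ℝ p x) (h2 : x ∉ segment ℝ y p) : det2 (x - p) (y - p) ≠ 0 := by
  intro h0
  rcases exists_mem_segment_of_collinear (a := y) (b := p) (c := x)
    (by rw [← orient_rotate]; exact h0) with h | h | h
  · obtain ⟨s, t, hs, ht, hst, he⟩ := h
    have : s * dot2 (y - p) p + t * dot2 (x - p) p = 0 := by
      have e0 : s • (y - p) + t • (x - p) = 0 := by
        rw [smul_sub, smul_sub, sub_add_sub_comm, he, ← add_smul, hst, one_smul, sub_self]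
      have := congrArg (fun u => dot2 u p) e0
      simp [dot2] at this ⊢
      linarith
    rcases hs.lt_or_eq with h | rfl
    · nlinarith
    · obtain rfl : t = 1 := by linarith
      linarith
  · exact h1 h
  · exact h2 h

lemma SimpleLoop.exists_rotation {l : List V} (hl : 3 ≤ l.length) (hs : SimpleLoop q l) :
    ∃ (l₁ l₂ : List V) (v w u : V) (m : List V), l = l₁ ++ l₂ ∧ l₂ ++ l₁ = v :: w :: (m ++ [u]) ∧
      ∀ x ∈ l, x ≠ v → dot2 (q x - q v) (q v) < 0 := by
  obtain ⟨v, hv, hext⟩ := extreme_vertex q (l := l) (by rintro rfl; simp at hl) hs.inj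
  obtain ⟨l₁, l₂, rfl⟩ := List.append_of_mem hv
  refine ⟨l₁, v :: l₂, v, ?_⟩
  have hlen : 2 ≤ (l₂ ++ l₁).length := by
    simp at hl ⊢; omega
  rcases hL : l₂ ++ l₁ with _ | ⟨w, m⟩
  · rw [hL] at hlen; simp at hlen
  · rcases List.eq_nil_or_concat m with rfl | ⟨m, u, rfl⟩
    · rw [hL] at hlen; simp at hlen
    · refine ⟨w, u, m, rfl, ?_, hext⟩
      rw [List.cons_append, hL]
      simp

theorem SimpleLoop.triangulable {l : List V} (hl : 3 ≤ l.length) (hs : SimpleLoop q l) :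
    Triangulable q l := by
  induction hn : l.length using Nat.strong_induction_on generalizing l with
  | _ n ih =>
  subst hn
  obtain ⟨l₁, l₂, v, w, u, m, rfl, hrot, hext⟩ := hs.exists_rotation hl
  apply Triangulable.rotate
  have hs' := hs.rotate
  have hlen : (l₁ ++ l₂).length = (v :: w :: (m ++ [u])).length := by
    rw [← hrot]; simp [add_comm]
  have hext' : ∀ x ∈ v :: w :: (m ++ [u]), x ≠ v → dot2 (q x - q v) (q v) < 0 := by
    intro x hx
    apply hext
    rw [← hrot] at hx
    simp at hx ⊢
    tauto
  rw [hlen] at ih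
  rw [hrot] at hs' ⊢
  clear hlen hext hrot hs hl
  have hnd := hs'.nodup
  have nvw : v ≠ w := by
    rintro rfl; simp at hnd
  have nvu : v ≠ u := by
    rintro rfl; simp at hnd
  have nwu : w ≠ u := by
    rintro rfl; simp at hnd
  have hcyc : ∀ e, e ∈ cyc (v :: w :: (m ++ [u])) ↔
      e = (v, w) ∨ e = (u, v) ∨ e ∈ pathEdges (w :: m ++ [u]) := by
    intro e
    have := Diagonal.mem_cycA_iff (v := v) (z := w) (l₂ := m ++ [u]) (e := e)
    rw [this, mem_pathEdges_chord_right]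
  have hvw : (v, w) ∈ cyc (v :: w :: (m ++ [u])) := by rw [hcyc]; simp
  have huv : (u, v) ∈ cyc (v :: w :: (m ++ [u])) := by rw [hcyc]; simp
  have hD : det2 (q u - q v) (q w - q v) ≠ 0 := by
    apply det2_ne_zero_of_extreme (hext' u (by simp) nvu.symm) (hext' w (by simp) nvw.symm)
    · intro h
      rw [segment_symm] at h
      rcases hs'.vertex_on_edge (by simp) huv h with h | h
      · exact nwu h
      · exact nvw h.symm
    · intro h
      rw [segment_symm] at h
      rcases hs'.vertex_on_edge (by simp) hvw h with h | h
      · exact nvu h.symm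
      · exact nwu h.symm
  have hD' := det2_ne_swap hD
  set In : V → Prop := fun c => 0 ≤ bary (q v) (q u) (q w) (q c) ∧
    0 ≤ bary (q v) (q w) (q u) (q c) ∧
    bary (q v) (q u) (q w) (q c) + bary (q v) (q w) (q u) (q c) ≤ 1 with hIn
  rcases (Set.eq_empty_or_nonempty {c | c ∈ m ∧ In c}) with hemp | hne
  · by_cases hm : m = []
    · subst hm
      exact triangulable_three hs'
    · apply Triangulable.rotate (l₁ := [u]) (l₂ := v :: w :: m)
      have hs'' := SimpleLoop.rotate (l₁ := v :: w :: m) (l₂ := [u]) hs'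
      have hlen : m.length ≠ 0 := fun h => hm (List.length_eq_zero_iff.1 h)
      have hout : ∀ c ∈ m, ¬ In c := by
        intro c hc hin
        have : c ∈ {c | c ∈ m ∧ In c} := ⟨hc, hin⟩
        rw [hemp] at this
        exact this
      have hdiag := ear_diagonal hs'' hm hD hout
      refine ear_triangulable hs'' hm hD ?_ hout ?_ ?_
      · intro x hx
        apply hext'
        simp at hx ⊢
        tauto
      · exact ih (u :: w :: m).length (by simp) (by simp; omega) hdiag.simpleA rfl
      · exact triangulable_three hdiag.symm.simpleA
  · obtain ⟨z, ⟨hzm, hz⟩, hmin⟩ := Set.exists_min_image _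
      (fun c => bary (q v) (q u) (q w) (q c) + bary (q v) (q w) (q u) (q c))
      ((List.finite_toSet m).subset (fun c hc => hc.1)) hne
    obtain ⟨a, b, rfl⟩ := List.append_of_mem hzm
    have hL : v :: w :: (a ++ z :: b ++ [u]) = v :: (w :: a) ++ z :: (b ++ [u]) := by simp
    rw [hL] at hs' hext' ih hvw huv hnd ⊢
    have nzv : z ≠ v := by rintro rfl; simp at hnd
    have nzu : z ≠ u := by
      rintro rfl
      have h3 := (List.nodup_append.1 hnd).2.1
      simp at h3
    have nzw : z ≠ w := by rintro rfl; simp at hnd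
    have hzu : 0 < bary (q v) (q u) (q w) (q z) := by
      refine lt_of_le_of_ne hz.1 fun h => ?_
      have := mem_segment_of_bary hD' h.symm hz.2.1 (by linarith [hz.2.2])
      rcases hs'.vertex_on_edge (by simp) hvw this with h | h
      · exact nzv h
      · exact nzw h
    have hzw : 0 < bary (q v) (q w) (q u) (q z) := by
      refine lt_of_le_of_ne hz.2.1 fun h => ?_
      have := mem_segment_of_bary hD h.symm hz.1 (by linarith [hz.2.2])
      rw [segment_symm] at this
      rcases hs'.vertex_on_edge (by simp) huv this with h | h
      · exact nzu h
      · exact nzv h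
    have hmin' : ∀ c ∈ a ++ b, 0 ≤ bary (q v) (q u) (q w) (q c) →
        0 ≤ bary (q v) (q w) (q u) (q c) →
        bary (q v) (q u) (q w) (q z) + bary (q v) (q w) (q u) (q z) ≤
          bary (q v) (q u) (q w) (q c) + bary (q v) (q w) (q u) (q c) := by
      intro c hc h1 h2
      by_contra hcon
      rw [not_le] at hcon
      have := hmin c ⟨by simp at hc ⊢; tauto, h1, h2, by linarith [hz.2.2]⟩
      linarith
    have hdiag := chord_diagonal hs' hD hzu hzw hz.2.2 hmin'
    refine chord_triangulable hs' hD hext' hzu hzw hz.2.2 hmin' ?_ ?_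
    · exact ih (v :: z :: (b ++ [u])).length (by simp) (by simp) hdiag.simpleA rfl
    · exact ih (z :: v :: (w :: a)).length (by simp) (by simp) hdiag.symm.simpleA rfl

end Chord

section Placement

variable {V : Type*} [Fintype V] [DecidableEq V]

/-- The vertex set of a triple. -/
def tri (t : V × V × V) : Finset V := {t.1, t.2.1, t.2.2}

/-- `w` is a system of barycentric weights supported in `A`. -/
structure Weights (A : Finset V) (w : V → ℝ) : Prop where
  nonneg : ∀ v, 0 ≤ w v
  sum_eq : ∑ v, w v = 1
  supp : ∀ v, v ∉ A → w v = 0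

/-- The point with barycentric weights `w`. -/
def pt (P : V → E2) (w : V → ℝ) : E2 := ∑ v, w v • P v

/-- `y` lies on no segment spanned by the points of `P`. -/
def Generic (P : V → E2) (y : E2) : Prop := ∀ a b, y ∉ segment ℝ (P a) (P b)

/-- The triples `𝒯` are placed positively by `P` and have boundary `E`, which winds at most once
around any point. -/
structure Placed (P : V → E2) (E : List (V × V)) (𝒯 : List (V × V × V)) : Prop where
  bdry_sum : ∀ α : V → V → ℝ, (∀ a b, α b a = -α a b) →
    (𝒯.map (bdry α)).sum = (E.map fun e => α e.1 e.2).sum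
  orient_pos : ∀ t ∈ 𝒯, 0 < orient (P t.1) (P t.2.1) (P t.2.2)
  winding_le : ∀ x, OffSegs P E x → winding P E x ≤ 2 * π
  ne : ∀ e ∈ E, P e.1 ≠ P e.2
  mem_tri : ∀ e ∈ E, ∃ t ∈ 𝒯, e.1 ∈ tri t ∧ e.2 ∈ tri t
  inter : ∀ e ∈ E, ∀ e' ∈ E, e ≠ e' → ∀ x ∈ segment ℝ (P e.1) (P e.2),
    x ∈ segment ℝ (P e'.1) (P e'.2) → ∃ v, (v = e.1 ∨ v = e.2) ∧ (v = e'.1 ∨ v = e'.2) ∧ x = P v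

omit [Fintype V] [DecidableEq V] in
lemma ne_of_orient {P : V → E2} {t : V × V × V} (h : 0 < orient (P t.1) (P t.2.1) (P t.2.2)) :
    t.1 ≠ t.2.1 ∧ t.1 ≠ t.2.2 ∧ t.2.1 ≠ t.2.2 := by
  refine ⟨fun e => ?_, fun e => ?_, fun e => ?_⟩ <;> rw [e] at h <;>
    simp [orient, det2] at h
  linarith

lemma sum_three {M : Type*} [AddCommMonoid M] {a b c : V} (hab : a ≠ b) (hac : a ≠ c) (hbc : b ≠ c)
    (f : V → M) (hf : ∀ v, v ∉ ({a, b, c} : Finset V) → f v = 0) : ∑ v, f v = f a + f b + f c := by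
  rw [← Finset.sum_subset (Finset.subset_univ {a, b, c}) (fun v _ hv => hf v hv),
    Finset.sum_insert (by simp [hab, hac]), Finset.sum_insert (by simp [hbc]),
    Finset.sum_singleton, add_assoc]

lemma Weights.three {P : V → E2} {t : V × V × V} {w : V → ℝ} (hw : Weights (tri t) w)
    (ht : 0 < orient (P t.1) (P t.2.1) (P t.2.2)) :
    w t.1 + w t.2.1 + w t.2.2 = 1 ∧
      pt P w = w t.1 • P t.1 + w t.2.1 • P t.2.1 + w t.2.2 • P t.2.2 := by
  obtain ⟨h1, h2, h3⟩ := ne_of_orient ht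
  constructor
  · rw [← hw.sum_eq, sum_three h1 h2 h3 _ hw.supp]
  · unfold pt
    rw [sum_three h1 h2 h3]
    intro v hv
    rw [hw.supp v hv, zero_smul]

omit [Fintype V] [DecidableEq V] in
lemma orient_comb (a b c : E2) {s t u : ℝ} (h : s + t + u = 1) :
    orient b c (s • a + t • b + u • c) = s * orient a b c ∧
    orient c a (s • a + t • b + u • c) = t * orient a b c ∧
    orient a b (s • a + t • b + u • c) = u * orient a b c := by
  obtain rfl : s = 1 - t - u := by linarith
  refine ⟨?_, ?_, ?_⟩ <;> simp [orient, det2] <;> ring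

lemma Weights.orient_pt {P : V → E2} {t : V × V × V} {w : V → ℝ} (hw : Weights (tri t) w)
    (ht : 0 < orient (P t.1) (P t.2.1) (P t.2.2)) :
    orient (P t.2.1) (P t.2.2) (pt P w) = w t.1 * orient (P t.1) (P t.2.1) (P t.2.2) ∧
    orient (P t.2.2) (P t.1) (pt P w) = w t.2.1 * orient (P t.1) (P t.2.1) (P t.2.2) ∧
    orient (P t.1) (P t.2.1) (pt P w) = w t.2.2 * orient (P t.1) (P t.2.1) (P t.2.2) := by
  obtain ⟨h1, h2⟩ := hw.three ht
  rw [h2]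
  exact orient_comb _ _ _ h1

lemma Weights.ext_tri {P : V → E2} {t : V × V × V} {w w' : V → ℝ} (hw : Weights (tri t) w)
    (hw' : Weights (tri t) w') (ht : 0 < orient (P t.1) (P t.2.1) (P t.2.2))
    (h : pt P w = pt P w') : w = w' := by
  obtain ⟨a1, a2, a3⟩ := hw.orient_pt ht
  obtain ⟨b1, b2, b3⟩ := hw'.orient_pt ht
  rw [h] at a1 a2 a3
  funext v
  by_cases hv : v ∈ tri t
  · simp only [tri, Finset.mem_insert, Finset.mem_singleton] at hv
    rcases hv with rfl | rfl | rfl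
    · exact mul_right_cancel₀ ht.ne' (a1.symm.trans b1)
    · exact mul_right_cancel₀ ht.ne' (a2.symm.trans b2)
    · exact mul_right_cancel₀ ht.ne' (a3.symm.trans b3)
  · rw [hw.supp v hv, hw'.supp v hv]

omit [DecidableEq V] in
lemma Weights.mono {A B : Finset V} {w : V → ℝ} (hw : Weights A w) (h : A ⊆ B) : Weights B w :=
  ⟨hw.nonneg, hw.sum_eq, fun v hv => hw.supp v fun h' => hv (h h')⟩

omit [DecidableEq V] in
lemma Weights.of_supp {A B : Finset V} {w : V → ℝ} (hw : Weights A w)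
    (h : Finset.univ.filter (fun v => w v ≠ 0) ⊆ B) : Weights B w :=
  ⟨hw.nonneg, hw.sum_eq, fun v hv => by
    by_contra h0
    exact hv (h (by simp [h0]))⟩

omit [Fintype V] [DecidableEq V] in
lemma dense_compl_segment (a b : E2) : Dense (segment ℝ a b)ᶜ := by
  by_cases hab : a = b
  · subst hab
    rw [segment_same]
    exact dense_compl_singleton a
  · intro x
    rw [mem_closure_iff_frequently]
    intro hcon
    obtain ⟨y, h1, h2⟩ := exists_near_orient_ne hab hcon
    simp only [mem_compl_iff, not_not] at h1
    exact h2 (orient_eq_zero_of_mem_segment h1)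

omit [DecidableEq V] in
lemma dense_generic (P : V → E2) : Dense {y | Generic P y} := by
  have : {y | Generic P y} = ⋂ e : V × V, (segment ℝ (P e.1) (P e.2))ᶜ := by
    ext y
    simp [Generic]
  rw [this]
  exact dense_iInter_of_isOpen (fun e => (isClosed_segment _ _).isOpen_compl)
    fun e => dense_compl_segment _ _

omit [DecidableEq V] in
lemma exists_generic (P : V → E2) {x : E2} {p : E2 → Prop} (h : ∀ᶠ y in nhds x, p y) :
    ∃ y, p y ∧ Generic P y := by
  have := mem_closure_iff_frequently.1 (dense_generic P x)
  exact (this.and_eventually h).exists.imp fun y hy => ⟨hy.2, hy.1⟩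

/-- The points strictly inside a positively oriented triangle. -/
def Inside (P : V → E2) (t : V × V × V) (y : E2) : Prop :=
  0 < orient (P t.1) (P t.2.1) y ∧ 0 < orient (P t.2.1) (P t.2.2) y ∧ 0 < orient (P t.2.2) (P t.1) y

lemma exists_inside_near {P : V → E2} {t : V × V × V} {w : V → ℝ} (hw : Weights (tri t) w)
    (ht : 0 < orient (P t.1) (P t.2.1) (P t.2.2)) {p : E2 → Prop}
    (hp : ∀ᶠ y in nhds (pt P w), p y) : ∃ y, p y ∧ Generic P y ∧ Inside P t y := by
  obtain ⟨h1, h2⟩ := hw.three ht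
  have hw1 := hw.nonneg t.1
  have hw2 := hw.nonneg t.2.1
  have hw3 := hw.nonneg t.2.2
  set g : ℝ → E2 := fun ε => ((1 - ε) * w t.1 + ε / 3) • P t.1 +
    ((1 - ε) * w t.2.1 + ε / 3) • P t.2.1 + ((1 - ε) * w t.2.2 + ε / 3) • P t.2.2 with hg
  have hg0 : g 0 = pt P w := by rw [h2, hg]; simp
  have hlim : Filter.Tendsto g (nhdsWithin 0 (Ioi 0)) (nhds (pt P w)) := by
    have : ContinuousAt g 0 := by
      simp only [hg]
      fun_prop
    have h3 := this.tendsto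
    rw [hg0] at h3
    exact h3.mono_left nhdsWithin_le_nhds
  have hlt : ∀ᶠ ε : ℝ in nhdsWithin 0 (Ioi 0), ε < 1 :=
    (Filter.Eventually.filter_mono nhdsWithin_le_nhds (eventually_lt_nhds one_pos))
  obtain ⟨ε, ⟨hpε, hε1⟩, hε0⟩ := ((hlim.eventually (eventually_eventually_nhds.2 hp)).and
    hlt |>.and self_mem_nhdsWithin).exists
  have hε0 : 0 < ε := hε0
  have hin : Inside P t (g ε) := by
    have e1 : (1 - ε) * w t.1 + ε / 3 + ((1 - ε) * w t.2.1 + ε / 3) +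
      ((1 - ε) * w t.2.2 + ε / 3) = 1 := by linear_combination (1 - ε) * h1
    have hε2 : 0 < 1 - ε := by linarith
    obtain ⟨k1, k2, k3⟩ := orient_comb (P t.1) (P t.2.1) (P t.2.2) e1
    refine ⟨?_, ?_, ?_⟩
    · simp only [hg]; rw [k3]; positivity
    · simp only [hg]; rw [k1]; positivity
    · simp only [hg]; rw [k2]; positivity
  have hcont : ∀ a b : E2, Continuous fun y => orient a b y := by
    intro a b
    unfold orient
    exact continuous_det2 continuous_const (by fun_prop)
  have hev : ∀ᶠ y in nhds (g ε), p y ∧ Inside P t y := by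
    refine hpε.and ?_
    have k1 := (hcont (P t.1) (P t.2.1)).continuousAt.eventually (lt_mem_nhds hin.1)
    have k2 := (hcont (P t.2.1) (P t.2.2)).continuousAt.eventually (lt_mem_nhds hin.2.1)
    have k3 := (hcont (P t.2.2) (P t.1)).continuousAt.eventually (lt_mem_nhds hin.2.2)
    filter_upwards [k1, k2, k3] with y y1 y2 y3 using ⟨y1, y2, y3⟩
  obtain ⟨y, ⟨h3, h4⟩, h5⟩ := exists_generic P hev
  exact ⟨y, h3, h5, h4⟩

end Placement

section Uniqueness

variable {V : Type*} [Fintype V] [DecidableEq V]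

/-- The support of a weight function. -/
def wsupp (w : V → ℝ) : Finset V := Finset.univ.filter fun v => w v ≠ 0

lemma Weights.wsupp_subset {A : Finset V} {w : V → ℝ} (hw : Weights A w) : wsupp w ⊆ A := by
  intro v hv
  by_contra h
  simp [wsupp, hw.supp v h] at hv

/-- The view angle, cut off on the pairs containing `S`. -/
def cutAngle (P : V → E2) (S : Finset V) (y : E2) (a b : V) : ℝ :=
  if S ⊆ {a, b} then 0 else viewAngle (P a) (P b) y

/-- The winding defect of the triangles not containing `S`, written using the boundary and the
triangles containing `S`. -/
def defect (P : V → E2) (E : List (V × V)) (𝒯 : List (V × V × V)) (S : Finset V) (y : E2) : ℝ :=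
  (E.map fun e => cutAngle P S y e.1 e.2).sum -
    (𝒯.map fun t => if S ⊆ tri t then bdry (cutAngle P S y) t else 0).sum

variable {P : V → E2} {E : List (V × V)} {𝒯 : List (V × V × V)}

omit [Fintype V] in
lemma cutAngle_swap {S : Finset V} {y : E2} (hy : Generic P y) (a b : V) :
    cutAngle P S y b a = -cutAngle P S y a b := by
  unfold cutAngle
  rw [Finset.pair_comm]
  split_ifs
  · simp
  · exact viewAngle_swap (hy a b)

omit [Fintype V] in
lemma bdry_cutAngle {S : Finset V} {y : E2} {t : V × V × V} (h : ¬ S ⊆ tri t) :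
    bdry (cutAngle P S y) t = triW (P t.1) (P t.2.1) (P t.2.2) y := by
  have h1 : ¬ S ⊆ {t.1, t.2.1} := fun h' => h (h'.trans (by
    intro v; simp [tri]; tauto))
  have h2 : ¬ S ⊆ {t.2.1, t.2.2} := fun h' => h (h'.trans (by
    intro v; simp [tri]; tauto))
  have h3 : ¬ S ⊆ {t.2.2, t.1} := fun h' => h (h'.trans (by
    intro v; simp [tri]; tauto))
  simp [bdry, cutAngle, h1, h2, h3, triW]

omit [Fintype V] in
lemma defect_eq (h : Placed P E 𝒯) (S : Finset V) {y : E2} (hy : Generic P y) :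
    defect P E 𝒯 S y =
      (𝒯.map fun t => if S ⊆ tri t then 0 else triW (P t.1) (P t.2.1) (P t.2.2) y).sum := by
  unfold defect
  rw [← h.bdry_sum (cutAngle P S y) (cutAngle_swap hy), sub_eq_iff_eq_add, ← List.sum_map_add]
  congr 1
  apply List.map_congr_left
  intro t _
  split_ifs with h1
  · simp
  · rw [bdry_cutAngle h1]; simp

omit [Fintype V] in
lemma winding_eq_sum (h : Placed P E 𝒯) {y : E2} (hy : Generic P y) :
    winding P E y = (𝒯.map fun t => triW (P t.1) (P t.2.1) (P t.2.2) y).sum := by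
  unfold winding
  rw [← h.bdry_sum (fun a b => viewAngle (P a) (P b) y) fun a b => viewAngle_swap (hy a b)]
  rfl

omit [Fintype V] in
lemma triW_nonneg_of_generic (h : Placed P E 𝒯) {y : E2} (hy : Generic P y) {t : V × V × V}
    (ht : t ∈ 𝒯) : 0 ≤ triW (P t.1) (P t.2.1) (P t.2.2) y :=
  triW_nonneg (h.orient_pos t ht) (hy _ _) (hy _ _) (hy _ _)

omit [Fintype V] in
lemma cutAngle_continuousAt {S : Finset V} {x : E2} {a b : V}
    (h : ¬ S ⊆ {a, b} → x ∉ segment ℝ (P a) (P b)) :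
    ContinuousAt (fun y => cutAngle P S y a b) x := by
  unfold cutAngle
  split_ifs with h1
  · exact continuousAt_const
  · exact viewAngle_continuousAt (h h1)

lemma Weights.notMem_segment {t : V × V × V} {w : V → ℝ} (hw : Weights (tri t) w)
    (ht : 0 < orient (P t.1) (P t.2.1) (P t.2.2)) :
    (¬ wsupp w ⊆ {t.1, t.2.1} → pt P w ∉ segment ℝ (P t.1) (P t.2.1)) ∧
    (¬ wsupp w ⊆ {t.2.1, t.2.2} → pt P w ∉ segment ℝ (P t.2.1) (P t.2.2)) ∧
    (¬ wsupp w ⊆ {t.2.2, t.1} → pt P w ∉ segment ℝ (P t.2.2) (P t.1)) := by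
  obtain ⟨h1, h2, h3⟩ := hw.orient_pt ht
  have key : ∀ v, v ∈ wsupp w → w v ≠ 0 ∧ (v = t.1 ∨ v = t.2.1 ∨ v = t.2.2) := by
    intro v hv
    refine ⟨by simpa [wsupp] using hv, ?_⟩
    simpa [tri] using hw.wsupp_subset hv
  refine ⟨fun hS hmem => hS ?_, fun hS hmem => hS ?_, fun hS hmem => hS ?_⟩
  all_goals
    intro v hv
    obtain ⟨k1, k2⟩ := key v hv
    have := orient_eq_zero_of_mem_segment hmem
    rw [Finset.mem_insert, Finset.mem_singleton]
    rcases k2 with rfl | rfl | rfl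
  all_goals first
    | exact Or.inl rfl
    | exact Or.inr rfl
    | (exfalso; first
        | (rw [h1] at this; exact mul_ne_zero k1 ht.ne' this)
        | (rw [h2] at this; exact mul_ne_zero k1 ht.ne' this)
        | (rw [h3] at this; exact mul_ne_zero k1 ht.ne' this))

lemma defect_continuousAt (h : Placed P E 𝒯) {w : V → ℝ}
    (hC : ∀ e ∈ E, ¬ wsupp w ⊆ {e.1, e.2} → pt P w ∉ segment ℝ (P e.1) (P e.2))
    (hw : Weights (wsupp w) w) : ContinuousAt (defect P E 𝒯 (wsupp w)) (pt P w) := by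
  unfold defect
  apply ContinuousAt.sub
  · exact tendsto_list_sum (a := fun e : V × V => cutAngle P (wsupp w) (pt P w) e.1 e.2) E
      fun e he => cutAngle_continuousAt (hC e he)
  · refine tendsto_list_sum (a := fun t => if wsupp w ⊆ tri t then
      bdry (cutAngle P (wsupp w) (pt P w)) t else 0) 𝒯 fun t ht => ?_
    by_cases hS : wsupp w ⊆ tri t
    · simp only [hS, if_true]
      obtain ⟨k1, k2, k3⟩ := (hw.mono hS).notMem_segment (h.orient_pos t ht)
      exact ((cutAngle_continuousAt k1).add (cutAngle_continuousAt k2)).add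
        (cutAngle_continuousAt k3)
    · simp only [hS, if_false]
      exact tendsto_const_nhds

lemma wsupp_subset_of_mem (h : Placed P E 𝒯) {w w' : V → ℝ} {t t' : V × V × V} (ht : t ∈ 𝒯)
    (ht' : t' ∈ 𝒯) (hw : Weights (tri t) w) (hw' : Weights (tri t') w') (hww : pt P w' = pt P w)
    (hC : ∀ e ∈ E, ¬ wsupp w ⊆ {e.1, e.2} → pt P w ∉ segment ℝ (P e.1) (P e.2)) :
    wsupp w ⊆ tri t' := by
  by_contra hcon
  have hc := defect_continuousAt h hC (hw.of_supp (Finset.Subset.refl _))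
  have hnear : ∀ᶠ y in nhds (pt P w),
      |defect P E 𝒯 (wsupp w) y - defect P E 𝒯 (wsupp w) (pt P w)| < π / 2 := by
    have := Metric.tendsto_nhds.1 hc.tendsto (π / 2) (by positivity)
    simpa [Real.dist_eq] using this
  obtain ⟨y, hy1, hyg, hyt⟩ := exists_inside_near hw (h.orient_pos t ht) hnear
  obtain ⟨z, hz1, hzg, hzt⟩ := exists_inside_near hw' (h.orient_pos t' ht')
    (by rw [hww]; exact hnear)
  have k1 : 2 * π ≤ defect P E 𝒯 (wsupp w) z := by
    rw [defect_eq h _ hzg]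
    have : 2 * π = (fun t => if wsupp w ⊆ tri t then 0 else
        triW (P t.1) (P t.2.1) (P t.2.2) z) t' := by
      simp only [hcon, if_false]
      rw [triW_eq_two_pi hzt.1 hzt.2.1 hzt.2.2]
    rw [this]
    refine List.single_le_sum ?_ _ (List.mem_map_of_mem ht')
    intro r hr
    obtain ⟨s, hs, rfl⟩ := List.mem_map.1 hr
    split_ifs
    · exact le_rfl
    · exact triW_nonneg_of_generic h hzg hs
  have k2 : defect P E 𝒯 (wsupp w) y ≤ 0 := by
    rw [defect_eq h _ hyg]
    have e1 := winding_eq_sum h hyg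
    have e2 := h.winding_le y fun e _ => hyg _ _
    have e3 : (𝒯.map fun t => triW (P t.1) (P t.2.1) (P t.2.2) y).sum =
        (𝒯.map fun t => if wsupp w ⊆ tri t then 0 else triW (P t.1) (P t.2.1) (P t.2.2) y).sum +
        (𝒯.map fun t => if wsupp w ⊆ tri t then triW (P t.1) (P t.2.1) (P t.2.2) y else 0).sum := by
      rw [← List.sum_map_add]
      congr 1
      apply List.map_congr_left
      intro t _
      split_ifs <;> simp
    have e4 : 2 * π ≤
        (𝒯.map fun t => if wsupp w ⊆ tri t then triW (P t.1) (P t.2.1) (P t.2.2) y else 0).sum := by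
      have : 2 * π = (fun t => if wsupp w ⊆ tri t then
          triW (P t.1) (P t.2.1) (P t.2.2) y else 0) t := by
        simp only [hw.wsupp_subset, if_true]
        rw [triW_eq_two_pi hyt.1 hyt.2.1 hyt.2.2]
      rw [this]
      refine List.single_le_sum ?_ _ (List.mem_map_of_mem ht)
      intro r hr
      obtain ⟨s, hs, rfl⟩ := List.mem_map.1 hr
      split_ifs
      · exact triW_nonneg_of_generic h hyg hs
      · exact le_rfl
    linarith
  have := Real.pi_pos
  rw [abs_lt] at hy1 hz1
  linarith

lemma exists_weights_of_mem_segment {a b : V} (hab : a ≠ b) {x : E2}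
    (hx : x ∈ segment ℝ (P a) (P b)) : ∃ w, Weights {a, b} w ∧ pt P w = x := by
  obtain ⟨s, t, hs, ht, hst, rfl⟩ := hx
  refine ⟨fun v => if v = a then s else if v = b then t else 0, ⟨?_, ?_, ?_⟩, ?_⟩
  · intro v
    split_ifs <;> positivity
  · rw [← Finset.sum_subset (Finset.subset_univ {a, b}), Finset.sum_pair hab]
    · simp [hab.symm, hst]
    · intro v _ hv
      simp at hv
      simp [hv]
  · intro v hv
    simp at hv
    simp [hv]
  · unfold pt
    rw [← Finset.sum_subset (Finset.subset_univ {a, b}), Finset.sum_pair hab]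
    · simp [hab.symm]
    · intro v _ hv
      simp at hv
      simp [hv]

lemma Weights.pair {a b : V} (hab : a ≠ b) {w : V → ℝ} (hw : Weights {a, b} w) :
    w a + w b = 1 ∧ pt P w = w a • P a + w b • P b := by
  constructor
  · rw [← hw.sum_eq, ← Finset.sum_subset (Finset.subset_univ {a, b}), Finset.sum_pair hab]
    intro v _ hv
    exact hw.supp v hv
  · unfold pt
    rw [← Finset.sum_subset (Finset.subset_univ {a, b}), Finset.sum_pair hab]
    intro v _ hv
    rw [hw.supp v hv, zero_smul]

lemma Placed.boundary_cond (h : Placed P E 𝒯) {e₀ : V × V} (he₀ : e₀ ∈ E) {w : V → ℝ}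
    (hw : Weights {e₀.1, e₀.2} w) :
    ∀ e ∈ E, ¬ wsupp w ⊆ {e.1, e.2} → pt P w ∉ segment ℝ (P e.1) (P e.2) := by
  intro e he hS hmem
  have hne := h.ne e₀ he₀
  have hne' : e₀.1 ≠ e₀.2 := fun h' => hne (by rw [h'])
  obtain ⟨h1, h2⟩ := hw.pair (P := P) hne'
  have hee : e₀ ≠ e := by
    rintro rfl
    exact hS hw.wsupp_subset
  have hmem₀ : pt P w ∈ segment ℝ (P e₀.1) (P e₀.2) :=
    ⟨w e₀.1, w e₀.2, hw.nonneg _, hw.nonneg _, h1, h2.symm⟩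
  obtain ⟨v, hv, hve, hvx⟩ := h.inter e₀ he₀ e he hee _ hmem₀ hmem
  apply hS
  have hz : ∀ z, z ∈ wsupp w → z = v := by
    intro z hz
    have hz0 : w z ≠ 0 := by simpa [wsupp] using hz
    have hz1 := hw.wsupp_subset hz
    simp only [Finset.mem_insert, Finset.mem_singleton] at hz1
    have key : w e₀.1 • (P e₀.1 - P v) + w e₀.2 • (P e₀.2 - P v) = 0 := by
      rw [smul_sub, smul_sub, sub_add_sub_comm, ← h2, ← add_smul, h1, one_smul, hvx, sub_self]
    rcases hv with rfl | rfl
    · rcases hz1 with rfl | rfl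
      · rfl
      · rw [sub_self, smul_zero, zero_add, smul_eq_zero] at key
        rcases key with h | h
        · exact absurd h hz0
        · exact absurd (sub_eq_zero.1 h).symm hne
    · rcases hz1 with rfl | rfl
      · rw [sub_self, smul_zero, add_zero, smul_eq_zero] at key
        rcases key with h | h
        · exact absurd h hz0
        · exact absurd (sub_eq_zero.1 h) hne
      · rfl
  intro z hz'
  rw [hz z hz']
  simpa using hve

theorem Placed.weights_unique (h : Placed P E 𝒯) {w w' : V → ℝ} {t t' : V × V × V} (ht : t ∈ 𝒯)
    (ht' : t' ∈ 𝒯) (hw : Weights (tri t) w) (hw' : Weights (tri t') w') (hww : pt P w = pt P w') :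
    w = w' := by
  by_cases hC : ∀ e ∈ E, ¬ wsupp w ⊆ {e.1, e.2} → pt P w ∉ segment ℝ (P e.1) (P e.2)
  · have := wsupp_subset_of_mem h ht ht' hw hw' hww.symm hC
    exact (hw.of_supp this).ext_tri hw' (h.orient_pos t' ht') hww
  · push Not at hC
    obtain ⟨e, he, -, hmem⟩ := hC
    obtain ⟨w₀, hw₀, hx₀⟩ := exists_weights_of_mem_segment
      (fun h' => h.ne e he (by rw [h'])) hmem
    obtain ⟨t₀, ht₀, h1, h2⟩ := h.mem_tri e he
    have hw₀' : Weights (tri t₀) w₀ := hw₀.mono (by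
      intro v hv
      rw [Finset.mem_insert, Finset.mem_singleton] at hv
      rcases hv with rfl | rfl
      · exact h1
      · exact h2)
    have hb := h.boundary_cond he hw₀
    have s1 := wsupp_subset_of_mem h ht₀ ht hw₀' hw hx₀.symm hb
    have s2 := wsupp_subset_of_mem h ht₀ ht' hw₀' hw' (hww.symm.trans hx₀.symm) hb
    rw [← (hw₀.of_supp s1).ext_tri hw (h.orient_pos t ht) hx₀]
    exact (hw₀.of_supp s2).ext_tri hw' (h.orient_pos t' ht') (hx₀.trans hww)

/-- Points around which the boundary winds are covered by the triangles. -/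
lemma Placed.exists_weights_of_generic (h : Placed P E 𝒯) {y : E2} (hy : Generic P y)
    (hw : winding P E y ≠ 0) : ∃ t ∈ 𝒯, ∃ w, Weights (tri t) w ∧ pt P w = y := by
  rw [winding_eq_sum h hy] at hw
  obtain ⟨t, ht, hne⟩ : ∃ t ∈ 𝒯, triW (P t.1) (P t.2.1) (P t.2.2) y ≠ 0 := by
    by_contra hcon
    push Not at hcon
    apply hw
    rw [List.map_congr_left hcon]
    simp
  have ho := h.orient_pos t ht
  have hin : Inside P t y := by
    by_contra hcon
    exact hne (triW_eq_zero ho (hy _ _) (hy _ _) (hy _ _) hcon)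
  obtain ⟨n1, n2, n3⟩ := ne_of_orient ho
  set O := orient (P t.1) (P t.2.1) (P t.2.2) with hO
  have hsum : orient (P t.2.1) (P t.2.2) y + orient (P t.2.2) (P t.1) y +
      orient (P t.1) (P t.2.1) y = O := by
    simp only [hO, orient, det2, PiLp.sub_apply]; ring
  have hcomb : orient (P t.2.1) (P t.2.2) y • P t.1 + orient (P t.2.2) (P t.1) y • P t.2.1 +
      orient (P t.1) (P t.2.1) y • P t.2.2 = O • y := by
    ext i
    fin_cases i <;> simp [hO, orient, det2] <;> ring
  have hdz : ∀ v, v ∉ ({t.1, t.2.1, t.2.2} : Finset V) → v ≠ t.1 ∧ v ≠ t.2.1 ∧ v ≠ t.2.2 := by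
    intro v hv
    simpa using hv
  have hzero : ∀ v, v ∉ ({t.1, t.2.1, t.2.2} : Finset V) →
      (if v = t.1 then orient (P t.2.1) (P t.2.2) y / O else
        if v = t.2.1 then orient (P t.2.2) (P t.1) y / O else
          if v = t.2.2 then orient (P t.1) (P t.2.1) y / O else 0) = 0 := by
    intro v hv
    obtain ⟨k1, k2, k3⟩ := hdz v hv
    simp [k1, k2, k3]
  have i1 := hin.1
  have i2 := hin.2.1
  have i3 := hin.2.2
  refine ⟨t, ht, fun v => if v = t.1 then orient (P t.2.1) (P t.2.2) y / O else
        if v = t.2.1 then orient (P t.2.2) (P t.1) y / O else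
          if v = t.2.2 then orient (P t.1) (P t.2.1) y / O else 0, ⟨?_, ?_, hzero⟩, ?_⟩
  · intro v
    split_ifs <;> positivity
  · rw [sum_three n1 n2 n3 _ hzero]
    simp only [if_true, n1.symm, n2.symm, n3.symm, if_false]
    rw [← add_div, ← add_div, hsum, div_self ho.ne']
  · unfold pt
    rw [sum_three n1 n2 n3]
    · simp only [if_true, n1.symm, n2.symm, n3.symm, if_false]
      rw [div_eq_inv_mul, div_eq_inv_mul, div_eq_inv_mul, mul_smul, mul_smul, mul_smul, ← smul_add,
        ← smul_add, hcomb, smul_smul, inv_mul_cancel₀ ho.ne', one_smul]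
    · intro v hv
      have := hzero v hv
      simp only [this, zero_smul]

end Uniqueness

section Realization

lemma isHomeoOn_of_compact {f : E2 → E2} {S : Set E2} (hS : IsCompact S) (hc : ContinuousOn f S)
    (hi : InjOn f S) : IsHomeoOn f S := by
  refine ⟨hc, hi, ?_⟩
  rw [continuousOn_iff_isClosed]
  intro t ht
  refine ⟨f '' (S ∩ t), ((hS.inter_right ht).image_of_continuousOn
    (hc.mono inter_subset_left)).isClosed, ?_⟩
  ext y
  constructor
  · rintro ⟨h1, x, hx, rfl⟩
    refine ⟨⟨x, ⟨hx, ?_⟩, rfl⟩, x, hx, rfl⟩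
    rwa [mem_preimage, hi.leftInvOn_invFunOn hx] at h1
  · rintro ⟨⟨x, ⟨hx, hxt⟩, rfl⟩, -⟩
    refine ⟨?_, x, hx, rfl⟩
    rwa [mem_preimage, hi.leftInvOn_invFunOn hx]

lemma continuousOn_list_union {α : Type*} (l : List α) (C : α → Set E2) {f : E2 → E2}
    (hC : ∀ a ∈ l, IsClosed (C a)) (hf : ∀ a ∈ l, ContinuousOn f (C a)) :
    IsClosed {x | ∃ a ∈ l, x ∈ C a} ∧ ContinuousOn f {x | ∃ a ∈ l, x ∈ C a} := by
  induction l with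
  | nil => simp
  | cons a l ih =>
    obtain ⟨h1, h2⟩ := ih (fun b hb => hC b (List.mem_cons_of_mem _ hb))
      (fun b hb => hf b (List.mem_cons_of_mem _ hb))
    have : {x | ∃ b ∈ a :: l, x ∈ C b} = C a ∪ {x | ∃ b ∈ l, x ∈ C b} := by
      ext x; simp
    rw [this]
    exact ⟨(hC a List.mem_cons_self).union h1,
      (hf a List.mem_cons_self).union_of_isClosed h2 (hC a List.mem_cons_self) h1⟩

lemma affineIndependent_of_orient {a b c : E2} (h : orient a b c ≠ 0) :
    AffineIndependent ℝ ![a, b, c] := by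
  rw [affineIndependent_iff_linearIndependent_vsub ℝ _ (0 : Fin 3),
    ← linearIndependent_equiv (finSuccAboveEquiv (0 : Fin 3))]
  rw [Fintype.linearIndependent_iff]
  intro g hg
  simp only [Fin.sum_univ_two, Function.comp] at hg
  have e0 := congrArg (fun u : E2 => u 0) hg
  have e1 := congrArg (fun u : E2 => u 1) hg
  simp [finSuccAboveEquiv_apply] at e0 e1
  have h0 : g 0 * orient a b c = 0 := by
    simp only [orient, det2, PiLp.sub_apply]
    linear_combination (c 1 - a 1) * e0 - (c 0 - a 0) * e1
  have h1 : g 1 * orient a b c = 0 := by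
    simp only [orient, det2, PiLp.sub_apply]
    linear_combination (b 0 - a 0) * e1 - (b 1 - a 1) * e0
  intro i
  fin_cases i
  · exact (mul_eq_zero.1 h0).resolve_right h
  · exact (mul_eq_zero.1 h1).resolve_right h

/-- The affine map sending the triangle `a b c` to the triangle `a' b' c'`. -/
lemma exists_affineMap {a b c : E2} (h : orient a b c ≠ 0) (a' b' c' : E2) :
    ∃ A : E2 →ᵃ[ℝ] E2, ∀ s t u : ℝ, s + t + u = 1 →
      A (s • a + t • b + u • c) = s • a' + t • b' + u • c' := by
  have hL : IsLinearMap ℝ (fun u : E2 => (det2 u (c - a) / orient a b c) • (b' - a') +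
      (det2 (b - a) u / orient a b c) • (c' - a')) := by
    constructor
    · intro x y
      ext i
      simp [det2]
      ring
    · intro k x
      ext i
      simp [det2]
      ring
  refine ⟨⟨fun x => hL.mk' _ (x - a) + a', hL.mk' _, ?_⟩, ?_⟩
  · intro p v
    simp only [vadd_eq_add]
    rw [add_sub_assoc, map_add, add_assoc]
  · intro s t u hstu
    have e : s • a + t • b + u • c - a = t • (b - a) + u • (c - a) := by
      have : s = 1 - t - u := by linarith
      subst this
      module
    have k1 : det2 (t • (b - a) + u • (c - a)) (c - a) / orient a b c = t := by
      rw [div_eq_iff h]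
      simp only [orient, det2, PiLp.add_apply, PiLp.smul_apply, smul_eq_mul]
      ring
    have k2 : det2 (b - a) (t • (b - a) + u • (c - a)) / orient a b c = u := by
      rw [div_eq_iff h]
      simp only [orient, det2, PiLp.add_apply, PiLp.smul_apply, smul_eq_mul]
      ring
    have hs : s = 1 - t - u := by linarith
    change (det2 (s • a + t • b + u • c - a) (c - a) / orient a b c) • (b' - a') +
      (det2 (b - a) (s • a + t • b + u • c - a) / orient a b c) • (c' - a') + a' = _
    rw [e, k1, k2, hs]
    module

variable {V : Type*} [Fintype V] [DecidableEq V] {P : V → E2} {E : List (V × V)}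
  {𝒯 : List (V × V × V)}

omit [DecidableEq V] in
lemma pt_mem_convexHull (P : V → E2) {A : Finset V} {w : V → ℝ} (hw : Weights A w) :
    pt P w ∈ convexHull ℝ (P '' A) := by
  unfold pt
  rw [← Finset.sum_subset (Finset.subset_univ A) (fun v _ hv => by rw [hw.supp v hv, zero_smul])]
  apply (convex_convexHull ℝ _).sum_mem (fun v _ => hw.nonneg v)
  · rw [← hw.sum_eq]
    exact Finset.sum_subset (Finset.subset_univ A) (fun v _ hv => hw.supp v hv)
  · intro v hv
    exact subset_convexHull ℝ _ ⟨v, hv, rfl⟩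

lemma Weights.single (v : V) : Weights {v} (Pi.single v (1 : ℝ)) := by
  refine ⟨fun u => ?_, by simp, fun u hu => ?_⟩
  · by_cases h : u = v
    · subst h; simp
    · simp [h]
  · simp only [Finset.mem_singleton] at hu
    simp [hu]

lemma pt_single (P : V → E2) (v : V) : pt P (Pi.single v (1 : ℝ)) = P v := by
  unfold pt
  rw [Finset.sum_eq_single v]
  · simp
  · intro b _ hb; simp [hb]
  · simp

lemma mem_convexHull_image (P : V → E2) (A : Finset V) (x : E2) :
    x ∈ convexHull ℝ (P '' A) ↔ ∃ w, Weights A w ∧ pt P w = x := by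
  constructor
  · intro hx
    have hconv : Convex ℝ {x | ∃ w, Weights A w ∧ pt P w = x} := by
      rintro _ ⟨w, hw, rfl⟩ _ ⟨w', hw', rfl⟩ a b ha hb hab
      refine ⟨fun v => a * w v + b * w' v, ⟨fun v => ?_, ?_, fun v hv => ?_⟩, ?_⟩
      · have := hw.nonneg v
        have := hw'.nonneg v
        positivity
      · rw [Finset.sum_add_distrib, ← Finset.mul_sum, ← Finset.mul_sum, hw.sum_eq, hw'.sum_eq]
        linarith
      · rw [hw.supp v hv, hw'.supp v hv]; simp
      · unfold pt
        rw [Finset.smul_sum, Finset.smul_sum, ← Finset.sum_add_distrib]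
        exact Finset.sum_congr rfl fun v _ => by rw [add_smul, mul_smul, mul_smul]
    refine convexHull_min ?_ hconv hx
    rintro _ ⟨v, hv, rfl⟩
    exact ⟨_, (Weights.single v).mono (by simpa using hv), pt_single P v⟩
  · rintro ⟨w, hw, rfl⟩
    exact pt_mem_convexHull P hw

lemma Placed.vertex_inj (h : Placed P E 𝒯) {v v' : V} {t t' : V × V × V} (ht : t ∈ 𝒯)
    (ht' : t' ∈ 𝒯) (hv : v ∈ tri t) (hv' : v' ∈ tri t') (e : P v = P v') : v = v' := by
  have := h.weights_unique ht ht' ((Weights.single v).mono (by simpa using hv))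
    ((Weights.single v').mono (by simpa using hv')) (by rw [pt_single, pt_single, e])
  by_contra hne
  have h1 := congrFun this v
  rw [Pi.single_eq_same, Pi.single_eq_of_ne hne] at h1
  exact one_ne_zero h1

open Classical in
/-- The geometric simplicial complex spanned by a placed family of triples. -/
def Placed.complex (h : Placed P E 𝒯) : SimplicialComplex ℝ E2 where
  faces := {s | ∃ A : Finset V, A.Nonempty ∧ (∃ t ∈ 𝒯, A ⊆ tri t) ∧ s = A.image P}
  isRelLowerSet_faces := by
    rintro s ⟨A, hA, ⟨t, ht, hAt⟩, rfl⟩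
    refine ⟨hA.image P, fun s' hs' hne => ?_⟩
    refine ⟨A.filter fun v => P v ∈ s', ?_, ⟨t, ht, (Finset.filter_subset _ _).trans hAt⟩, ?_⟩
    · obtain ⟨x, hx⟩ := hne
      obtain ⟨v, hv, rfl⟩ := Finset.mem_image.1 (hs' hx)
      exact ⟨v, Finset.mem_filter.2 ⟨hv, hx⟩⟩
    · ext x
      simp only [Finset.mem_image, Finset.mem_filter]
      constructor
      · intro hx
        obtain ⟨v, hv, rfl⟩ := Finset.mem_image.1 (hs' hx)
        exact ⟨v, ⟨hv, hx⟩, rfl⟩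
      · rintro ⟨v, ⟨-, hv⟩, rfl⟩
        exact hv
  indep := by
    rintro s ⟨A, hA, ⟨t, ht, hAt⟩, rfl⟩
    have h1 := (affineIndependent_of_orient (h.orient_pos t ht).ne').range
    refine h1.mono ?_
    intro x hx
    obtain ⟨v, hv, rfl⟩ := Finset.mem_image.1 hx
    have := hAt hv
    simp only [tri, Finset.mem_insert, Finset.mem_singleton] at this
    rcases this with rfl | rfl | rfl
    · exact ⟨0, rfl⟩
    · exact ⟨1, rfl⟩
    · exact ⟨2, rfl⟩
  inter_subset_convexHull := by
    rintro s s' ⟨A, hA, ⟨t, ht, hAt⟩, rfl⟩ ⟨B, hB, ⟨t', ht', hBt⟩, rfl⟩ x ⟨h1, h2⟩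
    rw [Finset.coe_image, mem_convexHull_image] at h1 h2
    obtain ⟨w, hw, rfl⟩ := h1
    obtain ⟨w', hw', hww⟩ := h2
    have e := h.weights_unique ht ht' (hw.mono hAt) (hw'.mono hBt) hww.symm
    subst e
    have hw2 : Weights (A ∩ B) w := ⟨hw.nonneg, hw.sum_eq, fun v hv => by
      rw [Finset.mem_inter, not_and_or] at hv
      rcases hv with hv | hv
      · exact hw.supp v hv
      · exact hw'.supp v hv⟩
    refine convexHull_mono ?_ (pt_mem_convexHull P hw2)
    rw [Finset.coe_inter, Finset.coe_image, Finset.coe_image]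
    exact image_inter_subset P _ _

open Classical in
lemma Placed.mem_faces (h : Placed P E 𝒯) {s : Finset E2} : s ∈ h.complex.faces ↔
    ∃ A : Finset V, A.Nonempty ∧ (∃ t ∈ 𝒯, A ⊆ tri t) ∧ s = A.image P := Iff.rfl

omit [Fintype V] in
lemma tri_nonempty (t : V × V × V) : (tri t).Nonempty := ⟨t.1, by simp [tri]⟩

lemma Placed.mem_space (h : Placed P E 𝒯) {x : E2} : x ∈ h.complex.space ↔
    ∃ t ∈ 𝒯, ∃ w, Weights (tri t) w ∧ pt P w = x := by
  classical
  rw [SimplicialComplex.mem_space_iff]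
  constructor
  · rintro ⟨s, ⟨A, hA, ⟨t, ht, hAt⟩, rfl⟩, hx⟩
    rw [Finset.coe_image, mem_convexHull_image] at hx
    obtain ⟨w, hw, rfl⟩ := hx
    exact ⟨t, ht, w, hw.mono hAt, rfl⟩
  · rintro ⟨t, ht, w, hw, rfl⟩
    refine ⟨(tri t).image P, ⟨tri t, tri_nonempty t, ⟨t, ht, subset_rfl⟩, rfl⟩, ?_⟩
    rw [Finset.coe_image]
    exact pt_mem_convexHull P hw

omit [Fintype V] in
lemma Placed.card_tri (h : Placed P E 𝒯) {t : V × V × V} (ht : t ∈ 𝒯) : (tri t).card = 3 := by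
  obtain ⟨h1, h2, h3⟩ := ne_of_orient (h.orient_pos t ht)
  exact Finset.card_eq_three.2 ⟨_, _, _, h1, h2, h3, rfl⟩

lemma isClosed_weights (P : V → E2) (A : Finset V) :
    IsClosed {x | ∃ w, Weights A w ∧ pt P w = x} := by
  have : {x | ∃ w, Weights A w ∧ pt P w = x} = convexHull ℝ (P '' A) := by
    ext x; rw [mem_convexHull_image]; rfl
  rw [this]
  exact ((A.finite_toSet.image P).isCompact_convexHull (𝕜 := ℝ)).isClosed

/-- A placed family triangulates the convex region around which its boundary winds. -/
lemma Placed.isTriangulation (h : Placed P E 𝒯) {Ω : Set E2} (hconv : Convex ℝ Ω)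
    (hcl : Ω ⊆ closure (interior Ω))
    (hv : ∀ t ∈ 𝒯, ∀ v ∈ tri t, P v ∈ Ω)
    (hw : ∀ x ∈ interior Ω, winding P E x ≠ 0) : IsTriangulation h.complex Ω := by
  classical
  refine ⟨?_, ?_, ?_, ?_⟩
  · refine (Set.finite_range fun A : Finset V => A.image P).subset ?_
    rintro s ⟨A, -, -, rfl⟩
    exact ⟨A, rfl⟩
  · rintro s ⟨A, -, ⟨t, ht, hAt⟩, rfl⟩
    exact Finset.card_image_le.trans ((Finset.card_le_card hAt).trans (h.card_tri ht).le)
  · ext x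
    rw [h.mem_space]
    constructor
    · rintro ⟨t, ht, w, hw, rfl⟩
      refine convexHull_min ?_ hconv (pt_mem_convexHull P hw)
      rintro _ ⟨v, hv', rfl⟩
      exact hv t ht v hv'
    · intro hx
      have hclosed : IsClosed {x | ∃ t ∈ 𝒯, x ∈ {x | ∃ w, Weights (tri t) w ∧ pt P w = x}} :=
        (continuousOn_list_union 𝒯 _ (f := id) (fun t _ => isClosed_weights P (tri t))
          (fun t _ => continuousOn_id)).1
      have hsub : interior Ω ⊆ {x | ∃ t ∈ 𝒯, x ∈ {x | ∃ w, Weights (tri t) w ∧ pt P w = x}} := by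
        rw [← hclosed.closure_eq]
        refine (((dense_generic P).open_subset_closure_inter isOpen_interior)).trans
          (closure_mono ?_)
        rintro y ⟨hy1, hy2⟩
        exact h.exists_weights_of_generic hy2 (hw y hy1)
      exact closure_minimal hsub hclosed (hcl hx)
  · rintro s ⟨A, -, ⟨t, ht, hAt⟩, rfl⟩
    refine ⟨(tri t).image P, ⟨tri t, tri_nonempty t, ⟨t, ht, subset_rfl⟩, rfl⟩,
      Finset.image_subset_image hAt, ?_⟩
    rw [Finset.card_image_of_injOn, h.card_tri ht]
    intro v hv v' hv' e
    exact h.vertex_inj ht ht hv hv' e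

/-- Two placements of the same triples are related by a piecewise affine homeomorphism. -/
lemma Placed.exists_map (h : Placed P E 𝒯) {Q : V → E2} {E' : List (V × V)} (h' : Placed Q E' 𝒯) :
    ∃ f : E2 → E2, IsHomeoOn f h.complex.space ∧ PiecewiseAffineOn f h.complex ∧
      ∀ t ∈ 𝒯, ∀ w, Weights (tri t) w → f (pt P w) = pt Q w := by
  classical
  have hex : ∀ x, ∃ w : V → ℝ, x ∈ h.complex.space → ∃ t ∈ 𝒯, Weights (tri t) w ∧ pt P w = x := by
    intro x
    by_cases hx : x ∈ h.complex.space
    · obtain ⟨t, ht, w, hw⟩ := h.mem_space.1 hx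
      exact ⟨w, fun _ => ⟨t, ht, hw⟩⟩
    · exact ⟨0, fun h => absurd h hx⟩
  choose g hg using hex
  have hfw : ∀ t ∈ 𝒯, ∀ w, Weights (tri t) w → pt Q (g (pt P w)) = pt Q w := by
    intro t ht w hw
    obtain ⟨t', ht', hw', e⟩ := hg (pt P w) (h.mem_space.2 ⟨t, ht, w, hw, rfl⟩)
    rw [h.weights_unique ht' ht hw' hw e]
  have haff : ∀ t ∈ 𝒯, ∃ A : E2 →ᵃ[ℝ] E2, ∀ w, Weights (tri t) w →
      pt Q (g (pt P w)) = A (pt P w) := by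
    intro t ht
    obtain ⟨A, hA⟩ := exists_affineMap (h.orient_pos t ht).ne' (Q t.1) (Q t.2.1) (Q t.2.2)
    refine ⟨A, fun w hw => ?_⟩
    rw [hfw t ht w hw, (hw.three (h'.orient_pos t ht)).2, (hw.three (h.orient_pos t ht)).2, hA]
    exact (hw.three (h.orient_pos t ht)).1
  have hspace : h.complex.space = {x | ∃ t ∈ 𝒯, x ∈ {x | ∃ w, Weights (tri t) w ∧ pt P w = x}} := by
    ext x; exact h.mem_space
  refine ⟨fun x => pt Q (g x), ?_, ?_, hfw⟩
  · apply isHomeoOn_of_compact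
    · rw [SimplicialComplex.space]
      refine Set.Finite.isCompact_biUnion ?_ fun s _ => s.finite_toSet.isCompact_convexHull (𝕜 := ℝ)
      refine (Set.finite_range fun A : Finset V => A.image P).subset ?_
      rintro s ⟨A, -, -, rfl⟩
      exact ⟨A, rfl⟩
    · rw [hspace]
      refine (continuousOn_list_union 𝒯 _ (fun t _ => isClosed_weights P (tri t)) ?_).2
      intro t ht
      obtain ⟨A, hA⟩ := haff t ht
      refine (A.continuous_of_finiteDimensional.continuousOn).congr ?_
      rintro _ ⟨w, hw, rfl⟩
      exact hA w hw
    · intro x hx y hy hxy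
      obtain ⟨t, ht, w, hw, rfl⟩ := h.mem_space.1 hx
      obtain ⟨t', ht', w', hw', rfl⟩ := h.mem_space.1 hy
      simp only [hfw t ht w hw, hfw t' ht' w' hw'] at hxy
      rw [h'.weights_unique ht ht' hw hw' hxy]
  · rintro s ⟨A, -, ⟨t, ht, hAt⟩, rfl⟩
    obtain ⟨F, hF⟩ := haff t ht
    refine ⟨F, fun x hx => ?_⟩
    rw [Finset.coe_image, mem_convexHull_image] at hx
    obtain ⟨w, hw, rfl⟩ := hx
    exact hF w (hw.mono hAt)

end Realization

section Ring

lemma cyc_eq_zip {V : Type*} (l : List V) : cyc l = l.zip (l.rotate 1) := by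
  cases l with
  | nil => rfl
  | cons v l =>
    rw [cyc_cons, pathEdges]
    have : (v :: l).rotate 1 = l ++ [v] := by simp
    rw [this, List.tail_cons]
    have h := List.zip_append (l₁ := v :: l) (r₁ := [v]) (l₂ := l ++ [v]) (r₂ := []) (by simp)
    rw [List.append_nil, List.zip_nil_right, List.append_nil] at h
    exact h

lemma cyc_finRange (n : ℕ) [NeZero n] :
    cyc (List.finRange n) = (List.finRange n).map fun i => (i, i + 1) := by
  rw [cyc_eq_zip]
  apply List.ext_getElem
  · simp
  · intro k h1 h2
    simp only [List.length_map, List.length_finRange] at h2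
    simp [List.getElem_rotate, Fin.ext_iff, Fin.val_add]

lemma mem_cyc_finRange {n : ℕ} [NeZero n] {e : Fin n × Fin n} :
    e ∈ cyc (List.finRange n) ↔ e.2 = e.1 + 1 := by
  rw [cyc_finRange, List.mem_map]
  constructor
  · rintro ⟨i, -, rfl⟩; rfl
  · intro h; exact ⟨e.1, List.mem_finRange _, by rw [← h]⟩

lemma sum_pathEdges_sub {V : Type*} (β : V → ℝ) : ∀ (a : V) (l : List V) (z : V),
    ((pathEdges (a :: (l ++ [z]))).map fun e => β e.2 - β e.1).sum = β z - β a
  | a, [], z => by simp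
  | a, b :: l, z => by
    have := sum_pathEdges_sub β b l z
    rw [List.cons_append, pathEdges_cons_cons, List.map_cons, List.sum_cons, this]
    ring

lemma sum_cyc_sub {V : Type*} (β : V → ℝ) (l : List V) :
    ((cyc l).map fun e => β e.2 - β e.1).sum = 0 := by
  cases l with
  | nil => rfl
  | cons v l => rw [cyc_cons, sum_pathEdges_sub, sub_self]

variable {ι : Type*}

/-- The two triples filling the strip between an outer edge and its inner copy. -/
def strip (e : ι × ι) : List ((ι × Bool) × (ι × Bool) × (ι × Bool)) :=
  [((e.1, false), (e.2, false), (e.2, true)), ((e.1, false), (e.2, true), (e.1, true))]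

/-- The inner copy of a triple. -/
def innerTri (t : ι × ι × ι) : (ι × Bool) × (ι × Bool) × (ι × Bool) :=
  ((t.1, true), (t.2.1, true), (t.2.2, true))

/-- The triples of a collar of the loop `l`, followed by the inner copies of `T`. -/
def collar (l : List ι) (T : List (ι × ι × ι)) : List ((ι × Bool) × (ι × Bool) × (ι × Bool)) :=
  (cyc l).flatMap strip ++ T.map innerTri

/-- The outer copy of an edge. -/
def outerEdge (e : ι × ι) : (ι × Bool) × (ι × Bool) := ((e.1, false), (e.2, false))

lemma collar_bdry {l : List ι} {T : List (ι × ι × ι)}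
    (hT : ∀ α : ι → ι → ℝ, (∀ a b, α b a = -α a b) →
      (T.map (bdry α)).sum = ((cyc l).map fun e => α e.1 e.2).sum)
    (α : ι × Bool → ι × Bool → ℝ) (hα : ∀ a b, α b a = -α a b) :
    ((collar l T).map (bdry α)).sum =
      (((cyc l).map outerEdge).map fun e => α e.1 e.2).sum := by
  have h1 := hT (fun a b => α (a, true) (b, true)) (fun a b => hα _ _)
  have h2 := sum_cyc_sub (fun a => α (a, false) (a, true)) l
  have h3 : ((T.map innerTri).map (bdry α)).sum =
      ((cyc l).map fun e => α (e.1, true) (e.2, true)).sum := by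
    rw [← h1, List.map_map]
    rfl
  have h4 : ∀ E : List (ι × ι), ((E.flatMap strip).map (bdry α)).sum =
      (E.map fun e => α (e.1, false) (e.2, false)).sum -
      (E.map fun e => α (e.1, true) (e.2, true)).sum +
      (E.map fun e => α (e.2, false) (e.2, true) - α (e.1, false) (e.1, true)).sum := by
    intro E
    induction E with
    | nil => simp
    | cons e E ih =>
      rw [List.flatMap_cons, List.map_append, List.sum_append, ih]
      simp only [strip, bdry, List.map_cons, List.map_nil, List.sum_cons, List.sum_nil]
      rw [hα (e.1, false) (e.2, true), hα (e.1, true) (e.2, true), hα (e.1, false) (e.1, true)]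
      rw [hα (e.2, true) (e.1, true)]
      ring
  rw [collar, List.map_append, List.sum_append, h3, h4, h2, List.map_map]
  simp only [Function.comp_def, outerEdge]
  ring

variable [Fintype ι] [DecidableEq ι]

omit [Fintype ι] [DecidableEq ι] in
lemma mem_collar {l : List ι} {T : List (ι × ι × ι)} {t : (ι × Bool) × (ι × Bool) × (ι × Bool)} :
    t ∈ collar l T ↔ (∃ e ∈ cyc l, t = ((e.1, false), (e.2, false), (e.2, true)) ∨
      t = ((e.1, false), (e.2, true), (e.1, true))) ∨ ∃ s ∈ T, t = innerTri s := by
  simp [collar, strip, List.mem_flatMap, eq_comm]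

omit [Fintype ι] in
lemma placed_collar {l : List ι} {T : List (ι × ι × ι)} {P : ι × Bool → E2}
    (hT : ∀ α : ι → ι → ℝ, (∀ a b, α b a = -α a b) →
      (T.map (bdry α)).sum = ((cyc l).map fun e => α e.1 e.2).sum)
    (hs : SimpleLoop (fun i => P (i, false)) l)
    (hwind : ∀ x, OffSegs (fun i => P (i, false)) (cyc l) x →
      winding (fun i => P (i, false)) (cyc l) x ≤ 2 * π)
    (h1 : ∀ e ∈ cyc l, 0 < orient (P (e.1, false)) (P (e.2, false)) (P (e.2, true)))
    (h2 : ∀ e ∈ cyc l, 0 < orient (P (e.1, false)) (P (e.2, true)) (P (e.1, true)))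
    (h3 : ∀ t ∈ T, 0 < orient (P (t.1, true)) (P (t.2.1, true)) (P (t.2.2, true))) :
    Placed P ((cyc l).map outerEdge) (collar l T) where
  bdry_sum := collar_bdry hT
  orient_pos := by
    intro t ht
    rw [mem_collar] at ht
    rcases ht with ⟨e, he, rfl | rfl⟩ | ⟨s, hs, rfl⟩
    · exact h1 e he
    · exact h2 e he
    · exact h3 s hs
  winding_le := by
    intro x hx
    have e : winding P ((cyc l).map outerEdge) x = winding (fun i => P (i, false)) (cyc l) x := by
      simp [winding, outerEdge, Function.comp_def]
    rw [e]
    refine hwind x fun e he => ?_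
    exact hx _ (List.mem_map_of_mem he)
  ne := by
    rintro _ he0
    obtain ⟨e, he, rfl⟩ := List.mem_map.1 he0
    intro heq
    have := h1 e he
    simp only [outerEdge] at heq
    rw [heq] at this
    simp [orient, det2] at this
  mem_tri := by
    rintro _ he0
    obtain ⟨e, he, rfl⟩ := List.mem_map.1 he0
    exact ⟨_, mem_collar.2 (Or.inl ⟨e, he, Or.inl rfl⟩), by simp [tri, outerEdge],
      by simp [tri, outerEdge]⟩
  inter := by
    intro _ he0 _ he0' hne x hx hx'
    obtain ⟨e, he, rfl⟩ := List.mem_map.1 he0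
    obtain ⟨e', he', rfl⟩ := List.mem_map.1 he0'
    obtain ⟨v, hv, hv', hx⟩ := hs.inter e he e' he' (fun h => hne (by rw [h])) x hx hx'
    refine ⟨(v, false), ?_, ?_, hx⟩
    · rcases hv with rfl | rfl
      · exact Or.inl rfl
      · exact Or.inr rfl
    · rcases hv' with rfl | rfl
      · exact Or.inl rfl
      · exact Or.inr rfl

end Ring

section Shrink

lemma exists_left_normal {u v : E2} (hu : u ≠ 0) (hv : v ≠ 0) (h : det2 u v = 0 → 0 < dot2 u v) :
    ∃ d, 0 < det2 u d ∧ 0 < det2 v d := by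
  have hu2 := nsq_pos hu
  have hv2 := nsq_pos hv
  have hlag : dot2 u v ^ 2 + det2 u v ^ 2 = nsq u * nsq v := by
    simp only [dot2, det2, nsq]; ring
  set a := √(nsq u) with ha
  set b := √(nsq v) with hb
  have ha0 : 0 < a := Real.sqrt_pos.2 hu2
  have hb0 : 0 < b := Real.sqrt_pos.2 hv2
  have ha2 : a ^ 2 = nsq u := Real.sq_sqrt hu2.le
  have hb2 : b ^ 2 = nsq v := Real.sq_sqrt hv2.le
  have key : 0 < a * b + dot2 u v := by
    by_contra hcon
    push Not at hcon
    have h1 : dot2 u v < 0 := by nlinarith [mul_pos ha0 hb0]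
    have h2 : a ^ 2 * b ^ 2 ≤ dot2 u v ^ 2 := by nlinarith [mul_pos ha0 hb0]
    rw [ha2, hb2, ← hlag] at h2
    have h3 : det2 u v = 0 := by nlinarith [sq_nonneg (det2 u v)]
    linarith [h h3]
  refine ⟨rot (b • u + a • v), ?_, ?_⟩
  · have : det2 u (rot (b • u + a • v)) = a * (a * b + dot2 u v) := by
      rw [mul_add, ← mul_assoc, ← sq, ha2]
      simp [det2, rot, dot2, nsq]; ring
    rw [this]; positivity
  · have : det2 v (rot (b • u + a • v)) = b * (a * b + dot2 u v) := by
      rw [mul_add, mul_left_comm, ← sq, hb2]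
      simp [det2, rot, dot2, nsq]; ring
    rw [this]; positivity

variable {n : ℕ} [NeZero n]

lemma Fin.add_one_ne_self' (hn : 3 ≤ n) (i : Fin n) : i + 1 ≠ i ∧ i + 1 + 1 ≠ i := by
  have := i.isLt
  constructor <;> intro h <;> rw [Fin.ext_iff] at h <;>
    simp only [Fin.val_add, Fin.val_one', Nat.mod_eq_of_lt (show 1 < n by omega)] at h
  · rcases Nat.lt_or_ge (i.val + 1) n with h' | h'
    · rw [Nat.mod_eq_of_lt h'] at h; omega
    · rw [show i.val + 1 = n by omega, Nat.mod_self] at h; omega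
  · rw [Nat.mod_add_mod] at h
    rcases Nat.lt_or_ge (i.val + 1 + 1) n with h' | h'
    · rw [Nat.mod_eq_of_lt h'] at h; omega
    · rw [Nat.mod_eq_sub_mod h', Nat.mod_eq_of_lt (by omega)] at h; omega

lemma SimpleLoop.not_antiparallel (hn : 3 ≤ n) {q : Fin n → E2}
    (hs : SimpleLoop q (List.finRange n)) (i : Fin n)
    (h : det2 (q (i + 1) - q i) (q (i + 1 + 1) - q (i + 1)) = 0) :
    0 < dot2 (q (i + 1) - q i) (q (i + 1 + 1) - q (i + 1)) := by
  obtain ⟨n1, n2⟩ := Fin.add_one_ne_self' hn i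
  obtain ⟨n3, -⟩ := Fin.add_one_ne_self' hn (i + 1)
  have hinj : ∀ {a b}, q a = q b → a = b := fun {a b} h =>
    hs.inj a (List.mem_finRange _) b (List.mem_finRange _) h
  have hmeet := hs.inter (i, i + 1) (mem_cyc_finRange.2 rfl) (i + 1, i + 1 + 1)
    (mem_cyc_finRange.2 rfl) (by intro h; exact n1 (Prod.ext_iff.1 h).1.symm)
  have ho : orient (q i) (q (i + 1)) (q (i + 1 + 1)) = 0 := by
    rw [← h]; simp [orient, det2]; ring
  rcases exists_mem_segment_of_collinear ho with h' | h' | h'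
  · rw [mem_segment_iff] at h'
    have hpos := h'.2
    have hne : dot2 (q (i + 1) - q i) (q (i + 1 + 1) - q (i + 1)) ≠ 0 := by
      intro h0
      have hlag : dot2 (q (i + 1) - q i) (q (i + 1 + 1) - q (i + 1)) ^ 2 +
          det2 (q (i + 1) - q i) (q (i + 1 + 1) - q (i + 1)) ^ 2 =
          nsq (q (i + 1) - q i) * nsq (q (i + 1 + 1) - q (i + 1)) := by
        simp only [dot2, det2, nsq]; ring
      have k1 := nsq_pos (sub_ne_zero.2 fun h => n1 (hinj h))
      have k2 := nsq_pos (sub_ne_zero.2 fun h => n3 (hinj h))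
      rw [h0, h] at hlag
      nlinarith [mul_pos k1 k2]
    refine lt_of_le_of_ne ?_ hne.symm
    have e : dot2 (q i - q (i + 1)) (q (i + 1 + 1) - q (i + 1)) =
      -dot2 (q (i + 1) - q i) (q (i + 1 + 1) - q (i + 1)) := by simp [dot2]; ring
    linarith
  · obtain ⟨v, hv, hv', hx⟩ := hmeet (q i) (left_mem_segment ℝ _ _) h'
    have := hinj hx
    subst this
    rcases hv' with h | h
    · exact absurd h.symm n1
    · exact absurd h.symm n2
  · obtain ⟨v, hv, hv', hx⟩ := hmeet (q (i + 1 + 1)) h' (right_mem_segment ℝ _ _)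
    have := hinj hx
    subst this
    rcases hv with h | h
    · exact absurd h n2
    · exact absurd h n3

lemma eventually_pos_of_tendsto {g : ℝ → ℝ} (hg : Continuous g) (h : 0 < g 0) :
    ∀ᶠ ε in nhdsWithin 0 (Ioi 0), 0 < g ε :=
  nhdsWithin_le_nhds (hg.continuousAt.eventually_const_lt h)

/-- A positively oriented triangulated loop can be pushed slightly inwards. -/
lemma exists_shrink (hn : 3 ≤ n) {q : Fin n → E2} (hs : SimpleLoop q (List.finRange n))
    {T : List (Fin n × Fin n × Fin n)}
    (hT : ∀ t ∈ T, 0 < orient (q t.1) (q t.2.1) (q t.2.2)) :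
    ∃ q' : Fin n → E2, (∀ i, 0 < orient (q i) (q (i + 1)) (q' (i + 1))) ∧
      (∀ i, 0 < orient (q i) (q' (i + 1)) (q' i)) ∧
      ∀ t ∈ T, 0 < orient (q' t.1) (q' t.2.1) (q' t.2.2) := by
  have hinj : ∀ {a b}, q a = q b → a = b := fun {a b} h =>
    hs.inj a (List.mem_finRange _) b (List.mem_finRange _) h
  have hex : ∀ j : Fin n, ∃ d, 0 < det2 (q j - q (j - 1)) d ∧ 0 < det2 (q (j + 1) - q j) d := by
    intro j
    have hj : j - 1 + 1 = j := sub_add_cancel j 1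
    have hna := hs.not_antiparallel hn (j - 1)
    rw [hj] at hna
    refine exists_left_normal (sub_ne_zero.2 fun h => ?_) (sub_ne_zero.2 fun h => ?_) hna
    · have := (Fin.add_one_ne_self' hn (j - 1)).1
      rw [hj] at this
      exact this (hinj h)
    · exact (Fin.add_one_ne_self' hn j).1 (hinj h)
  choose d hd1 hd2 using hex
  have e2 : ∀ᶠ ε in nhdsWithin (0 : ℝ) (Ioi 0), ∀ i : Fin n,
      0 < det2 (q (i + 1) - q i) (d i) + ε * det2 (d (i + 1)) (d i) := by
    refine Filter.eventually_all.2 fun i => eventually_pos_of_tendsto (by fun_prop) ?_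
    simpa using hd2 i
  have e3 : ∀ᶠ ε in nhdsWithin (0 : ℝ) (Ioi 0), ∀ t : Fin n × Fin n × Fin n, t ∈ T →
      0 < orient (q t.1 + ε • d t.1) (q t.2.1 + ε • d t.2.1) (q t.2.2 + ε • d t.2.2) := by
    refine Filter.eventually_all.2 fun t => ?_
    by_cases ht : t ∈ T
    · refine (eventually_pos_of_tendsto (g := fun ε : ℝ => orient (q t.1 + ε • d t.1)
        (q t.2.1 + ε • d t.2.1) (q t.2.2 + ε • d t.2.2)) ?_ ?_).mono fun ε h _ => h
      · simp only [orient, det2, PiLp.sub_apply, PiLp.add_apply, PiLp.smul_apply, smul_eq_mul]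
        fun_prop
      · simpa using hT t ht
    · exact Filter.Eventually.of_forall fun ε h => absurd h ht
  obtain ⟨ε, ⟨h2, h3⟩, hε⟩ := ((e2.and e3).and self_mem_nhdsWithin).exists
  refine ⟨fun i => q i + ε • d i, fun i => ?_, fun i => ?_, h3⟩
  · have := hd1 (i + 1)
    rw [add_sub_cancel_right] at this
    have e : orient (q i) (q (i + 1)) (q (i + 1) + ε • d (i + 1)) =
        ε * det2 (q (i + 1) - q i) (d (i + 1)) := by
      simp [orient, det2]; ring
    rw [e]; positivity
  · have e : orient (q i) (q (i + 1) + ε • d (i + 1)) (q i + ε • d i) =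
        ε * (det2 (q (i + 1) - q i) (d i) + ε * det2 (d (i + 1)) (d i)) := by
      simp [orient, det2]; ring
    rw [e]
    exact mul_pos hε (h2 i)

end Shrink

section Triangle

variable {a b c : E2}

lemma continuous_orient (a b : E2) : Continuous fun x => orient a b x := by
  unfold orient det2
  fun_prop

lemma orient_combo (a b x y : E2) {s t : ℝ} (h : s + t = 1) :
    orient a b (s • x + t • y) = s * orient a b x + t * orient a b y := by
  have : t = 1 - s := by linarith
  subst this
  simp [orient, det2]; ring

lemma convex_orient_nonneg (a b : E2) : Convex ℝ {x | 0 ≤ orient a b x} := by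
  intro x hx y hy s t hs ht hst
  rw [mem_ofPred_eq, orient_combo a b x y hst]
  exact add_nonneg (mul_nonneg hs hx) (mul_nonneg ht hy)

lemma mem_triangle_iff (hO : 0 < orient a b c) {x : E2} : x ∈ convexHull ℝ {a, b, c} ↔
    0 ≤ orient a b x ∧ 0 ≤ orient b c x ∧ 0 ≤ orient c a x := by
  have hab : orient a b a = 0 := by simp [orient, det2]
  have hab' : orient a b b = 0 := by simp [orient, det2]; ring
  have hbc : orient b c b = 0 := by simp [orient, det2]
  have hbc' : orient b c c = 0 := by simp [orient, det2]; ring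
  have hca : orient c a c = 0 := by simp [orient, det2]
  have hca' : orient c a a = 0 := by simp [orient, det2]; ring
  have hO1 : orient b c a = orient a b c := orient_rotate a b c
  have hO2 : orient c a b = orient a b c := by rw [← hO1]; exact orient_rotate b c a
  constructor
  · intro hx
    have := convexHull_min (t := {x | 0 ≤ orient a b x} ∩ ({x | 0 ≤ orient b c x} ∩
      {x | 0 ≤ orient c a x})) ?_ ((convex_orient_nonneg a b).inter
        ((convex_orient_nonneg b c).inter (convex_orient_nonneg c a))) hx
    · exact this
    · rintro y (rfl | rfl | rfl)
      · simp only [mem_inter_iff, mem_ofPred_eq, hab, hca', hO1]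
        exact ⟨le_rfl, hO.le, le_rfl⟩
      · simp only [mem_inter_iff, mem_ofPred_eq, hab', hbc, hO2]
        exact ⟨le_rfl, le_rfl, hO.le⟩
      · simp only [mem_inter_iff, mem_ofPred_eq, hbc', hca]
        exact ⟨hO.le, le_rfl, le_rfl⟩
  · rintro ⟨h1, h2, h3⟩
    have e : x = ∑ i : Fin 3, ![orient b c x / orient a b c, orient c a x / orient a b c,
        orient a b x / orient a b c] i • ![a, b, c] i := by
      simp only [Fin.sum_univ_three, Matrix.cons_val]
      rw [div_eq_inv_mul, div_eq_inv_mul, div_eq_inv_mul, mul_smul, mul_smul, mul_smul, ← smul_add,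
        ← smul_add, eq_inv_smul_iff₀ hO.ne']
      ext i
      fin_cases i <;> simp [orient, det2] <;> ring
    rw [e]
    refine (convex_convexHull ℝ _).sum_mem ?_ ?_ ?_
    · intro i _
      fin_cases i <;> simp <;> positivity
    · simp only [Fin.sum_univ_three, Matrix.cons_val]
      rw [← add_div, ← add_div, div_eq_one_iff_eq hO.ne']
      simp [orient, det2]; ring
    · intro i _
      apply subset_convexHull
      fin_cases i <;> simp

lemma mem_interior_triangle_iff (hO : 0 < orient a b c) {x : E2} :
    x ∈ interior (convexHull ℝ {a, b, c}) ↔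
      0 < orient a b x ∧ 0 < orient b c x ∧ 0 < orient c a x := by
  have key : ∀ p q : E2, p ≠ q → (∀ y ∈ convexHull ℝ {a, b, c}, 0 ≤ orient p q y) →
      x ∈ interior (convexHull ℝ {a, b, c}) → 0 < orient p q x := by
    intro p q hpq hpos hx
    have hc : Continuous fun t : ℝ => x - t • rot (q - p) := by fun_prop
    have h0 : (fun t : ℝ => x - t • rot (q - p)) 0 ∈ interior (convexHull ℝ {a, b, c}) := by
      simpa using hx
    have hev : ∀ᶠ t in nhdsWithin (0 : ℝ) (Ioi 0), x - t • rot (q - p) ∈ convexHull ℝ {a, b, c} :=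
      (show ∀ᶠ t in nhdsWithin (0 : ℝ) (Ioi 0), x - t • rot (q - p) ∈
        interior (convexHull ℝ {a, b, c}) from nhdsWithin_le_nhds
          (hc.continuousAt (isOpen_interior.mem_nhds h0))).mono fun t ht => interior_subset ht
    obtain ⟨t, ht, ht0⟩ := (hev.and self_mem_nhdsWithin).exists
    have h1 := hpos _ ht
    rw [orient_sub_smul, det2_rot] at h1
    have h2 := nsq_pos (sub_ne_zero.2 hpq.symm)
    have h3 := mul_pos (show (0 : ℝ) < t from ht0) h2
    linarith
  constructor
  · intro hx
    refine ⟨key a b ?_ (fun y hy => ((mem_triangle_iff hO).1 hy).1) hx,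
      key b c ?_ (fun y hy => ((mem_triangle_iff hO).1 hy).2.1) hx,
      key c a ?_ (fun y hy => ((mem_triangle_iff hO).1 hy).2.2) hx⟩ <;>
    · rintro rfl
      simp [orient, det2] at hO
      try linarith
  · rintro ⟨h1, h2, h3⟩
    have hopen : IsOpen {x | 0 < orient a b x ∧ 0 < orient b c x ∧ 0 < orient c a x} :=
      (isOpen_lt continuous_const (continuous_orient a b)).inter
        ((isOpen_lt continuous_const (continuous_orient b c)).inter
          (isOpen_lt continuous_const (continuous_orient c a)))
    exact interior_maximal (fun y hy => (mem_triangle_iff hO).2 ⟨hy.1.le, hy.2.1.le, hy.2.2.le⟩)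
      hopen ⟨h1, h2, h3⟩

lemma isClosed_triangle (a b c : E2) : IsClosed (convexHull ℝ {a, b, c}) :=
  Set.Finite.isClosed_convexHull ℝ (Set.toFinite {a, b, c})

lemma mem_frontier_triangle_iff (hO : 0 < orient a b c) {x : E2} :
    x ∈ frontier (convexHull ℝ {a, b, c}) ↔ x ∈ convexHull ℝ {a, b, c} ∧
      (orient a b x = 0 ∨ orient b c x = 0 ∨ orient c a x = 0) := by
  rw [(isClosed_triangle a b c).frontier_eq, mem_sdiff, mem_interior_triangle_iff hO]
  refine and_congr_right fun hx => ?_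
  obtain ⟨h1, h2, h3⟩ := (mem_triangle_iff hO).1 hx
  rw [not_and_or, not_and_or, not_lt, not_lt, not_lt]
  constructor
  · rintro (h | h | h)
    · exact Or.inl (le_antisymm h h1)
    · exact Or.inr (Or.inl (le_antisymm h h2))
    · exact Or.inr (Or.inr (le_antisymm h h3))
  · rintro (h | h | h)
    · exact Or.inl h.le
    · exact Or.inr (Or.inl h.le)
    · exact Or.inr (Or.inr h.le)

end Triangle

section Polar

/-- The unit vector in the direction `t`. -/
def dir (t : ℝ) : E2 := !₂[cos t, sin t]

lemma norm_eq_sqrt_nsq (u : E2) : ‖u‖ = √(nsq u) := by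
  rw [EuclideanSpace.norm_eq]; simp [nsq]

lemma norm_sq_eq_nsq (u : E2) : ‖u‖ ^ 2 = nsq u := by
  rw [norm_eq_sqrt_nsq, Real.sq_sqrt]; simp only [nsq]; positivity

lemma norm_dir (t : ℝ) : ‖dir t‖ = 1 := by
  rw [norm_eq_sqrt_nsq]; simp [dir, nsq]

lemma abs_det2_le (u v : E2) : |det2 u v| ≤ ‖u‖ * ‖v‖ := by
  apply abs_le_of_sq_le_sq _ (by positivity)
  rw [mul_pow, norm_sq_eq_nsq, norm_sq_eq_nsq]
  simp only [det2, nsq]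
  nlinarith [sq_nonneg (u 0 * v 0 + u 1 * v 1)]

lemma norm_toC (u : E2) : ‖toC u‖ = ‖u‖ := by
  rw [norm_eq_sqrt_nsq, Complex.norm_eq_sqrt_sq_add_sq]; simp [toC, nsq]

lemma eq_norm_smul_dir {u : E2} {t : ℝ} (h : (t : Real.Angle) = Complex.arg (toC u)) :
    u = ‖u‖ • dir t := by
  have h1 : cos t = cos (Complex.arg (toC u)) := by
    rw [← Real.Angle.cos_coe, h, Real.Angle.cos_coe]
  have h2 : sin t = sin (Complex.arg (toC u)) := by
    rw [← Real.Angle.sin_coe, h, Real.Angle.sin_coe]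
  have h3 := Complex.norm_mul_cos_arg (toC u)
  have h4 := Complex.norm_mul_sin_arg (toC u)
  rw [norm_toC] at h3 h4
  ext i
  fin_cases i
  · simp only [dir, h1]
    exact h3.symm
  · simp only [dir, h2]
    exact h4.symm

lemma norm_dir_sub_dir (s t : ℝ) : ‖dir s - dir t‖ = 2 * |sin ((t - s) / 2)| := by
  rw [← abs_of_nonneg (norm_nonneg _), ← abs_of_nonneg (show (0 : ℝ) ≤ 2 * |_| by positivity),
    ← sq_eq_sq_iff_abs_eq_abs, norm_sq_eq_nsq, mul_pow, sq_abs]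
  have e1 : cos (t - s) = 1 - 2 * sin ((t - s) / 2) ^ 2 := by
    have := Real.cos_two_mul ((t - s) / 2)
    rw [show 2 * ((t - s) / 2) = t - s by ring] at this
    have h3 := Real.sin_sq_add_cos_sq ((t - s) / 2)
    linarith
  rw [Real.cos_sub] at e1
  have h4 := Real.sin_sq_add_cos_sq s
  have h5 := Real.sin_sq_add_cos_sq t
  simp only [nsq, dir, PiLp.sub_apply]
  simp
  nlinarith

lemma orient_dir (s t u : ℝ) : orient (dir s) (dir t) (dir u) =
    4 * sin ((t - s) / 2) * sin ((u - t) / 2) * sin ((u - s) / 2) := by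
  have e1 : orient (dir s) (dir t) (dir u) = sin (t - s) + sin (u - t) - sin (u - s) := by
    simp only [orient, det2, dir, PiLp.sub_apply, Real.sin_sub]
    simp
    ring
  obtain ⟨A, hA⟩ : ∃ A, A = (t - s) / 2 := ⟨_, rfl⟩
  obtain ⟨B, hB⟩ : ∃ B, B = (u - t) / 2 := ⟨_, rfl⟩
  rw [e1, ← hA, ← hB, show t - s = 2 * A by rw [hA]; ring, show u - t = 2 * B by rw [hB]; ring,
    show u - s = 2 * A + 2 * B by rw [hA, hB]; ring, show (2 * A + 2 * B) / 2 = A + B by ring,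
    Real.sin_add (2 * A), Real.sin_add A, Real.sin_two_mul, Real.sin_two_mul, Real.cos_two_mul',
    Real.cos_two_mul']
  have h1 := Real.sin_sq_add_cos_sq A
  have h2 := Real.sin_sq_add_cos_sq B
  linear_combination (-2 * sin A * cos A) * h2 - 2 * sin B * cos B * h1

lemma sin_half_ge {x α β κ : ℝ} (hα : 0 < α) (hα' : α < π) (hβ : 0 < β) (hβ' : β < π)
    (h1 : α ≤ x) (h2 : x ≤ 2 * π - β) (hκ1 : κ ≤ sin α) (hκ2 : κ ≤ sin β) :
    κ / 2 ≤ sin (x / 2) := by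
  have half : ∀ y, 0 < y → y < π → sin y / 2 ≤ sin (y / 2) := by
    intro y h0 h1
    have := Real.sin_two_mul (y / 2)
    rw [show 2 * (y / 2) = y by ring] at this
    have h2 : 0 ≤ sin (y / 2) := sin_nonneg_of_nonneg_of_le_pi (by linarith) (by linarith)
    have h3 := Real.cos_le_one (y / 2)
    nlinarith
  rcases le_total (x / 2) (π / 2) with h | h
  · have : sin (α / 2) ≤ sin (x / 2) :=
      Real.sin_le_sin_of_le_of_le_pi_div_two (by linarith) h (by linarith)
    linarith [half α hα hα']
  · have : sin (β / 2) ≤ sin (π - x / 2) :=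
      Real.sin_le_sin_of_le_of_le_pi_div_two (by linarith) (by linarith) (by linarith)
    rw [Real.sin_pi_sub] at this
    linarith [half β hβ hβ']

lemma sin_angle_mul_dist (p q r : E2) :
    sin (∠ p q r) * (dist p q * dist q r) = |orient p q r| := by
  have h1 := InnerProductGeometry.sin_angle_mul_norm_mul_norm (p - q) (r - q)
  rw [dist_eq_norm, dist_eq_norm, norm_sub_rev q r, EuclideanGeometry.angle, vsub_eq_sub,
    vsub_eq_sub, h1, ← Real.sqrt_sq_eq_abs]
  congr 1
  simp only [PiLp.inner_apply, Fin.sum_univ_two, orient, det2, PiLp.sub_apply]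
  simp
  ring

lemma le_sin_angle {p q r : E2} (hpq : p ≠ q) (hqr : q ≠ r) {k : ℝ}
    (h : k * (dist p q * dist q r) ≤ |orient p q r|) : k ≤ sin (∠ p q r) := by
  rw [← sin_angle_mul_dist] at h
  exact le_of_mul_le_mul_right h (mul_pos (dist_pos.2 hpq) (dist_pos.2 hqr))

end Polar

section BoundaryFaces

variable {M : SimplicialComplex ℝ E2}

lemma vertex_mem_of_mem {x : E2} {t : Finset E2} (hx : {x} ∈ M.faces) (ht : t ∈ M.faces)
    (h : x ∈ convexHull ℝ (t : Set E2)) : x ∈ t := by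
  by_contra hxt
  have := M.inter_subset_convexHull hx ht ⟨subset_convexHull ℝ _ (by simp), h⟩
  have he : ((({x} : Finset E2) : Set E2) ∩ (t : Set E2)) = ∅ := by
    ext y
    simp only [Finset.coe_singleton, mem_inter_iff, mem_singleton_iff, Finset.mem_coe,
      mem_empty_iff_false, iff_false, not_and]
    rintro rfl
    exact hxt
  rw [he, convexHull_empty] at this
  exact this

lemma singleton_mem_faces {x : E2} {t : Finset E2} (ht : t ∈ M.faces) (h : x ∈ t) :
    {x} ∈ M.faces :=
  M.down_closed ht (by simpa using h) (by simp)

/-- A point of a one-dimensional complex is a vertex or interior to an edge. -/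
lemma vertex_or_edge (hdim : ∀ s ∈ M.faces, s.card ≤ 2) {x : E2} (hx : x ∈ M.space) :
    {x} ∈ M.faces ∨ ∃ y z : E2, y ≠ z ∧ {y, z} ∈ M.faces ∧ ∃ s t : ℝ, 0 < s ∧ 0 < t ∧ s + t = 1 ∧
      x = s • y + t • z := by
  obtain ⟨e, he, hxe⟩ := SimplicialComplex.mem_space_iff.1 hx
  have h1 := hdim e he
  have h0 := Finset.card_pos.2 (M.nonempty_of_mem_faces he)
  rcases (show e.card = 1 ∨ e.card = 2 by omega) with h | h
  · obtain ⟨y, rfl⟩ := Finset.card_eq_one.1 h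
    left
    simp only [Finset.coe_singleton, convexHull_singleton, mem_singleton_iff] at hxe
    rwa [hxe]
  · obtain ⟨y, z, hyz, rfl⟩ := Finset.card_eq_two.1 h
    rw [Finset.coe_pair, convexHull_pair] at hxe
    obtain ⟨s, t, hs, ht, hst, rfl⟩ := hxe
    rcases hs.eq_or_lt with rfl | hs
    · left
      rw [show t = 1 by linarith]
      simpa using singleton_mem_faces he (by simp)
    rcases ht.eq_or_lt with rfl | ht
    · left
      rw [show s = 1 by linarith]
      simpa using singleton_mem_faces he (by simp)
    exact Or.inr ⟨y, z, hyz, he, s, t, hs, ht, hst, rfl⟩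

/-- The point dividing the segment from `p` to `q` in the ratio `u : 1 - u`. -/
def lin (p q : E2) (u : ℝ) : E2 := (1 - u) • p + u • q

lemma lin_inj {p q : E2} (h : p ≠ q) {u v : ℝ} (e : lin p q u = lin p q v) : u = v := by
  have : (u - v) • (q - p) = 0 := by
    have e2 : lin p q u - lin p q v = (u - v) • (q - p) := by unfold lin; module
    rw [← e2, e, sub_self]
  rcases smul_eq_zero.1 this with h' | h'
  · linarith
  · exact absurd (sub_eq_zero.1 h').symm h

lemma lin_mem_segment {p q : E2} {i j u : ℝ} (h1 : i ≤ u) (h2 : u ≤ j) :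
    lin p q u ∈ segment ℝ (lin p q i) (lin p q j) := by
  rcases h1.eq_or_lt with rfl | h1
  · exact left_mem_segment ℝ _ _
  · have hpos : 0 < j - i := by linarith
    refine ⟨(j - u) / (j - i), (u - i) / (j - i), by apply div_nonneg <;> linarith,
      by apply div_nonneg <;> linarith, by field_simp; ring, ?_⟩
    have : (j - u) / (j - i) = 1 - (u - i) / (j - i) := by field_simp; ring
    have h3 : u = i + (u - i) / (j - i) * (j - i) := by field_simp; ring
    rw [this]
    set k := (u - i) / (j - i)
    rw [h3]
    unfold lin
    module

variable {p q z : E2}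

lemma orient_lin (p q : E2) (u : ℝ) : orient p q (lin p q u) = 0 := by
  simp [orient, det2, lin]; ring

lemma lin_mem_triangle (hO : 0 < orient p q z) {u : ℝ} (h0 : 0 ≤ u) (h1 : u ≤ 1) :
    lin p q u ∈ frontier (convexHull ℝ {p, q, z}) := by
  rw [mem_frontier_triangle_iff hO]
  refine ⟨?_, Or.inl (orient_lin p q u)⟩
  exact (convex_convexHull ℝ _) (subset_convexHull ℝ _ (by simp)) (subset_convexHull ℝ _ (by simp))
    (by linarith) h0 (by ring)

lemma eq_lin_of_orient_eq_zero (hO : 0 < orient p q z) {x : E2}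
    (hx : x ∈ convexHull ℝ {p, q, z}) (h : orient p q x = 0) :
    ∃ u, 0 ≤ u ∧ u ≤ 1 ∧ x = lin p q u := by
  obtain ⟨-, h2, h3⟩ := (mem_triangle_iff hO).1 hx
  have hsum : orient q z x + orient z p x = orient p q z := by
    have : orient p q x + orient q z x + orient z p x = orient p q z := by
      simp [orient, det2]; ring
    linarith
  refine ⟨orient z p x / orient p q z, by positivity, by rw [div_le_one hO]; linarith, ?_⟩
  have : (1 : ℝ) - orient z p x / orient p q z = orient q z x / orient p q z := by
    rw [← hsum]
    have : orient q z x + orient z p x ≠ 0 := by rw [hsum]; exact hO.ne'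
    field_simp; ring
  rw [lin, this, div_eq_inv_mul, div_eq_inv_mul, mul_smul, mul_smul, ← smul_add,
    eq_inv_smul_iff₀ hO.ne']
  have e : orient p q z • x = orient q z x • p + orient z p x • q + orient p q x • z := by
    ext i
    fin_cases i <;> simp [orient, det2] <;> ring
  rw [e, h, zero_smul, add_zero]

lemma ne_of_orient_pos' (hO : 0 < orient p q z) : p ≠ q := by
  rintro rfl
  simp [orient, det2] at hO

lemma space_subset_triangle (hM : M.space = frontier (convexHull ℝ {p, q, z})) :
    M.space ⊆ convexHull ℝ {p, q, z} := by
  rw [hM]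
  exact (isClosed_triangle p q z).frontier_subset

lemma corner_mem (hO : 0 < orient p q z) (hdim : ∀ s ∈ M.faces, s.card ≤ 2)
    (hM : M.space = frontier (convexHull ℝ {p, q, z})) : {p} ∈ M.faces := by
  have hp : p ∈ M.space := by
    rw [hM]
    simpa [lin] using lin_mem_triangle hO le_rfl zero_le_one
  rcases vertex_or_edge hdim hp with h | ⟨x, y, -, he, s, t, hs, ht, hst, e⟩
  · exact h
  · have hx := space_subset_triangle hM (M.subset_space he (show x ∈ _ by simp))
    have hy := space_subset_triangle hM (M.subset_space he (show y ∈ _ by simp))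
    obtain ⟨x1, x2, x3⟩ := (mem_triangle_iff hO).1 hx
    obtain ⟨y1, y2, y3⟩ := (mem_triangle_iff hO).1 hy
    have k1 := orient_combo p q x y hst
    have k3 := orient_combo z p x y hst
    rw [← e] at k1 k3
    have z1 : orient p q p = 0 := by simp [orient, det2]
    have z3 : orient z p p = 0 := by simp [orient, det2]; ring
    rw [z1] at k1
    rw [z3] at k3
    have q1 : orient p q x = 0 := by nlinarith [mul_nonneg hs.le x1, mul_nonneg ht.le y1]
    have q3 : orient z p x = 0 := by nlinarith [mul_nonneg hs.le x3, mul_nonneg ht.le y3]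
    obtain ⟨u, -, -, hu⟩ := eq_lin_of_orient_eq_zero hO hx q1
    have : orient z p (lin p q u) = u * orient p q z := by simp [orient, det2, lin]; ring
    rw [← hu, q3] at this
    have hu0 : u = 0 := by
      rcases mul_eq_zero.1 this.symm with h | h
      · exact h
      · exact absurd h hO.ne'
    have hxp : x = p := by rw [hu, hu0]; simp [lin]
    rw [← hxp]
    exact singleton_mem_faces he (by simp)

/-- Consecutive vertices on a side span an edge. -/
lemma edge_of_gap (hO : 0 < orient p q z) (hdim : ∀ s ∈ M.faces, s.card ≤ 2)
    (hM : M.space = frontier (convexHull ℝ {p, q, z})) {s s' : ℝ} (h0 : 0 ≤ s) (hss : s < s')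
    (h1 : s' ≤ 1) (hs : {lin p q s} ∈ M.faces) (hs' : {lin p q s'} ∈ M.faces)
    (hgap : ∀ u, s < u → u < s' → {lin p q u} ∉ M.faces) :
    {lin p q s, lin p q s'} ∈ M.faces := by
  have hpq := ne_of_orient_pos' hO
  have hm : lin p q ((s + s') / 2) ∈ M.space := by
    rw [hM]
    exact lin_mem_triangle hO (by linarith) (by linarith)
  rcases vertex_or_edge hdim hm with h | ⟨x, y, hxy, he, a, b, ha, hb, hab, e⟩
  · exact absurd h (hgap _ (by linarith) (by linarith))
  have hx := space_subset_triangle hM (M.subset_space he (show x ∈ _ by simp))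
  have hy := space_subset_triangle hM (M.subset_space he (show y ∈ _ by simp))
  obtain ⟨x1, -, -⟩ := (mem_triangle_iff hO).1 hx
  obtain ⟨y1, -, -⟩ := (mem_triangle_iff hO).1 hy
  have k1 := orient_combo p q x y hab
  rw [← e, orient_lin] at k1
  have q1 : orient p q x = 0 := by nlinarith [mul_nonneg ha.le x1, mul_nonneg hb.le y1]
  have q2 : orient p q y = 0 := by nlinarith [mul_nonneg ha.le x1, mul_nonneg hb.le y1]
  obtain ⟨i, hi0, hi1, hi⟩ := eq_lin_of_orient_eq_zero hO hx q1
  obtain ⟨j, hj0, hj1, hj⟩ := eq_lin_of_orient_eq_zero hO hy q2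
  have main : ∀ (i j a b : ℝ), 0 < a → 0 < b → a + b = 1 → i < j →
      {lin p q i, lin p q j} ∈ M.faces →
      lin p q ((s + s') / 2) = a • lin p q i + b • lin p q j →
      {lin p q s, lin p q s'} ∈ M.faces := by
    intro i j a b ha hb hab hij he e
    have e2 : (s + s') / 2 = a * i + b * j := by
      apply lin_inj hpq
      rw [e]
      have : a = 1 - b := by linarith
      subst this
      unfold lin
      module
    have hi' : i ≤ s := by
      by_contra hcon
      push Not at hcon
      exact hgap i hcon (by nlinarith) (singleton_mem_faces he (by simp))
    have hj' : s' ≤ j := by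
      by_contra hcon
      push Not at hcon
      exact hgap j (by nlinarith) hcon (singleton_mem_faces he (by simp))
    have ms := vertex_mem_of_mem hs he (by
      rw [Finset.coe_pair, convexHull_pair]
      exact lin_mem_segment hi' (by linarith))
    have ms' := vertex_mem_of_mem hs' he (by
      rw [Finset.coe_pair, convexHull_pair]
      exact lin_mem_segment (by linarith) hj')
    rw [Finset.mem_insert, Finset.mem_singleton] at ms ms'
    have es : s = i := by
      rcases ms with h | h
      · exact lin_inj hpq h
      · have := lin_inj hpq h; linarith
    have es' : s' = j := by
      rcases ms' with h | h
      · have := lin_inj hpq h; linarith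
      · exact lin_inj hpq h
    rw [es, es']
    exact he
  rw [hi, hj] at he e
  rcases lt_trichotomy i j with h | h | h
  · exact main i j a b ha hb hab h he e
  · exact absurd (by rw [hi, hj, h]) hxy
  · exact main j i b a hb ha (by linarith) h (by rwa [Finset.pair_comm]) (by rw [e, add_comm])

end BoundaryFaces

section BoundaryPath

/-- The side of the triangle `abc` with number `k`, from `p` to `q`, with opposite corner `z`. -/
def IsSide (a b c : E2) (k : ℝ) (p q z : E2) : Prop :=
  (k = 0 ∧ p = a ∧ q = b ∧ z = c) ∨ (k = 1 ∧ p = b ∧ q = c ∧ z = a) ∨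
    (k = 2 ∧ p = c ∧ q = a ∧ z = b)

/-- The path around the boundary of the triangle `abc`, parametrized by `[0, 3]`. -/
def bpath (a b c : E2) (s : ℝ) : E2 :=
  if s ≤ 1 then lin a b s else if s ≤ 2 then lin b c (s - 1) else lin c a (s - 2)

lemma lin_zero (p q : E2) : lin p q 0 = p := by simp [lin]

lemma lin_one (p q : E2) : lin p q 1 = q := by simp [lin]

variable {a b c p q z : E2} {k : ℝ}

lemma IsSide.orient_eq (h : IsSide a b c k p q z) : orient p q z = orient a b c := by
  rcases h with ⟨-, rfl, rfl, rfl⟩ | ⟨-, rfl, rfl, rfl⟩ | ⟨-, rfl, rfl, rfl⟩ <;>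
    simp [orient, det2] <;> ring

lemma IsSide.set_eq (h : IsSide a b c k p q z) : ({p, q, z} : Set E2) = {a, b, c} := by
  rcases h with ⟨-, rfl, rfl, rfl⟩ | ⟨-, rfl, rfl, rfl⟩ | ⟨-, rfl, rfl, rfl⟩ <;> ext x <;>
    simp <;> tauto

lemma IsSide.bpath_eq (h : IsSide a b c k p q z) {u : ℝ} (h0 : k ≤ u) (h1 : u ≤ k + 1) :
    bpath a b c u = lin p q (u - k) := by
  rcases h with ⟨rfl, rfl, rfl, rfl⟩ | ⟨rfl, rfl, rfl, rfl⟩ | ⟨rfl, rfl, rfl, rfl⟩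
  · rw [bpath, if_pos (by linarith), sub_zero]
  · rcases h0.eq_or_lt with rfl | h0
    · rw [bpath, if_pos le_rfl, sub_self, lin_zero, lin_one]
    · rw [bpath, if_neg (by linarith), if_pos (by linarith)]
  · rcases h0.eq_or_lt with rfl | h0
    · rw [bpath, if_neg (by norm_num), if_pos le_rfl, sub_self, lin_zero,
        show (2 : ℝ) - 1 = 1 by norm_num, lin_one]
    · rw [bpath, if_neg (by linarith), if_neg (by linarith)]

lemma exists_side (a b c : E2) {s : ℝ} (h0 : 0 ≤ s) (h3 : s < 3) :
    ∃ k p q z, IsSide a b c k p q z ∧ k ≤ s ∧ s < k + 1 := by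
  rcases lt_or_ge s 1 with h1 | h1
  · exact ⟨0, a, b, c, Or.inl ⟨rfl, rfl, rfl, rfl⟩, h0, by linarith⟩
  rcases lt_or_ge s 2 with h2 | h2
  · exact ⟨1, b, c, a, Or.inr (Or.inl ⟨rfl, rfl, rfl, rfl⟩), h1, by linarith⟩
  · exact ⟨2, c, a, b, Or.inr (Or.inr ⟨rfl, rfl, rfl, rfl⟩), h2, by linarith⟩

lemma bpath_zero : bpath a b c 0 = a := by
  rw [bpath, if_pos (by norm_num), lin_zero]

lemma bpath_three : bpath a b c 3 = a := by
  rw [bpath, if_neg (by norm_num), if_neg (by norm_num), show (3 : ℝ) - 2 = 1 by norm_num, lin_one]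

lemma bpath_injOn (hO : 0 < orient a b c) : InjOn (bpath a b c) (Ico 0 3) := by
  intro s hs t ht e
  have f2 : ∀ u (p q z : E2), orient q z (lin p q u) = (1 - u) * orient p q z := by
    intro u p q z; simp [orient, det2, lin]; ring
  have f3 : ∀ u (p q z : E2), orient z p (lin p q u) = u * orient p q z := by
    intro u p q z; simp [orient, det2, lin]; ring
  have r1 : orient b c a = orient a b c := orient_rotate a b c
  have r2 : orient c a b = orient a b c := by rw [orient_rotate b c a, r1]
  have e1 := congrArg (orient a b) e
  have e2 := congrArg (orient b c) e
  have e3 := congrArg (orient c a) e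
  obtain ⟨k, p, q, z, h, h0, h1⟩ := exists_side a b c hs.1 hs.2
  obtain ⟨k', p', q', z', h', h0', h1'⟩ := exists_side a b c ht.1 ht.2
  rw [h.bpath_eq h0 h1.le, h'.bpath_eq h0' h1'.le] at e1 e2 e3
  rcases h with ⟨rfl, rfl, rfl, rfl⟩ | ⟨rfl, rfl, rfl, rfl⟩ | ⟨rfl, rfl, rfl, rfl⟩ <;>
  rcases h' with ⟨rfl, h1, h2, h3⟩ | ⟨rfl, h1, h2, h3⟩ | ⟨rfl, h1, h2, h3⟩ <;>
  subst p' q' z'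
  all_goals
    simp only [orient_lin, f2, f3, r1, r2, zero_eq_mul, mul_eq_zero, hO.ne', or_false,
      mul_left_inj' hO.ne'] at e1 e2 e3
    linarith

lemma exists_bpath (hO : 0 < orient a b c) {x : E2}
    (hx : x ∈ frontier (convexHull ℝ {a, b, c})) : ∃ u, 0 ≤ u ∧ u < 3 ∧ bpath a b c u = x := by
  have key : ∀ k p q z, IsSide a b c k p q z → 0 ≤ k → k ≤ 2 → orient p q x = 0 →
      ∃ u, 0 ≤ u ∧ u < 3 ∧ bpath a b c u = x := by
    intro k p q z h h0 h2 hz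
    obtain ⟨u, u0, u1, hu⟩ := eq_lin_of_orient_eq_zero (z := z) (by rwa [h.orient_eq])
      (by rw [h.set_eq]; exact (isClosed_triangle a b c).frontier_subset hx) hz
    have e : bpath a b c (k + u) = x := by
      rw [h.bpath_eq (by linarith) (by linarith), hu, add_sub_cancel_left]
    rcases lt_or_ge (k + u) 3 with h3 | h3
    · exact ⟨k + u, by linarith, h3, e⟩
    · have : k + u = 3 := by linarith
      rw [this, bpath_three] at e
      exact ⟨0, le_rfl, by norm_num, bpath_zero.trans e⟩
  rcases ((mem_frontier_triangle_iff hO).1 hx).2 with h | h | h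
  · exact key 0 a b c (Or.inl ⟨rfl, rfl, rfl, rfl⟩) (by norm_num) (by norm_num) h
  · exact key 1 b c a (Or.inr (Or.inl ⟨rfl, rfl, rfl, rfl⟩)) (by norm_num) (by norm_num) h
  · exact key 2 c a b (Or.inr (Or.inr ⟨rfl, rfl, rfl, rfl⟩)) (by norm_num) (by norm_num) h

lemma IsSide.bounds (h : IsSide a b c k p q z) : 0 ≤ k ∧ k ≤ 2 := by
  rcases h with ⟨rfl, -⟩ | ⟨rfl, -⟩ | ⟨rfl, -⟩ <;> norm_num

end BoundaryPath

section LoopExistence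

variable {M : SimplicialComplex ℝ E2} {a b c : E2}

/-- If a point which is not a vertex lies on two edges, then these coincide. -/
lemma pair_eq_of_mem {e e' : Finset E2} (he : e ∈ M.faces) (he' : e' ∈ M.faces) {m : E2}
    (hm : {m} ∉ M.faces) (h : m ∈ convexHull ℝ (e : Set E2))
    (h' : m ∈ convexHull ℝ (e' : Set E2)) (hc : e.card = 2) (hc' : e'.card = 2) : e = e' := by
  classical
  have hi := M.inter_subset_convexHull he he' ⟨h, h'⟩
  rw [← Finset.coe_inter] at hi
  have h2 : 2 ≤ (e ∩ e').card := by
    by_contra hcon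
    rcases (show (e ∩ e').card = 0 ∨ (e ∩ e').card = 1 by omega) with h0 | h1
    · rw [Finset.card_eq_zero] at h0
      simp [h0] at hi
    · obtain ⟨w, hw⟩ := Finset.card_eq_one.1 h1
      simp only [hw, Finset.coe_singleton, convexHull_singleton, mem_singleton_iff] at hi
      subst hi
      refine hm (singleton_mem_faces he ?_)
      have : m ∈ e ∩ e' := by rw [hw]; simp
      exact (Finset.mem_inter.1 this).1
  have k1 := Finset.eq_of_subset_of_card_le (Finset.inter_subset_left (s₁ := e) (s₂ := e'))
    (by omega)
  have k2 := Finset.eq_of_subset_of_card_le (Finset.inter_subset_right (s₁ := e) (s₂ := e'))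
    (by omega)
  rw [← k1, k2]

/-- `v` enumerates the vertices of a subdivision `M` of the boundary of the triangle `abc` in
counterclockwise order. -/
structure BoundaryLoop (M : SimplicialComplex ℝ E2) (a b c : E2) {n : ℕ} [NeZero n]
    (v : Fin n → E2) : Prop where
  three_le : 3 ≤ n
  inj : Function.Injective v
  edge : ∀ i, {v i, v (i + 1)} ∈ M.faces
  side : ∀ i, ∃ k p q z s s', IsSide a b c k p q z ∧ 0 ≤ s ∧ s < s' ∧ s' ≤ 1 ∧
    v i = lin p q s ∧ v (i + 1) = lin p q s'
  cover : ∀ s ∈ M.faces, (∃ i, s = {v i}) ∨ ∃ i, s = {v i, v (i + 1)}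

lemma exists_boundary_loop (hO : 0 < orient a b c) (hfin : M.faces.Finite)
    (hdim : ∀ s ∈ M.faces, s.card ≤ 2) (hM : M.space = frontier (convexHull ℝ {a, b, c})) :
    ∃ n : ℕ, ∃ _ : NeZero n, ∃ v : Fin n → E2, BoundaryLoop M a b c v := by
  classical
  have hMk : ∀ {k p q z}, IsSide a b c k p q z → M.space = frontier (convexHull ℝ {p, q, z}) := by
    intro k p q z h
    rw [h.set_eq, hM]
  have hOk : ∀ {k p q z}, IsSide a b c k p q z → 0 < orient p q z := by
    intro k p q z h
    rwa [h.orient_eq]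
  set S : Set ℝ := {s | s ∈ Ico (0 : ℝ) 3 ∧ {bpath a b c s} ∈ M.faces} with hS
  have hSfin : S.Finite := by
    refine Set.Finite.of_finite_image (f := fun s => ({bpath a b c s} : Finset E2))
      (hfin.subset ?_) ?_
    · rintro _ ⟨s, hs, rfl⟩
      exact hs.2
    · intro s hs t ht e
      exact bpath_injOn hO hs.1 ht.1 (Finset.singleton_injective e)
  have hcorner : ∀ {k p q z}, IsSide a b c k p q z → k ∈ S := by
    intro k p q z h
    refine ⟨⟨h.bounds.1, by linarith [h.bounds.2]⟩, ?_⟩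
    rw [h.bpath_eq le_rfl (by linarith), sub_self, lin_zero]
    exact corner_mem (hOk h) hdim (hMk h)
  have s0 : (0 : ℝ) ∈ S := hcorner (Or.inl ⟨rfl, rfl, rfl, rfl⟩)
  have s1 : (1 : ℝ) ∈ S := hcorner (Or.inr (Or.inl ⟨rfl, rfl, rfl, rfl⟩))
  have s2 : (2 : ℝ) ∈ S := hcorner (Or.inr (Or.inr ⟨rfl, rfl, rfl, rfl⟩))
  set F := hSfin.toFinset with hF
  have memF : ∀ s, s ∈ F ↔ s ∈ S := fun s => hSfin.mem_toFinset
  have hn : 3 ≤ F.card := by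
    have : ({0, 1, 2} : Finset ℝ) ⊆ F := by
      intro x hx
      rw [memF]
      simp only [Finset.mem_insert, Finset.mem_singleton] at hx
      rcases hx with rfl | rfl | rfl <;> assumption
    refine le_trans ?_ (Finset.card_le_card this)
    norm_num
  obtain ⟨n, hcard⟩ : ∃ n, F.card = n := ⟨_, rfl⟩
  rw [hcard] at hn
  have : NeZero n := ⟨by omega⟩
  set τ := F.orderEmbOfFin hcard with hτ
  have hτS : ∀ i, τ i ∈ S := fun i => (memF _).1 (F.orderEmbOfFin_mem hcard i)
  have hτsurj : ∀ s ∈ S, ∃ i, τ i = s := by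
    intro s hs
    have : s ∈ Set.range τ := by rw [hτ, Finset.range_orderEmbOfFin]; exact (memF s).2 hs
    exact this
  have hτ0 : τ 0 = 0 := by
    obtain ⟨j, hj⟩ := hτsurj 0 s0
    have h1 : τ 0 ≤ τ j := τ.monotone (Fin.zero_le j)
    exact le_antisymm (hj ▸ h1) (hτS 0).1.1
  have hnext : ∀ i, ∃ s', τ i < s' ∧ s' ≤ 3 ∧ bpath a b c s' = bpath a b c (τ (i + 1)) ∧
      (s' = 3 ∨ s' ∈ S) ∧ ∀ u ∈ S, τ i < u → s' ≤ u := by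
    intro i
    by_cases hi : i.1 + 1 < n
    · have hv : (i + 1 : Fin n).1 = i.1 + 1 := by
        rw [Fin.val_add, Fin.val_one', Nat.mod_eq_of_lt (show 1 < n by omega),
          Nat.mod_eq_of_lt hi]
      refine ⟨τ (i + 1), τ.strictMono (by rw [Fin.lt_def, hv]; omega), (hτS _).1.2.le, rfl,
        Or.inr (hτS _), ?_⟩
      intro u hu hlt
      obtain ⟨j, rfl⟩ := hτsurj u hu
      have := τ.lt_iff_lt.1 hlt
      refine τ.monotone ?_
      rw [Fin.le_def, hv]
      rw [Fin.lt_def] at this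
      omega
    · have hi' : i.1 + 1 = n := by omega
      have hv : (i + 1 : Fin n) = 0 := by
        ext
        rw [Fin.val_add, Fin.val_one', Nat.mod_eq_of_lt (show 1 < n by omega), hi', Nat.mod_self]
        simp
      refine ⟨3, (hτS i).1.2, le_rfl, ?_, Or.inl rfl, ?_⟩
      · rw [hv, hτ0, bpath_zero, bpath_three]
      · intro u hu hlt
        obtain ⟨j, rfl⟩ := hτsurj u hu
        have := τ.lt_iff_lt.1 hlt
        rw [Fin.lt_def] at this
        omega
  have hseg : ∀ i, ∃ k p q z s', IsSide a b c k p q z ∧ k ≤ τ i ∧ τ i < s' ∧ s' ≤ k + 1 ∧ s' ≤ 3 ∧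
      bpath a b c s' = bpath a b c (τ (i + 1)) ∧ (s' = 3 ∨ s' ∈ S) ∧
      ∀ u ∈ S, τ i < u → s' ≤ u := by
    intro i
    obtain ⟨s', h1, h2, h3, h4, h5⟩ := hnext i
    obtain ⟨k, p, q, z, h, hk, hk1⟩ := exists_side a b c (hτS i).1.1 (hτS i).1.2
    refine ⟨k, p, q, z, s', h, hk, h1, ?_, h2, h3, h4, h5⟩
    rcases h with ⟨rfl, -⟩ | ⟨rfl, -⟩ | ⟨rfl, -⟩
    · exact h5 _ (by rwa [zero_add]) hk1
    · exact h5 _ (by rwa [one_add_one_eq_two]) hk1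
    · linarith
  have hedge : ∀ i, {bpath a b c (τ i), bpath a b c (τ (i + 1))} ∈ M.faces := by
    intro i
    obtain ⟨k, p, q, z, s', h, h1, h2, h3, h4, h5, h6, h7⟩ := hseg i
    have e1 := h.bpath_eq h1 (by linarith)
    have e2 := h.bpath_eq (u := s') (by linarith) h3
    have m2 : {bpath a b c s'} ∈ M.faces := by rw [h5]; exact (hτS _).2
    rw [← h5, e1, e2]
    refine edge_of_gap (hOk h) hdim (hMk h) (by linarith) (by linarith) (by linarith)
      (by rw [← e1]; exact (hτS i).2) (by rw [← e2]; exact m2) ?_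
    intro u hu hu' hmem
    have e3 := h.bpath_eq (u := u + k) (by linarith) (by linarith)
    rw [add_sub_cancel_right] at e3
    have := h7 (u + k) ⟨⟨by linarith [h.bounds.1], by linarith⟩, by rwa [e3]⟩ (by linarith)
    linarith
  have hinj : Function.Injective fun i => bpath a b c (τ i) := by
    intro i j e
    exact τ.injective (bpath_injOn hO (hτS i).1 (hτS j).1 e)
  refine ⟨n, this, fun i => bpath a b c (τ i), hn, hinj, hedge, ?_, ?_⟩
  · intro i
    obtain ⟨k, p, q, z, s', h, h1, h2, h3, h4, h5, h6, h7⟩ := hseg i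
    refine ⟨k, p, q, z, τ i - k, s' - k, h, by linarith, by linarith, by linarith,
      h.bpath_eq h1 (by linarith), ?_⟩
    simp only [← h5]
    exact h.bpath_eq (by linarith) h3
  · intro s hs
    have hc := hdim s hs
    have hc0 := Finset.card_pos.2 (M.nonempty_of_mem_faces hs)
    rcases (show s.card = 1 ∨ s.card = 2 by omega) with h1 | h2
    · left
      obtain ⟨x, rfl⟩ := Finset.card_eq_one.1 h1
      have hx : x ∈ M.space := M.subset_space hs (by simp)
      rw [hM] at hx
      obtain ⟨u, u0, u3, rfl⟩ := exists_bpath hO hx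
      obtain ⟨i, hi⟩ := hτsurj u ⟨⟨u0, u3⟩, hs⟩
      exact ⟨i, by simp only [hi]⟩
    · right
      obtain ⟨x, y, hxy, rfl⟩ := Finset.card_eq_two.1 h2
      have hmid : (1 / 2 : ℝ) • x + (1 / 2 : ℝ) • y ∈
          convexHull ℝ (({x, y} : Finset E2) : Set E2) := by
        rw [Finset.coe_pair, convexHull_pair]
        exact ⟨1 / 2, 1 / 2, by norm_num, by norm_num, by norm_num, rfl⟩
      have hms : (1 / 2 : ℝ) • x + (1 / 2 : ℝ) • y ∈ M.space :=
        SimplicialComplex.mem_space_iff.2 ⟨_, hs, hmid⟩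
      have hnv : {(1 / 2 : ℝ) • x + (1 / 2 : ℝ) • y} ∉ M.faces := by
        intro hmem
        have := vertex_mem_of_mem hmem hs hmid
        rw [Finset.mem_insert, Finset.mem_singleton] at this
        apply hxy
        rcases this with h | h
        · have h' : (1 / 2 : ℝ) • (y - x) = 0 := by
            rw [← sub_eq_zero] at h
            rw [← h]
            module
          have := (smul_eq_zero.1 h').resolve_left (by norm_num)
          exact (sub_eq_zero.1 this).symm
        · have h' : (1 / 2 : ℝ) • (x - y) = 0 := by
            rw [← sub_eq_zero] at h
            rw [← h]
            module
          have := (smul_eq_zero.1 h').resolve_left (by norm_num)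
          exact sub_eq_zero.1 this
      rw [hM] at hms
      obtain ⟨u, u0, u3, hu⟩ := exists_bpath hO hms
      obtain ⟨i, hi, himax⟩ := Finset.exists_max_image (Finset.univ.filter fun i => τ i ≤ u) τ
        ⟨0, by simp [hτ0, u0]⟩
      rw [Finset.mem_filter] at hi
      obtain ⟨k, p, q, z, s', h, h1, h2', h3, h4, h5, h6, h7⟩ := hseg i
      have hus : u < s' := by
        by_contra hcon
        push Not at hcon
        have : s' ∈ S := by
          rcases h6 with h6 | h6
          · linarith
          · exact h6
        obtain ⟨j, hj⟩ := hτsurj s' this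
        have := himax j (by simp [hj, hcon])
        linarith
      refine ⟨i, pair_eq_of_mem hs (hedge i) hnv hmid ?_ h2 ?_⟩
      · rw [Finset.coe_pair, convexHull_pair, ← hu]
        beta_reduce
        rw [← h5, h.bpath_eq h1 (by linarith),
          h.bpath_eq (by linarith) h3, h.bpath_eq (u := u) (by linarith [hi.2]) (by linarith)]
        exact lin_mem_segment (by linarith [hi.2]) (by linarith)
      · refine Finset.card_pair fun e => ?_
        exact (Fin.add_one_ne_self' hn i).1 (hinj e).symm

end LoopExistence

section LoopWinding

variable {M : SimplicialComplex ℝ E2} {a b c : E2} {n : ℕ} [NeZero n] {v : Fin n → E2}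

namespace BoundaryLoop

lemma ne (h : BoundaryLoop M a b c v) (i : Fin n) : v i ≠ v (i + 1) :=
  fun e => (Fin.add_one_ne_self' h.three_le i).1 (h.inj e).symm

lemma vertex (h : BoundaryLoop M a b c v) (i : Fin n) : {v i} ∈ M.faces :=
  singleton_mem_faces (h.edge i) (by simp)

lemma pair_inj (h : BoundaryLoop M a b c v) {i j : Fin n}
    (e : ({v i, v (i + 1)} : Finset E2) = {v j, v (j + 1)}) : i = j := by
  have h1 : v i ∈ ({v j, v (j + 1)} : Finset E2) := by rw [← e]; simp
  have h2 : v (i + 1) ∈ ({v j, v (j + 1)} : Finset E2) := by rw [← e]; simp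
  rw [Finset.mem_insert, Finset.mem_singleton] at h1 h2
  rcases h1 with h1 | h1
  · exact h.inj h1
  · have h1 := h.inj h1
    rcases h2 with h2 | h2
    · have h2 := h.inj h2
      rw [h1] at h2
      exact absurd h2 (Fin.add_one_ne_self' h.three_le j).2
    · exact add_right_cancel (h.inj h2)

lemma common_vertex (h : BoundaryLoop M a b c v) {i j : Fin n} (hij : i ≠ j) {x : E2}
    (hx : x ∈ segment ℝ (v i) (v (i + 1))) (hx' : x ∈ segment ℝ (v j) (v (j + 1))) :
    ∃ k, (k = i ∨ k = i + 1) ∧ (k = j ∨ k = j + 1) ∧ x = v k := by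
  have hc : ∀ i, ({v i, v (i + 1)} : Finset E2).card = 2 := fun i => Finset.card_pair (h.ne i)
  have hxe : x ∈ convexHull ℝ (({v i, v (i + 1)} : Finset E2) : Set E2) := by
    rwa [Finset.coe_pair, convexHull_pair]
  have hxe' : x ∈ convexHull ℝ (({v j, v (j + 1)} : Finset E2) : Set E2) := by
    rwa [Finset.coe_pair, convexHull_pair]
  have hv : {x} ∈ M.faces := by
    by_contra hcon
    exact hij (h.pair_inj (pair_eq_of_mem (h.edge i) (h.edge j) hcon hxe hxe' (hc i) (hc j)))
  have m := vertex_mem_of_mem hv (h.edge i) hxe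
  have m' := vertex_mem_of_mem hv (h.edge j) hxe'
  rw [Finset.mem_insert, Finset.mem_singleton] at m m'
  rcases m with rfl | rfl
  · exact ⟨i, Or.inl rfl, m'.imp (fun e => h.inj e) (fun e => h.inj e), rfl⟩
  · exact ⟨i + 1, Or.inr rfl, m'.imp (fun e => h.inj e) (fun e => h.inj e), rfl⟩

lemma segment_subset (h : BoundaryLoop M a b c v) (i : Fin n) :
    segment ℝ (v i) (v (i + 1)) ⊆ M.space := by
  intro x hx
  refine SimplicialComplex.mem_space_iff.2 ⟨_, h.edge i, ?_⟩
  rwa [Finset.coe_pair, convexHull_pair]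

lemma simpleLoop_map (h : BoundaryLoop M a b c v) {g : E2 → E2} (hg : InjOn g M.space)
    (hpa : PiecewiseAffineOn g M) : SimpleLoop (fun i => g (v i)) (List.finRange n) := by
  have hseg : ∀ i x, x ∈ segment ℝ (g (v i)) (g (v (i + 1))) →
      ∃ y ∈ segment ℝ (v i) (v (i + 1)), g y = x := by
    intro i x hx
    obtain ⟨A, hA⟩ := hpa _ (h.edge i)
    rw [Finset.coe_pair, convexHull_pair] at hA
    rw [hA _ (left_mem_segment ℝ _ _), hA _ (right_mem_segment ℝ _ _), ← image_segment] at hx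
    obtain ⟨y, hy, rfl⟩ := hx
    exact ⟨y, hy, hA y hy⟩
  refine ⟨List.nodup_finRange n, ?_, ?_⟩
  · intro i _ j _ e
    exact h.inj (hg (M.subset_space (h.vertex i) (by simp))
      (M.subset_space (h.vertex j) (by simp)) e)
  · rintro ⟨i, i'⟩ he ⟨j, j'⟩ he' hne x hx hx'
    rw [mem_cyc_finRange] at he he'
    simp only at he he' hx hx'
    subst he he'
    obtain ⟨y, hy, rfl⟩ := hseg i x hx
    obtain ⟨y', hy', e⟩ := hseg j _ hx'
    have := hg (h.segment_subset j hy') (h.segment_subset i hy) e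
    subst this
    have hij : i ≠ j := by rintro rfl; exact hne rfl
    obtain ⟨k, h1, h2, rfl⟩ := h.common_vertex hij hy hy'
    exact ⟨k, h1, h2, rfl⟩

lemma simpleLoop (h : BoundaryLoop M a b c v) : SimpleLoop v (List.finRange n) :=
  h.simpleLoop_map (g := id) (injOn_id _) fun _ _ => ⟨AffineMap.id ℝ E2, fun _ _ => rfl⟩

lemma exists_orient_eq (h : BoundaryLoop M a b c v) (i : Fin n) :
    ∃ k p q z t, IsSide a b c k p q z ∧ 0 < t ∧ v (i + 1) - v i = t • (q - p) ∧
      ∀ x, orient (v i) (v (i + 1)) x = t * orient p q x := by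
  obtain ⟨k, p, q, z, s, s', hk, h0, hs, h1, e, e'⟩ := h.side i
  refine ⟨k, p, q, z, s' - s, hk, by linarith, ?_, fun x => ?_⟩
  · rw [e, e', lin, lin]; module
  · rw [e, e']; simp [orient, det2, lin]; ring

lemma orient_pos (hO : 0 < orient a b c) (h : BoundaryLoop M a b c v) {x : E2}
    (hx : x ∈ interior (convexHull ℝ {a, b, c})) (i : Fin n) :
    0 < orient (v i) (v (i + 1)) x := by
  obtain ⟨k, p, q, z, t, hk, ht, -, e⟩ := h.exists_orient_eq i
  rw [e]
  rw [← hk.set_eq, mem_interior_triangle_iff (by rwa [hk.orient_eq])] at hx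
  exact mul_pos ht hx.1

lemma viewAngle_pos (hO : 0 < orient a b c) (h : BoundaryLoop M a b c v) {x : E2}
    (hx : x ∈ interior (convexHull ℝ {a, b, c})) (i : Fin n) :
    0 < viewAngle (v i) (v (i + 1)) x ∧ viewAngle (v i) (v (i + 1)) x < π := by
  have := h.orient_pos hO hx i
  rw [orient_eq_view] at this
  exact ⟨turn_pos this, turn_lt_pi this⟩

lemma winding_eq_sum (x : E2) : winding v (cyc (List.finRange n)) x =
    ∑ i, viewAngle (v i) (v (i + 1)) x := by
  rw [winding, cyc_finRange, List.map_map, ← List.ofFn_eq_map, List.sum_ofFn]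
  rfl

lemma winding_pos (hO : 0 < orient a b c) (h : BoundaryLoop M a b c v) {x : E2}
    (hx : x ∈ interior (convexHull ℝ {a, b, c})) : 0 < winding v (cyc (List.finRange n)) x := by
  rw [winding_eq_sum]
  exact Finset.sum_pos (fun i _ => (h.viewAngle_pos hO hx i).1) ⟨0, Finset.mem_univ _⟩

lemma offSegs (hO : 0 < orient a b c) (h : BoundaryLoop M a b c v) {x : E2}
    (hx : x ∈ interior (convexHull ℝ {a, b, c})) : OffSegs v (cyc (List.finRange n)) x := by
  rintro ⟨i, j⟩ he hm
  rw [mem_cyc_finRange] at he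
  simp only at he hm
  subst he
  have h1 := h.orient_pos hO hx i
  obtain ⟨s, t, -, -, hst, rfl⟩ := hm
  rw [orient_combo _ _ _ _ hst] at h1
  have e1 : orient (v i) (v (i + 1)) (v i) = 0 := by simp [orient, det2]
  have e2 : orient (v i) (v (i + 1)) (v (i + 1)) = 0 := by simp [orient, det2]; ring
  rw [e1, e2] at h1
  simp at h1

lemma winding_le (h : BoundaryLoop M a b c v) {x : E2}
    (hx : OffSegs v (cyc (List.finRange n)) x) : winding v (cyc (List.finRange n)) x ≤ 2 * π := by
  obtain ⟨σ, hσ, T, hT⟩ := h.simpleLoop.triangulable (by simpa using h.three_le)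
  rcases hT.winding x hx with e | e <;> rw [e]
  · positivity
  · rcases hσ with rfl | rfl <;> linarith [pi_pos]

lemma winding_eq (hO : 0 < orient a b c) (h : BoundaryLoop M a b c v) {x : E2}
    (hx : x ∈ interior (convexHull ℝ {a, b, c})) :
    ∑ i, viewAngle (v i) (v (i + 1)) x = 2 * π := by
  have h0 := h.winding_pos hO hx
  obtain ⟨σ, hσ, T, hT⟩ := h.simpleLoop.triangulable (by simpa using h.three_le)
  rw [← winding_eq_sum]
  rcases hT.winding x (h.offSegs hO hx) with e | e
  · linarith
  · rcases hσ with rfl | rfl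
    · rw [e, mul_one]
    · linarith [pi_pos]

end BoundaryLoop

end LoopWinding

section Incenter

variable {a b c p q z : E2} {k : ℝ}

/-- Distance from the incenter `o` to the corner `p`. -/
lemma dist_incenter_le {o : E2} {s r : ℝ} (hs : 0 < s)
    (hang : s * (‖q - p‖ * ‖z - p‖) ≤ orient p q z)
    {P : ℝ} (hP : 0 < P) (ho : P • (o - p) = ‖z - p‖ • (q - p) + ‖q - p‖ • (z - p))
    (hr : r = orient p q z / P) : dist p o ≤ 2 * r / s := by
  have h1 : P * ‖o - p‖ ≤ 2 * (‖q - p‖ * ‖z - p‖) := by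
    calc P * ‖o - p‖ = ‖P • (o - p)‖ := by rw [norm_smul, Real.norm_of_nonneg hP.le]
      _ ≤ ‖‖z - p‖ • (q - p)‖ + ‖‖q - p‖ • (z - p)‖ := by rw [ho]; exact norm_add_le _ _
      _ = 2 * (‖q - p‖ * ‖z - p‖) := by rw [norm_smul, norm_smul, norm_norm, norm_norm]; ring
  rw [dist_eq_norm, norm_sub_rev, hr, le_div_iff₀ hs, mul_div_assoc', le_div_iff₀ hP]
  nlinarith

lemma orient_combo_three (p q a b c : E2) {P : ℝ} (hP : P ≠ 0) {x y z : ℝ} (h : x + y + z = P) :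
    orient p q (P⁻¹ • (x • a + y • b + z • c)) =
      (x * orient p q a + y * orient p q b + z * orient p q c) / P := by
  subst h
  simp [orient, det2]
  field_simp
  ring

/-- The incenter and the inradius of a triangle whose angles have sine at least `s`. -/
lemma exists_incenter (hO : 0 < orient a b c) {s : ℝ} (hs : 0 < s) (ha : s ≤ sin (∠ b a c))
    (hb : s ≤ sin (∠ a b c)) (hc : s ≤ sin (∠ a c b)) :
    ∃ (o : E2) (r : ℝ), 0 < r ∧ o ∈ interior (convexHull ℝ {a, b, c}) ∧
      (∀ {k p q z}, IsSide a b c k p q z → orient p q o = ‖q - p‖ * r) ∧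
      ∀ x ∈ convexHull ℝ {a, b, c}, dist x o ≤ 2 * r / s := by
  have r1 : orient b c a = orient a b c := orient_rotate a b c
  have r2 : orient c a b = orient a b c := by rw [orient_rotate b c a, r1]
  have nab : 0 < ‖b - a‖ := norm_pos_iff.2 (sub_ne_zero.2 (ne_of_orient_pos' hO).symm)
  have nbc : 0 < ‖c - b‖ := norm_pos_iff.2 (sub_ne_zero.2 (ne_of_orient_pos' (r1 ▸ hO)).symm)
  have nca : 0 < ‖a - c‖ := norm_pos_iff.2 (sub_ne_zero.2 (ne_of_orient_pos' (r2 ▸ hO)).symm)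
  obtain ⟨P, hP⟩ : ∃ P, ‖c - b‖ + ‖a - c‖ + ‖b - a‖ = P := ⟨_, rfl⟩
  have hP0 : 0 < P := by linarith
  set o := P⁻¹ • (‖c - b‖ • a + ‖a - c‖ • b + ‖b - a‖ • c) with ho
  have z1 : ∀ x y : E2, orient x y x = 0 := fun x y => by simp [orient, det2]
  have z2 : ∀ x y : E2, orient x y y = 0 := fun x y => by simp [orient, det2]; ring
  have hside : ∀ {k p q z}, IsSide a b c k p q z → orient p q o = ‖q - p‖ * (orient a b c / P) := by
    intro k p q z h
    rw [ho, orient_combo_three _ _ _ _ _ hP0.ne' hP]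
    rcases h with ⟨rfl, rfl, rfl, rfl⟩ | ⟨rfl, rfl, rfl, rfl⟩ | ⟨rfl, rfl, rfl, rfl⟩ <;>
      simp only [z1, z2, r1, r2] <;> ring
  have ho' : P • o = ‖c - b‖ • a + ‖a - c‖ • b + ‖b - a‖ • c := by
    rw [ho, smul_inv_smul₀ hP0.ne']
  have hd : ∀ x ∈ ({a, b, c} : Set E2), dist x o ≤ 2 * (orient a b c / P) / s := by
    rintro x (rfl | rfl | rfl)
    · refine dist_incenter_le (q := b) (z := c) hs ?_ hP0 ?_ rfl
      · rw [← abs_of_pos hO, ← abs_neg, ← orient_swap, ← sin_angle_mul_dist, dist_eq_norm,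
          dist_eq_norm, norm_sub_rev x c]
        gcongr
      · rw [smul_sub, ho', ← hP, norm_sub_rev c x]
        module
    · refine dist_incenter_le (q := c) (z := a) hs ?_ hP0 ?_ (by rw [r1])
      · rw [r1, ← abs_of_pos hO, ← sin_angle_mul_dist, dist_eq_norm, dist_eq_norm,
          norm_sub_rev x c, mul_comm ‖c - x‖]
        gcongr
      · rw [smul_sub, ho', ← hP, norm_sub_rev a x]
        module
    · refine dist_incenter_le (q := a) (z := b) hs ?_ hP0 ?_ (by rw [r2])
      · rw [← orient_rotate, ← abs_of_pos (show 0 < orient a b x from hO), ← abs_neg, ← orient_swap,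
          ← orient_rotate b a x, ← sin_angle_mul_dist, dist_eq_norm, dist_eq_norm, norm_sub_rev x b]
        gcongr
      · rw [smul_sub, ho', ← hP, norm_sub_rev b x]
        module
  refine ⟨o, orient a b c / P, by positivity, ?_, hside, ?_⟩
  · rw [mem_interior_triangle_iff hO, hside (Or.inl ⟨rfl, rfl, rfl, rfl⟩),
      hside (Or.inr (Or.inl ⟨rfl, rfl, rfl, rfl⟩)), hside (Or.inr (Or.inr ⟨rfl, rfl, rfl, rfl⟩))]
    refine ⟨?_, ?_, ?_⟩ <;> positivity
  · intro x hx
    exact convexHull_min (fun y hy => mem_closedBall.2 (hd y hy)) (convex_closedBall _ _) hx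

end Incenter

section Angles

variable {n : ℕ} [NeZero n]

lemma sin_turn_mul (u v : E2) : sin (turn u v) * (‖u‖ * ‖v‖) = det2 u v := by
  rcases eq_or_ne u 0 with rfl | hu
  · simp [det2]
  rcases eq_or_ne v 0 with rfl | hv
  · simp [det2]
  have h : ‖(⟨dot2 u v, det2 u v⟩ : ℂ)‖ = ‖u‖ * ‖v‖ := by
    rw [← conj_toC_mul, norm_mul, Complex.norm_conj, norm_toC, norm_toC]
  have hp : ‖u‖ * ‖v‖ ≠ 0 := mul_ne_zero (norm_ne_zero_iff.2 hu) (norm_ne_zero_iff.2 hv)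
  rw [turn, Complex.sin_arg, h, div_mul_cancel₀ _ hp]

/-- Vectors turning once around the origin, in polar coordinates. -/
lemma exists_polar {u : Fin n → E2} (hu : ∀ i, u i ≠ 0)
    (hpos : ∀ i, 0 < turn (u i) (u (i + 1)))
    (hsum : ∑ i, turn (u i) (u (i + 1)) = 2 * π) :
    ∃ ψ : Fin n → ℝ, (∀ i, u i = ‖u i‖ • dir (ψ i)) ∧ ∀ i j, i < j →
      turn (u i) (u (i + 1)) ≤ ψ j - ψ i ∧ ψ j - ψ i ≤ 2 * π - turn (u j) (u (j + 1)) := by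
  set δ : ℕ → ℝ := fun k => if h : k < n then turn (u ⟨k, h⟩) (u (⟨k, h⟩ + 1)) else 0 with hδ
  have hδi : ∀ i : Fin n, δ i = turn (u i) (u (i + 1)) := fun i => by simp [hδ]
  have hδ0 : ∀ k, 0 ≤ δ k := by
    intro k
    by_cases h : k < n
    · rw [show k = (⟨k, h⟩ : Fin n).1 from rfl, hδi]
      exact (hpos _).le
    · simp [hδ, h]
  have hall : ∑ k ∈ Finset.range n, δ k = 2 * π := by
    rw [← hsum, Finset.sum_range]
    exact Finset.sum_congr rfl fun i _ => hδi i
  set ψ : ℕ → ℝ := fun k => Complex.arg (toC (u 0)) + ∑ j ∈ Finset.range k, δ j with hψ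
  have harg : ∀ k (h : k < n), (ψ k : Real.Angle) = Complex.arg (toC (u ⟨k, h⟩)) := by
    intro k
    induction k with
    | zero => intro h; simp only [hψ, Finset.range_zero, Finset.sum_empty, add_zero]; rfl
    | succ k ih =>
      intro h
      have hk : k < n := by omega
      have e : (⟨k, hk⟩ + 1 : Fin n) = ⟨k + 1, h⟩ := by
        ext
        rw [Fin.val_add, Fin.val_one', Nat.mod_eq_of_lt (show 1 < n by omega), Nat.mod_eq_of_lt h]
      have e2 : ψ (k + 1) = ψ k + δ k := by simp only [hψ, Finset.sum_range_succ]; ring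
      rw [e2, Real.Angle.coe_add, ih hk, hδi ⟨k, hk⟩, e, turn_coe (hu _) (hu _), add_sub_cancel]
  refine ⟨fun i => ψ i, fun i => eq_norm_smul_dir (harg i i.2), fun i j hij => ?_⟩
  have e : ψ j - ψ i = ∑ k ∈ Finset.Ico i.1 j.1, δ k := by
    rw [Finset.sum_Ico_eq_sub _ (le_of_lt hij)]
    simp only [hψ]; ring
  rw [e]
  constructor
  · rw [← hδi]
    exact Finset.single_le_sum (fun k _ => hδ0 k) (Finset.mem_Ico.2 ⟨le_rfl, hij⟩)
  · rw [← hδi, le_sub_iff_add_le, ← hall, add_comm, ← Finset.sum_insert (by simp)]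
    refine Finset.sum_le_sum_of_subset_of_nonneg ?_ fun k _ _ => hδ0 k
    intro k hk
    rw [Finset.mem_insert, Finset.mem_Ico] at hk
    rw [Finset.mem_range]
    have := j.2
    omega

end Angles

section Circle

variable {M : SimplicialComplex ℝ E2} {a b c : E2} {n : ℕ} [NeZero n] {v : Fin n → E2}

lemma orient_smul_smul (o x y z : E2) (s : ℝ) :
    orient (o + s • x) (o + s • y) (o + s • z) = s ^ 2 * orient x y z := by
  simp [orient, det2]; ring

lemma orient_add_right (p q o w : E2) : orient p q (o + w) = orient p q o + det2 (q - p) w := by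
  simp [orient, det2]; ring

lemma abs_orient_polar {o : E2} {ρ : ℝ} (hρ : 0 < ρ) (s t u : ℝ) :
    |orient (o + ρ • dir s) (o + ρ • dir t) (o + ρ • dir u)| * (2 * ρ) =
      dist (o + ρ • dir s) (o + ρ • dir t) * dist (o + ρ • dir t) (o + ρ • dir u) *
        dist (o + ρ • dir s) (o + ρ • dir u) := by
  have hd : ∀ s t, dist (o + ρ • dir s) (o + ρ • dir t) = ρ * (2 * |sin ((t - s) / 2)|) := by
    intro s t
    rw [dist_eq_norm, add_sub_add_left_eq_sub, ← smul_sub, norm_smul, norm_dir_sub_dir,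
      Real.norm_of_nonneg hρ.le]
  rw [hd, hd, hd, orient_smul_smul, orient_dir, abs_mul, abs_mul, abs_mul, abs_mul, abs_pow,
    abs_of_pos hρ, abs_of_pos (show (0 : ℝ) < 4 by norm_num)]
  ring

/-- A circle of vertices inside a triangle, radially below the boundary vertices `v`. -/
lemma BoundaryLoop.exists_circle (hO : 0 < orient a b c) (h : BoundaryLoop M a b c v)
    {s : ℝ} (hs : 0 < s) (hs1 : s ≤ 1) (ha : s ≤ sin (∠ b a c))
    (hb : s ≤ sin (∠ a b c)) (hc : s ≤ sin (∠ a c b)) {l m : ℝ} (hl : 0 < l)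
    (hlv : ∀ i, l ≤ dist (v i) (v (i + 1)))
    (hm : ∀ x ∈ convexHull ℝ {a, b, c}, ∀ y ∈ convexHull ℝ {a, b, c}, dist x y ≤ m) :
    ∃ w : Fin n → E2, (∀ i, w i ∈ interior (convexHull ℝ {a, b, c})) ∧
      (∀ i, (l * s ^ 2 / 12) ^ 2 ≤ orient (v i) (v (i + 1)) (w (i + 1))) ∧
      (∀ i, (l * s ^ 2 / 12) ^ 2 ≤ orient (v i) (w (i + 1)) (w i)) ∧
      (∀ i j k, i < j → j < k → 0 < orient (w i) (w j) (w k)) ∧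
      (∀ i j, i ≠ j → l * s ^ 2 / 8 ≤ dist (w i) (w j)) ∧
      (∀ i j, l * s ^ 2 / 8 ≤ dist (v i) (w j)) ∧
      ∀ i j k, i ≠ k → l * s ^ 2 / (12 * m) * (dist (w i) (w j) * dist (w j) (w k)) ≤
        |orient (w i) (w j) (w k)| := by
  obtain ⟨o, r, hr, ho, hside, hR⟩ := exists_incenter hO hs ha hb hc
  have hvΔ : ∀ i, v i ∈ convexHull ℝ {a, b, c} := by
    intro i
    obtain ⟨k, p, q, z, s, s', hk, h0, h1, h2, e, -⟩ := h.side i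
    rw [← hk.set_eq, e]
    exact (isClosed_triangle p q z).frontier_subset
      (lin_mem_triangle (by rwa [hk.orient_eq]) h0 (by linarith))
  have hℓ : ∀ i, orient (v i) (v (i + 1)) o = ‖v (i + 1) - v i‖ * r := by
    intro i
    obtain ⟨k, p, q, z, t, hk, ht, e, e'⟩ := h.exists_orient_eq i
    rw [e', hside hk, e, norm_smul, Real.norm_of_nonneg ht.le]
    ring
  have hℓl : ∀ i, l ≤ ‖v (i + 1) - v i‖ := by
    intro i
    rw [← dist_eq_norm, dist_comm]
    exact hlv i
  set u : Fin n → E2 := fun i => v i - o with hu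
  have hview : ∀ i, det2 (u i) (u (i + 1)) = ‖v (i + 1) - v i‖ * r := by
    intro i
    rw [← hℓ, orient_eq_view]
  have hur : ∀ i, r ≤ ‖u i‖ := by
    intro i
    have h1 : ‖v (i + 1) - v i‖ * r ≤ ‖v (i + 1) - v i‖ * ‖u i‖ := by
      rw [← hℓ, hu, norm_sub_rev (v i)]
      exact (le_abs_self _).trans (abs_det2_le _ _)
    exact le_of_mul_le_mul_left h1 (by linarith [hℓl i])
  have huR : ∀ i, ‖u i‖ ≤ 2 * r / s := fun i => by
    rw [← dist_eq_norm]
    exact hR _ (hvΔ i)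
  have hrm : r ≤ m := by
    refine (hur 0).trans ?_
    rw [← dist_eq_norm]
    exact hm _ (hvΔ 0) _ (interior_subset ho)
  have hlr : l * s ≤ 4 * r := by
    have h1 : ‖v (0 + 1) - v 0‖ ≤ ‖u (0 + 1)‖ + ‖u 0‖ := by
      rw [show v (0 + 1) - v 0 = u (0 + 1) - u 0 by simp [hu]]
      exact norm_sub_le _ _
    have h2 : l ≤ 2 * r / s + 2 * r / s := by linarith [hℓl 0, huR 0, huR (0 + 1)]
    rw [← add_div, le_div_iff₀ hs] at h2
    linarith
  have hu0 : ∀ i, 0 < ‖u i‖ := fun i => hr.trans_le (hur i)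
  have hdet : ∀ i, 0 < det2 (u i) (u (i + 1)) := fun i => by
    rw [hview]
    exact mul_pos (hl.trans_le (hℓl i)) hr
  have hsin : ∀ i, l * s ^ 2 / (4 * r) ≤ sin (turn (u i) (u (i + 1))) := by
    intro i
    have h1 := sin_turn_mul (u i) (u (i + 1))
    rw [hview] at h1
    have h2 : 0 < sin (turn (u i) (u (i + 1))) :=
      sin_pos_of_pos_of_lt_pi (turn_pos (hdet i)) (turn_lt_pi (hdet i))
    have h3 : ‖u i‖ * ‖u (i + 1)‖ ≤ (2 * r / s) * (2 * r / s) :=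
      mul_le_mul (huR i) (huR _) (norm_nonneg _) (by positivity)
    have h4 : l * r ≤ sin (turn (u i) (u (i + 1))) * ((2 * r / s) * (2 * r / s)) := by
      calc l * r ≤ ‖v (i + 1) - v i‖ * r := by gcongr; exact hℓl i
        _ = _ := h1.symm
        _ ≤ _ := by gcongr
    rw [div_le_iff₀ (by positivity)]
    have h5 : sin (turn (u i) (u (i + 1))) * ((2 * r / s) * (2 * r / s)) * s ^ 2 =
        sin (turn (u i) (u (i + 1))) * (4 * r) * r := by
      field_simp; ring
    have h6 := mul_le_mul_of_nonneg_right h4 (sq_nonneg s)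
    rw [h5] at h6
    refine le_of_mul_le_mul_right ?_ hr
    linarith
  obtain ⟨ψ, hψ, hψ'⟩ := exists_polar (u := u) (fun i => norm_pos_iff.1 (hu0 i))
    (fun i => turn_pos (hdet i)) (h.winding_eq hO ho)
  obtain ⟨ρ, hρ⟩ : ∃ ρ, ρ = r / 2 := ⟨_, rfl⟩
  have hρ0 : 0 < ρ := by linarith
  obtain ⟨β, hβ⟩ : ∃ β : Fin n → ℝ, ∀ i, β i = ρ / ‖u i‖ := ⟨fun i => ρ / ‖u i‖, fun _ => rfl⟩
  have hβ0 : ∀ i, s / 4 ≤ β i := by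
    intro i
    rw [hβ, le_div_iff₀ (hu0 i), hρ]
    have := huR i
    rw [le_div_iff₀ hs] at this
    linarith
  have hβ1 : ∀ i, β i ≤ 1 / 2 := by
    intro i
    rw [hβ, div_le_iff₀ (hu0 i), hρ]
    linarith [hur i]
  set w : Fin n → E2 := fun i => o + ρ • dir (ψ i) with hw
  have hwu : ∀ i, w i = o + β i • u i := by
    intro i
    rw [hw, hβ]
    conv_rhs => rw [hψ i]
    rw [smul_smul, div_mul_eq_mul_div, norm_smul, norm_dir, mul_one, norm_norm,
      mul_div_cancel_right₀ _ (hu0 i).ne']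
  have hv : ∀ i, v i = o + u i := fun i => by simp [hu]
  have hwo : ∀ i, dist (w i) o = ρ := by
    intro i
    rw [hw, dist_eq_norm, add_sub_cancel_left, norm_smul, norm_dir, mul_one,
      Real.norm_of_nonneg hρ0.le]
  have hhalf : ∀ i j, i < j → 0 < ψ j - ψ i ∧ ψ j - ψ i < 2 * π ∧
      l * s ^ 2 / (8 * r) ≤ sin ((ψ j - ψ i) / 2) := by
    intro i j hij
    obtain ⟨h1, h2⟩ := hψ' i j hij
    refine ⟨by linarith [turn_pos (hdet i)], by linarith [turn_pos (hdet j)], ?_⟩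
    have := sin_half_ge (turn_pos (hdet i)) (turn_lt_pi (hdet i)) (turn_pos (hdet j))
      (turn_lt_pi (hdet j)) h1 h2 (hsin i) (hsin j)
    refine le_trans (le_of_eq ?_) this
    field_simp; ring
  have hchord : ∀ i j, i ≠ j → l * s ^ 2 / 8 ≤ dist (w i) (w j) := by
    have key : ∀ i j, i < j → l * s ^ 2 / 8 ≤ dist (w i) (w j) := by
      intro i j hij
      have h1 := (hhalf i j hij).2.2
      simp only [hw]
      rw [dist_eq_norm, add_sub_add_left_eq_sub, ← smul_sub, norm_smul, norm_dir_sub_dir,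
        Real.norm_of_nonneg hρ0.le]
      calc l * s ^ 2 / 8 = ρ * (2 * (l * s ^ 2 / (8 * r))) := by rw [hρ]; field_simp
        _ ≤ _ := by
          gcongr
          exact h1.trans (le_abs_self _)
    intro i j hij
    rcases lt_or_gt_of_ne hij with h | h
    · exact key i j h
    · rw [dist_comm]; exact key j i h
  have hprod : ∀ i, (l * s ^ 2 / 12) ^ 2 ≤ s / 8 * (‖v (i + 1) - v i‖ * r) := by
    intro i
    have h1 : l * r ≤ ‖v (i + 1) - v i‖ * r := by gcongr; exact hℓl i
    have h2 : (l * s) * (l * s) ≤ (l * s) * (4 * r) := by gcongr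
    have h3 : s ^ 2 ≤ 1 := pow_le_one₀ hs.le hs1
    calc (l * s ^ 2 / 12) ^ 2 = (l * s) * (l * s) * s ^ 2 / 144 := by ring
      _ ≤ (l * s) * (4 * r) * 1 / 144 := by gcongr
      _ ≤ s / 8 * (l * r) := by
        have : 0 < s * (l * r) := by positivity
        nlinarith
      _ ≤ _ := by gcongr
  refine ⟨w, ?_, ?_, ?_, ?_, hchord, ?_, ?_⟩
  · intro i
    have key : ∀ {k p q z}, IsSide a b c k p q z → 0 < orient p q (w i) := by
      intro k p q z hk
      have hpq : 0 < ‖q - p‖ := norm_pos_iff.2 (sub_ne_zero.2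
        (ne_of_orient_pos' (z := z) (by rwa [hk.orient_eq])).symm)
      simp only [hw]
      rw [orient_add_right, hside hk]
      have h1 := abs_det2_le (q - p) (ρ • dir (ψ i))
      rw [norm_smul, norm_dir, mul_one, Real.norm_of_nonneg hρ0.le] at h1
      have h2 := neg_abs_le (det2 (q - p) (ρ • dir (ψ i)))
      have h3 : ‖q - p‖ * ρ < ‖q - p‖ * r := by gcongr; linarith
      linarith
    exact (mem_interior_triangle_iff hO).2 ⟨key (Or.inl ⟨rfl, rfl, rfl, rfl⟩),
      key (Or.inr (Or.inl ⟨rfl, rfl, rfl, rfl⟩)), key (Or.inr (Or.inr ⟨rfl, rfl, rfl, rfl⟩))⟩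
  · intro i
    have e : orient (v i) (v (i + 1)) (w (i + 1)) = (1 - β (i + 1)) * det2 (u i) (u (i + 1)) := by
      rw [hwu, hv i, hv (i + 1)]
      simp [orient, det2]; ring
    rw [e, hview]
    refine (hprod i).trans (mul_le_mul_of_nonneg_right ?_ (by positivity))
    linarith [hβ1 (i + 1)]
  · intro i
    have e : orient (v i) (w (i + 1)) (w i) =
        (β (i + 1) * (1 - β i)) * det2 (u i) (u (i + 1)) := by
      rw [hwu, hwu, hv i]
      simp [orient, det2]; ring
    rw [e, hview]
    refine (hprod i).trans (mul_le_mul_of_nonneg_right ?_ (by positivity))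
    nlinarith [hβ1 i, hβ0 (i + 1)]
  · intro i j k hij hjk
    have pos : ∀ i j, i < j → 0 < sin ((ψ j - ψ i) / 2) := fun i j hij =>
      sin_pos_of_pos_of_lt_pi (by linarith [(hhalf i j hij).1]) (by linarith [(hhalf i j hij).2.1])
    simp only [hw]
    rw [orient_smul_smul, orient_dir]
    have := pos i j hij
    have := pos j k hjk
    have := pos i k (hij.trans hjk)
    positivity
  · intro i j
    have h1 : dist (v i) o ≤ dist (v i) (w j) + dist (w j) o := dist_triangle _ _ _
    rw [hwo] at h1
    have h2 : r ≤ dist (v i) o := by rw [dist_eq_norm]; exact hur i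
    have h3 : l * s * s ≤ l * s * 1 := by gcongr
    nlinarith
  · intro i j k hik
    have h1 := abs_orient_polar (o := o) hρ0 (ψ i) (ψ j) (ψ k)
    have h2 := hchord i k hik
    have hm0 : 0 < m := hr.trans_le hrm
    have h3 : l * s ^ 2 / (12 * m) * (2 * ρ) ≤ l * s ^ 2 / 8 := by
      rw [hρ, div_mul_eq_mul_div, div_le_iff₀ (by positivity)]
      have : 0 < l * s ^ 2 := by positivity
      nlinarith
    refine le_of_mul_le_mul_right ?_ (show 0 < 2 * ρ by positivity)
    calc _ = dist (w i) (w j) * dist (w j) (w k) * (l * s ^ 2 / (12 * m) * (2 * ρ)) := by ring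
      _ ≤ dist (w i) (w j) * dist (w j) (w k) * dist (w i) (w k) := by
        gcongr
        exact h3.trans h2
      _ = _ := h1.symm

end Circle

section Target

lemma exists_reflection : ∃ R : E2 →ᵃ[ℝ] E2, (∀ x, R (R x) = x) ∧
    ∀ a b c, orient (R a) (R b) (R c) = -orient a b c := by
  have hL : IsLinearMap ℝ (fun x : E2 => (!₂[x 0, -x 1] : E2)) := by
    constructor
    · intro x y
      ext i
      fin_cases i
      · simp
      · simp; ring
    · intro s x
      ext i
      fin_cases i <;> simp
  refine ⟨(IsLinearMap.mk' _ hL).toAffineMap, fun x => ?_, fun a b c => ?_⟩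
  · ext i
    fin_cases i <;> simp
  · simp [orient, det2]; ring

lemma SimpleLoop.map {V : Type*} {q : V → E2} {l : List V} (hs : SimpleLoop q l)
    {R : E2 →ᵃ[ℝ] E2} (hR : ∀ x, R (R x) = x) : SimpleLoop (fun i => R (q i)) l := by
  have hinj : Function.Injective R := fun x y e => by rw [← hR x, e, hR]
  refine ⟨hs.nodup, fun a ha b hb e => hs.inj a ha b hb (hinj e), ?_⟩
  intro e he e' he' hne x hx hx'
  rw [← image_segment] at hx hx'
  obtain ⟨y, hy, rfl⟩ := hx
  obtain ⟨y', hy', e1⟩ := hx'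
  obtain rfl := hinj e1
  obtain ⟨v, hv, hv', rfl⟩ := hs.inter e he e' he' hne y' hy hy'
  exact ⟨v, hv, hv', rfl⟩

lemma exists_lt_of_isRotated {V : Type*} [LinearOrder V] {i j k : V} {s : List V}
    (h : s ~r [i, j, k]) (hs : s.Pairwise (· < ·)) :
    (i < j ∧ j < k) ∨ (j < k ∧ k < i) ∨ (k < i ∧ i < j) := by
  obtain ⟨m, hm⟩ := h.symm
  rw [← List.rotate_mod] at hm
  have : m % [i, j, k].length < 3 := Nat.mod_lt _ (by simp)
  generalize m % [i, j, k].length = m' at hm this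
  interval_cases m'
  · subst hm; simp at hs; tauto
  · subst hm; simp [List.rotate] at hs; tauto
  · subst hm; simp [List.rotate] at hs; tauto

variable {n : ℕ} [NeZero n]

omit [NeZero n] in
lemma SimpleLoop.winding_le (hn : 3 ≤ n) {q : Fin n → E2}
    (hs : SimpleLoop q (List.finRange n)) {x : E2}
    (hx : OffSegs q (cyc (List.finRange n)) x) : winding q (cyc (List.finRange n)) x ≤ 2 * π := by
  obtain ⟨σ, hσ, T, hT⟩ := hs.triangulable (by simpa using hn)
  rcases hT.winding x hx with e | e <;> rw [e]
  · positivity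
  · rcases hσ with rfl | rfl <;> linarith [pi_pos]

/-- Up to a reflection, a simple loop bounds a collared triangulated polygon. -/
lemma SimpleLoop.exists_target (hn : 3 ≤ n) {q : Fin n → E2}
    (hs : SimpleLoop q (List.finRange n)) :
    ∃ (T : List (Fin n × Fin n × Fin n)) (R : E2 →ᵃ[ℝ] E2) (Q : Fin n × Bool → E2),
      (∀ α : Fin n → Fin n → ℝ, (∀ a b, α b a = -α a b) →
        (T.map (bdry α)).sum = ((cyc (List.finRange n)).map fun e => α e.1 e.2).sum) ∧
      (∀ t ∈ T, (t.1 < t.2.1 ∧ t.2.1 < t.2.2) ∨ (t.2.1 < t.2.2 ∧ t.2.2 < t.1) ∨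
        (t.2.2 < t.1 ∧ t.1 < t.2.1)) ∧
      (∀ x, R (R x) = x) ∧
      Placed Q ((cyc (List.finRange n)).map outerEdge) (collar (List.finRange n) T) ∧
      ∀ i, R (Q (i, false)) = q i := by
  obtain ⟨σ, hσ, T, hT⟩ := hs.triangulable (by simpa using hn)
  obtain ⟨R, hR, hRT⟩ : ∃ R : E2 →ᵃ[ℝ] E2, (∀ x, R (R x) = x) ∧
      ∀ t ∈ T, 0 < orient (R (q t.1)) (R (q t.2.1)) (R (q t.2.2)) := by
    rcases hσ with rfl | rfl
    · exact ⟨AffineMap.id ℝ E2, fun x => rfl, fun t ht => by simpa using hT.orient_pos t ht⟩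
    · obtain ⟨R, hR, hR'⟩ := exists_reflection
      refine ⟨R, hR, fun t ht => ?_⟩
      rw [hR']
      simpa using hT.orient_pos t ht
  have hs' := hs.map hR
  obtain ⟨q', h1, h2, h3⟩ := exists_shrink hn hs' hRT
  refine ⟨T, R, fun p => bif p.2 then q' p.1 else R (q p.1), hT.bdry_sum, fun t ht => ?_, hR, ?_,
    fun i => hR _⟩
  · obtain ⟨s, hst, hsl⟩ := hT.sublist t ht
    exact exists_lt_of_isRotated hst ((List.pairwise_lt_finRange n).sublist hsl)
  · refine placed_collar hT.bdry_sum hs' (fun x hx => hs'.winding_le hn hx) ?_ ?_ h3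
    · rintro ⟨i, j⟩ he
      rw [mem_cyc_finRange] at he
      simp only at he
      subst he
      exact h1 i
    · rintro ⟨i, j⟩ he
      rw [mem_cyc_finRange] at he
      simp only at he
      subst he
      exact h2 i

end Target

section Collar

lemma dist_le_of_mem_triangle {a b c : E2} {m : ℝ} (hab : dist a b ≤ m) (hbc : dist b c ≤ m)
    (hca : dist c a ≤ m) : ∀ x ∈ convexHull ℝ {a, b, c}, ∀ y ∈ convexHull ℝ {a, b, c},
      dist x y ≤ m := by
  intro x hx y hy
  obtain ⟨x', hx', y', hy', hd⟩ := convexHull_exists_dist_ge2 hx hy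
  refine hd.trans ?_
  have hm : 0 ≤ m := dist_nonneg.trans hab
  rcases hx' with rfl | rfl | rfl <;> rcases hy' with rfl | rfl | rfl <;>
    first
      | assumption
      | (rw [dist_self]; assumption)
      | (rw [dist_comm]; assumption)

lemma abs_orient_of_mem {a b c p q r : E2} (hp : p = a ∨ p = b ∨ p = c)
    (hq : q = a ∨ q = b ∨ q = c) (hr : r = a ∨ r = b ∨ r = c) (hpq : p ≠ q) (hqr : q ≠ r)
    (hpr : p ≠ r) : |orient p q r| = |orient a b c| := by
  have h1 : ∀ a b c : E2, |orient b a c| = |orient a b c| := fun a b c => by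
    rw [orient_swap, abs_neg]
  have h2 : ∀ a b c : E2, |orient b c a| = |orient a b c| := fun a b c => by rw [orient_rotate]
  rcases hp with rfl | rfl | rfl <;> rcases hq with rfl | rfl | rfl <;>
    rcases hr with rfl | rfl | rfl <;>
    first
      | exact absurd rfl hpq
      | exact absurd rfl hqr
      | exact absurd rfl hpr
      | rfl
      | exact h1 _ _ _
      | exact h2 _ _ _
      | exact (h2 _ _ _).symm
      | (rw [← h2, h1]; done)
      | (rw [h2, h1])

lemma eqOn_segment {f g : E2 → E2} {x y : E2} {A B : E2 →ᵃ[ℝ] E2}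
    (hA : ∀ z ∈ segment ℝ x y, f z = A z) (hB : ∀ z ∈ segment ℝ x y, g z = B z)
    (hx : f x = g x) (hy : f y = g y) : ∀ z ∈ segment ℝ x y, f z = g z := by
  intro z hz
  rw [hA z hz, hB z hz]
  rw [hA x (left_mem_segment ℝ _ _), hB x (left_mem_segment ℝ _ _)] at hx
  rw [hA y (right_mem_segment ℝ _ _), hB y (right_mem_segment ℝ _ _)] at hy
  rw [segment_eq_image_lineMap] at hz
  obtain ⟨t, -, rfl⟩ := hz
  rw [AffineMap.apply_lineMap, AffineMap.apply_lineMap, hx, hy]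

variable {n : ℕ} [NeZero n] {T : List (Fin n × Fin n × Fin n)}

lemma mem_collar_finRange {t : (Fin n × Bool) × (Fin n × Bool) × (Fin n × Bool)} :
    t ∈ collar (List.finRange n) T ↔ (∃ i, t = ((i, false), (i + 1, false), (i + 1, true))) ∨
      (∃ i, t = ((i, false), (i + 1, true), (i, true))) ∨ ∃ s ∈ T, t = innerTri s := by
  rw [mem_collar]
  constructor
  · rintro (⟨⟨i, j⟩, he, h⟩ | h)
    · rw [mem_cyc_finRange] at he
      simp only at he
      subst he
      exact h.elim (fun h => Or.inl ⟨i, h⟩) fun h => Or.inr (Or.inl ⟨i, h⟩)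
    · exact Or.inr (Or.inr h)
  · rintro (⟨i, h⟩ | ⟨i, h⟩ | h)
    · exact Or.inl ⟨(i, i + 1), mem_cyc_finRange.2 rfl, Or.inl h⟩
    · exact Or.inl ⟨(i, i + 1), mem_cyc_finRange.2 rfl, Or.inr h⟩
    · exact Or.inr h

lemma exists_mem_collar (p : Fin n × Bool) : ∃ t ∈ collar (List.finRange n) T, p ∈ tri t := by
  obtain ⟨i, _ | _⟩ := p
  · exact ⟨_, mem_collar_finRange.2 (Or.inl ⟨i, rfl⟩), by simp [tri]⟩
  · exact ⟨_, mem_collar_finRange.2 (Or.inr (Or.inl ⟨i, rfl⟩)), by simp [tri]⟩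

lemma consecutive_of_mem_collar {t : (Fin n × Bool) × (Fin n × Bool) × (Fin n × Bool)}
    (ht : t ∈ collar (List.finRange n) T) {i j : Fin n} (hi : (i, false) ∈ tri t)
    (hj : (j, false) ∈ tri t) (hij : i ≠ j) : j = i + 1 ∨ i = j + 1 := by
  rw [mem_collar_finRange] at ht
  rcases ht with ⟨k, rfl⟩ | ⟨k, rfl⟩ | ⟨s, -, rfl⟩
  · simp only [tri, Finset.mem_insert, Finset.mem_singleton, Prod.mk.injEq, and_true,
      Bool.false_eq_true, and_false, or_false] at hi hj
    rcases hi with rfl | rfl <;> rcases hj with rfl | rfl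
    · exact absurd rfl hij
    · exact Or.inl rfl
    · exact Or.inr rfl
    · exact absurd rfl hij
  · simp only [tri, Finset.mem_insert, Finset.mem_singleton, Prod.mk.injEq, and_true,
      Bool.false_eq_true, and_false, or_false] at hi hj
    exact absurd (hi.trans hj.symm) hij
  · simp [tri, innerTri] at hi

end Collar

section Assembly

variable {n : ℕ} [NeZero n] {T : List (Fin n × Fin n × Fin n)} {v w : Fin n → E2}

/-- The outer vertices `v` together with the inner vertices `w`. -/
def ringPt (v w : Fin n → E2) (p : Fin n × Bool) : E2 := bif p.2 then w p.1 else v p.1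

lemma ringPt_injective {E : List ((Fin n × Bool) × (Fin n × Bool))}
    (hP : Placed (ringPt v w) E (collar (List.finRange n) T)) :
    Function.Injective (ringPt v w) := by
  intro p p' e
  obtain ⟨t, ht, hp⟩ := exists_mem_collar (T := T) p
  obtain ⟨t', ht', hp'⟩ := exists_mem_collar (T := T) p'
  exact hP.vertex_inj ht ht' hp hp' e

lemma mem_faces_pair {E : List ((Fin n × Bool) × (Fin n × Bool))}
    (hP : Placed (ringPt v w) E (collar (List.finRange n) T)) (i : Fin n) :
    {v i, v (i + 1)} ∈ hP.complex.faces := by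
  classical
  rw [hP.mem_faces]
  refine ⟨{(i, false), (i + 1, false)}, ⟨_, Finset.mem_insert_self _ _⟩,
    ⟨_, mem_collar_finRange.2 (Or.inl ⟨i, rfl⟩), ?_⟩, ?_⟩
  · intro p hp
    simp only [Finset.mem_insert, Finset.mem_singleton, tri] at hp ⊢
    tauto
  · rw [Finset.image_insert, Finset.image_singleton]
    rfl

variable {M : SimplicialComplex ℝ E2} {a b c : E2}

lemma BoundaryLoop.placed (h : BoundaryLoop M a b c v)
    (hT : ∀ α : Fin n → Fin n → ℝ, (∀ a b, α b a = -α a b) →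
      (T.map (bdry α)).sum = ((cyc (List.finRange n)).map fun e => α e.1 e.2).sum)
    (hT' : ∀ t ∈ T, (t.1 < t.2.1 ∧ t.2.1 < t.2.2) ∨ (t.2.1 < t.2.2 ∧ t.2.2 < t.1) ∨
      (t.2.2 < t.1 ∧ t.1 < t.2.1))
    (h1 : ∀ i, 0 < orient (v i) (v (i + 1)) (w (i + 1)))
    (h2 : ∀ i, 0 < orient (v i) (w (i + 1)) (w i))
    (h3 : ∀ i j k, i < j → j < k → 0 < orient (w i) (w j) (w k)) :
    Placed (ringPt v w) ((cyc (List.finRange n)).map outerEdge) (collar (List.finRange n) T) := by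
  refine placed_collar hT h.simpleLoop (fun x hx => h.winding_le hx) ?_ ?_ ?_
  · rintro ⟨i, j⟩ he
    rw [mem_cyc_finRange] at he
    simp only at he
    subst he
    exact h1 i
  · rintro ⟨i, j⟩ he
    rw [mem_cyc_finRange] at he
    simp only at he
    subst he
    exact h2 i
  · rintro ⟨i, j, k⟩ ht
    rcases hT' _ ht with ⟨e1, e2⟩ | ⟨e1, e2⟩ | ⟨e1, e2⟩
    · exact h3 _ _ _ e1 e2
    · have := h3 _ _ _ e1 e2
      rw [← orient_rotate]
      exact this
    · have := h3 _ _ _ e1 e2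
      rw [← orient_rotate] at this
      exact this

lemma BoundaryLoop.mem_frontier (h : BoundaryLoop M a b c v)
    (hM : M.space = frontier (convexHull ℝ {a, b, c})) (i : Fin n) :
    v i ∈ frontier (convexHull ℝ {a, b, c}) := by
  rw [← hM]
  exact h.segment_subset i (left_mem_segment ℝ _ _)

lemma BoundaryLoop.isTriangulation (hO : 0 < orient a b c) (h : BoundaryLoop M a b c v)
    (hM : M.space = frontier (convexHull ℝ {a, b, c}))
    (hw : ∀ i, w i ∈ interior (convexHull ℝ {a, b, c}))
    (hP : Placed (ringPt v w) ((cyc (List.finRange n)).map outerEdge)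
      (collar (List.finRange n) T)) : IsTriangulation hP.complex (convexHull ℝ {a, b, c}) := by
  refine hP.isTriangulation (convex_convexHull ℝ _) ?_ ?_ ?_
  · rw [(convex_convexHull ℝ _).closure_interior_eq_closure_of_nonempty_interior ⟨w 0, hw 0⟩]
    exact subset_closure
  · rintro t - ⟨i, _ | _⟩ -
    · exact (isClosed_triangle a b c).frontier_subset (h.mem_frontier hM i)
    · exact interior_subset (hw i)
  · intro x hx
    have e : winding (ringPt v w) ((cyc (List.finRange n)).map outerEdge) x =
        winding v (cyc (List.finRange n)) x := by
      simp [winding, outerEdge, Function.comp_def, ringPt]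
    rw [e]
    exact (h.winding_pos hO hx).ne'

lemma BoundaryLoop.mem_iff_of_faces (h : BoundaryLoop M a b c v)
    (hM : M.space = frontier (convexHull ℝ {a, b, c}))
    (hw : ∀ i, w i ∈ interior (convexHull ℝ {a, b, c})) {E : List ((Fin n × Bool) × (Fin n × Bool))}
    (hP : Placed (ringPt v w) E (collar (List.finRange n) T)) :
    M.faces ⊆ hP.complex.faces ∧
    (∀ x : E2, ({x} : Finset E2) ∈ hP.complex.faces →
      (x ∈ frontier (convexHull ℝ {a, b, c}) ↔ ({x} : Finset E2) ∈ M.faces)) ∧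
    (∀ e : Finset E2, e.card = 2 →
      ((e ∈ hP.complex.faces ∧ convexHull ℝ (e : Set E2) ⊆ frontier (convexHull ℝ {a, b, c})) ↔
        e ∈ M.faces)) := by
  classical
  have hsub : M.faces ⊆ hP.complex.faces := by
    intro s hs
    rcases h.cover s hs with ⟨i, rfl⟩ | ⟨i, rfl⟩
    · exact singleton_mem_faces (mem_faces_pair hP i) (by simp)
    · exact mem_faces_pair hP i
  have hfalse : ∀ p, ringPt v w p ∈ frontier (convexHull ℝ {a, b, c}) → ∃ i, p = (i, false) := by
    rintro ⟨i, _ | _⟩ hp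
    · exact ⟨i, rfl⟩
    · exact absurd (hw i) (disjoint_left.1 disjoint_interior_frontier.symm hp)
  refine ⟨hsub, fun x hx => ⟨fun hxf => ?_, fun hxM => ?_⟩, fun e he => ⟨?_, fun heM => ?_⟩⟩
  · rw [hP.mem_faces] at hx
    obtain ⟨A, ⟨p, hp⟩, -, hA⟩ := hx
    have hpx : ringPt v w p = x := by
      have : ringPt v w p ∈ A.image (ringPt v w) := Finset.mem_image_of_mem _ hp
      rw [← hA] at this
      simpa using this
    subst hpx
    obtain ⟨i, rfl⟩ := hfalse p hxf
    exact h.vertex i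
  · rw [← hM]
    exact M.subset_space hxM (by simp)
  · rintro ⟨heK, hef⟩
    rw [hP.mem_faces] at heK
    obtain ⟨A, -, ⟨t, ht, hAt⟩, rfl⟩ := heK
    rw [Finset.card_image_of_injective _ (ringPt_injective hP)] at he
    obtain ⟨p, q, hpq, rfl⟩ := Finset.card_eq_two.1 he
    obtain ⟨i, rfl⟩ := hfalse p (hef (subset_convexHull ℝ _ (by simp)))
    obtain ⟨j, rfl⟩ := hfalse q (hef (subset_convexHull ℝ _ (by simp)))
    have hij : i ≠ j := by rintro rfl; exact hpq rfl
    rw [Finset.image_insert, Finset.image_singleton]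
    rcases consecutive_of_mem_collar ht (hAt (by simp)) (hAt (by simp)) hij with rfl | rfl
    · exact h.edge i
    · rw [Finset.pair_comm]
      exact h.edge j
  · refine ⟨hsub heM, ?_⟩
    rw [← hM]
    exact M.convexHull_subset_space heM

/-- The triangles of a ring with large oriented areas have large angles. -/
lemma angleLB_ring {E : List ((Fin n × Bool) × (Fin n × Bool))}
    (hP : Placed (ringPt v w) E (collar (List.finRange n) T)) {A k m κ : ℝ} (hm : 0 < m)
    (hdist : ∀ p q, dist (ringPt v w p) (ringPt v w q) ≤ m)
    (h1 : ∀ i, A ≤ orient (v i) (v (i + 1)) (w (i + 1)))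
    (h2 : ∀ i, A ≤ orient (v i) (w (i + 1)) (w i))
    (h3 : ∀ i j l, i ≠ l → k * (dist (w i) (w j) * dist (w j) (w l)) ≤ |orient (w i) (w j) (w l)|)
    (hA : 0 ≤ A) (hκA : κ ≤ A / m ^ 2) (hκ : κ ≤ k) : AngleLB hP.complex κ := by
  classical
  intro s hs p hp q hq r hr hpq hqr hpr
  rw [hP.mem_faces] at hs
  obtain ⟨B, -, ⟨t, ht, hBt⟩, rfl⟩ := hs
  obtain ⟨p, hp', rfl⟩ := Finset.mem_image.1 hp
  obtain ⟨q, hq', rfl⟩ := Finset.mem_image.1 hq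
  obtain ⟨r, hr', rfl⟩ := Finset.mem_image.1 hr
  have hring : A ≤ orient (ringPt v w t.1) (ringPt v w t.2.1) (ringPt v w t.2.2) →
      κ ≤ sin (∠ (ringPt v w p) (ringPt v w q) (ringPt v w r)) := by
    intro hAt
    refine hκA.trans (le_sin_angle hpq hqr ?_)
    have hmem : ∀ p ∈ B, ringPt v w p = ringPt v w t.1 ∨ ringPt v w p = ringPt v w t.2.1 ∨
        ringPt v w p = ringPt v w t.2.2 := by
      intro p hp
      have := hBt hp
      simp only [tri, Finset.mem_insert, Finset.mem_singleton] at this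
      rcases this with rfl | rfl | rfl <;> simp
    rw [abs_orient_of_mem (hmem p hp') (hmem q hq') (hmem r hr') hpq hqr hpr]
    refine le_trans ?_ (hAt.trans (le_abs_self _))
    rw [div_mul_eq_mul_div, div_le_iff₀ (by positivity), sq]
    exact mul_le_mul_of_nonneg_left (mul_le_mul (hdist _ _) (hdist _ _) dist_nonneg hm.le) hA
  rw [mem_collar_finRange] at ht
  rcases ht with ⟨i, rfl⟩ | ⟨i, rfl⟩ | ⟨s, -, rfl⟩
  · exact hring (h1 i)
  · exact hring (h2 i)
  · have hin : ∀ p ∈ B, ∃ i, p = (i, true) := by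
      rintro ⟨i, c⟩ hp
      refine ⟨i, ?_⟩
      have := hBt hp
      simp only [tri, innerTri, Finset.mem_insert, Finset.mem_singleton, Prod.mk.injEq] at this
      rcases this with ⟨-, rfl⟩ | ⟨-, rfl⟩ | ⟨-, rfl⟩ <;> rfl
    obtain ⟨i, rfl⟩ := hin p hp'
    obtain ⟨j, rfl⟩ := hin q hq'
    obtain ⟨l, rfl⟩ := hin r hr'
    exact hκ.trans (le_sin_angle hpq hqr (h3 i j l (by rintro rfl; exact hpr rfl)))

end Assembly

section Main

lemma BoundaryLoop.exists_extension {n : ℕ} [NeZero n] {v w : Fin n → E2}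
    {T : List (Fin n × Fin n × Fin n)} {M : SimplicialComplex ℝ E2} {a b c : E2}
    (hl : BoundaryLoop M a b c v)
    (hM : M.space = frontier (convexHull ℝ {a, b, c}))
    {E E' : List ((Fin n × Bool) × (Fin n × Bool))}
    (hP : Placed (ringPt v w) E (collar (List.finRange n) T))
    (hK : IsTriangulation hP.complex (convexHull ℝ {a, b, c}))
    {Q : Fin n × Bool → E2} (hQ : Placed Q E' (collar (List.finRange n) T))
    {R : E2 →ᵃ[ℝ] E2} (hR : ∀ x, R (R x) = x) {h : E2 → E2}
    (hRQ : ∀ i, R (Q (i, false)) = h (v i)) (hpa : PiecewiseAffineOn h M) :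
    ∃ f : E2 → E2, IsHomeoOn f (convexHull ℝ {a, b, c}) ∧ PiecewiseAffineOn f hP.complex ∧
      ∀ x ∈ frontier (convexHull ℝ {a, b, c}), f x = h x := by
  obtain ⟨g, hg, hgpa, hgv⟩ := hP.exists_map hQ
  rw [hK.2.2.1] at hg
  have hfpa : PiecewiseAffineOn (fun x => R (g x)) hP.complex := by
    intro s hs
    obtain ⟨A, hA⟩ := hgpa s hs
    exact ⟨R.comp A, fun x hx => congrArg R (hA x hx)⟩
  refine ⟨fun x => R (g x), ?_, hfpa, ?_⟩
  · refine isHomeoOn_of_compact ?_ ?_ ?_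
    · exact (Set.toFinite _).isCompact_convexHull (𝕜 := ℝ)
    · exact R.continuous_of_finiteDimensional.comp_continuousOn hg.1
    · intro x hx y hy e
      refine hg.2.1 hx hy ?_
      rw [← hR (g x), ← hR (g y)]
      exact congrArg R e
  · have hv : ∀ i, R (g (v i)) = h (v i) := by
      intro i
      obtain ⟨t, ht, hi⟩ := exists_mem_collar (T := T) (i, false)
      have := hgv t ht _ ((Weights.single (i, false)).mono (by simpa using hi))
      rw [pt_single, pt_single] at this
      rw [← hRQ, ← this]
      rfl
    intro x hx
    have hseg : ∃ i, x ∈ segment ℝ (v i) (v (i + 1)) := by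
      rw [← hM, SimplicialComplex.mem_space_iff] at hx
      obtain ⟨s, hs, hxs⟩ := hx
      rcases hl.cover s hs with ⟨i, rfl⟩ | ⟨i, rfl⟩
      · rw [Finset.coe_singleton, convexHull_singleton, mem_singleton_iff] at hxs
        exact ⟨i, hxs ▸ left_mem_segment ℝ _ _⟩
      · rw [Finset.coe_pair, convexHull_pair] at hxs
        exact ⟨i, hxs⟩
    obtain ⟨i, hxi⟩ := hseg
    obtain ⟨A, hA⟩ := hfpa _ (mem_faces_pair hP i)
    obtain ⟨B, hB⟩ := hpa _ (hl.edge i)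
    rw [Finset.coe_pair, convexHull_pair] at hA hB
    exact eqOn_segment hA hB (hv i) (hv (i + 1)) x hxi

/-- The extension theorem for a positively oriented triangle. -/
lemma exists_piecewise_affine_extension {a b c : E2} (hO : 0 < orient a b c) {s : ℝ} (hs : 0 < s)
    (hs1 : s ≤ 1) (ha : s ≤ sin (∠ b a c)) (hb : s ≤ sin (∠ a b c)) (hc : s ≤ sin (∠ a c b))
    {m₁ m₂ : ℝ} (hm₁ : 0 < m₁) (hm12 : m₁ ≤ m₂) (hab : dist a b ≤ m₂) (hbc : dist b c ≤ m₂)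
    (hca : dist c a ≤ m₂) {l₁ : ℝ} (hl₁ : 0 < l₁)
    (M : SimplicialComplex ℝ E2) (hMfin : M.faces.Finite)
    (hMdim : ∀ s ∈ M.faces, s.card ≤ 2)
    (hMspace : M.space = frontier (convexHull ℝ {a, b, c}))
    (hMedge : ∀ e ∈ M.faces, e.card = 2 → l₁ ≤ edgeLen e)
    (h : E2 → E2) (hhom : IsHomeoOn h (frontier (convexHull ℝ {a, b, c})))
    (hpa : PiecewiseAffineOn h M) :
    ∃ (K : SimplicialComplex ℝ E2) (f : E2 → E2),
      IsTriangulation K (convexHull ℝ {a, b, c}) ∧ IsHomeoOn f (convexHull ℝ {a, b, c}) ∧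
      PiecewiseAffineOn f K ∧
      M.faces ⊆ K.faces ∧
      (∀ v : E2, ({v} : Finset E2) ∈ K.faces →
        (v ∈ frontier (convexHull ℝ {a, b, c}) ↔ ({v} : Finset E2) ∈ M.faces)) ∧
      (∀ e : Finset E2, e.card = 2 →
        ((e ∈ K.faces ∧ convexHull ℝ (e : Set E2) ⊆ frontier (convexHull ℝ {a, b, c})) ↔
          e ∈ M.faces)) ∧
      (∀ x ∈ frontier (convexHull ℝ {a, b, c}), f x = h x) ∧
      AngleLB K ((1 / 144) * l₁ ^ 2 * m₁ ^ 2 * s ^ 4 / m₂ ^ 4) ∧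
      (∀ e ∈ K.faces, e.card = 2 →
        (1 / 12) * l₁ * m₁ * s ^ 2 / m₂ ≤ edgeLen e ∧ edgeLen e ≤ m₂) := by
  classical
  obtain ⟨n, _, v, hl⟩ := exists_boundary_loop hO hMfin hMdim hMspace
  have hm₂ : 0 < m₂ := hm₁.trans_le hm12
  have hdiam := dist_le_of_mem_triangle hab hbc hca
  have hvΔ : ∀ i, v i ∈ convexHull ℝ {a, b, c} := fun i =>
    (isClosed_triangle a b c).frontier_subset (hl.mem_frontier hMspace i)
  have hlv : ∀ i, l₁ ≤ dist (v i) (v (i + 1)) := by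
    intro i
    have := hMedge _ (hl.edge i) (Finset.card_pair (hl.ne i))
    rwa [edgeLen, Finset.coe_pair, Metric.diam_pair] at this
  obtain ⟨w, hw, h1, h2, h3, h4, h5, h6⟩ :=
    hl.exists_circle hO hs hs1 ha hb hc hl₁ hlv hdiam
  have hA : 0 < (l₁ * s ^ 2 / 12) ^ 2 := by positivity
  have hloop : SimpleLoop (fun i => h (v i)) (List.finRange n) :=
    hl.simpleLoop_map (by rw [hMspace]; exact hhom.2.1) hpa
  obtain ⟨T, R, Q, hT, hT', hR, hQ, hRQ⟩ := hloop.exists_target hl.three_le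
  have hP := hl.placed hT hT' (fun i => hA.trans_le (h1 i)) (fun i => hA.trans_le (h2 i)) h3
  have hK := hl.isTriangulation hO hMspace hw hP
  obtain ⟨f, hf, hfpa, hfh⟩ := hl.exists_extension hMspace hP hK hQ hR hRQ hpa
  obtain ⟨k1, k2, k3⟩ := hl.mem_iff_of_faces hMspace hw hP
  have hPΔ : ∀ p, ringPt v w p ∈ convexHull ℝ {a, b, c} := by
    rintro ⟨i, _ | _⟩
    · exact hvΔ i
    · exact interior_subset (hw i)
  have hlm : l₁ ≤ m₂ := (hlv 0).trans (hdiam _ (hvΔ _) _ (hvΔ _))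
  have hs2 : s ^ 2 ≤ 1 := pow_le_one₀ hs.le hs1
  have hratio : m₁ / m₂ ≤ 1 := (div_le_one hm₂).2 hm12
  have hratio0 : 0 ≤ m₁ / m₂ := by positivity
  have hL : 1 / 12 * l₁ * m₁ * s ^ 2 / m₂ ≤ l₁ * s ^ 2 / 12 := by
    calc 1 / 12 * l₁ * m₁ * s ^ 2 / m₂ = l₁ * s ^ 2 / 12 * (m₁ / m₂) := by ring
      _ ≤ l₁ * s ^ 2 / 12 * 1 := by gcongr
      _ = _ := mul_one _
  refine ⟨hP.complex, f, hK, hf, hfpa, k1, k2, k3, hfh, ?_, ?_⟩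
  · refine angleLB_ring hP hm₂ (fun p q => hdiam _ (hPΔ p) _ (hPΔ q)) h1 h2
      (fun i j k hik => h6 i j k hik) hA.le ?_ ?_
    · calc 1 / 144 * l₁ ^ 2 * m₁ ^ 2 * s ^ 4 / m₂ ^ 4
          = (l₁ * s ^ 2 / 12) ^ 2 / m₂ ^ 2 * (m₁ / m₂) ^ 2 := by field_simp; ring
        _ ≤ (l₁ * s ^ 2 / 12) ^ 2 / m₂ ^ 2 * 1 := by
            gcongr
            exact pow_le_one₀ hratio0 hratio
        _ = _ := mul_one _
    · have hX1 : l₁ * s ^ 2 / (12 * m₂) ≤ 1 := by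
        rw [div_le_one (by positivity)]
        nlinarith [mul_le_mul hlm hs2 (by positivity) hm₂.le]
      have hX0 : 0 ≤ l₁ * s ^ 2 / (12 * m₂) := by positivity
      calc 1 / 144 * l₁ ^ 2 * m₁ ^ 2 * s ^ 4 / m₂ ^ 4
          = l₁ * s ^ 2 / (12 * m₂) * (l₁ * s ^ 2 / (12 * m₂) * (m₁ / m₂) ^ 2) := by
            field_simp; ring
        _ ≤ l₁ * s ^ 2 / (12 * m₂) * 1 := by
            gcongr
            exact mul_le_one₀ hX1 (by positivity) (pow_le_one₀ hratio0 hratio)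
        _ = _ := mul_one _
  · intro e he hcard
    rw [hP.mem_faces] at he
    obtain ⟨A, -, ⟨t, ht, hAt⟩, rfl⟩ := he
    rw [Finset.card_image_of_injective _ (ringPt_injective hP)] at hcard
    obtain ⟨p, q, hpq, rfl⟩ := Finset.card_eq_two.1 hcard
    rw [Finset.image_insert, Finset.image_singleton, edgeLen, Finset.coe_pair, Metric.diam_pair]
    refine ⟨hL.trans ?_, hdiam _ (hPΔ p) _ (hPΔ q)⟩
    have hle : l₁ * s ^ 2 / 12 ≤ l₁ * s ^ 2 / 8 := by
      have : 0 < l₁ * s ^ 2 := by positivity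
      linarith
    have hle' : l₁ * s ^ 2 / 12 ≤ l₁ := by nlinarith
    have hp := hAt (Finset.mem_insert_self _ _)
    have hq := hAt (Finset.mem_insert_of_mem (Finset.mem_singleton_self _))
    obtain ⟨i, _ | _⟩ := p <;> obtain ⟨j, _ | _⟩ := q
    · have hij : i ≠ j := by rintro rfl; exact hpq rfl
      rcases consecutive_of_mem_collar ht hp hq hij with rfl | rfl
      · exact hle'.trans (hlv i)
      · rw [dist_comm]
        exact hle'.trans (hlv j)
    · exact hle.trans (h5 i j)
    · rw [dist_comm]
      exact hle.trans (h5 j i)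
    · exact hle.trans (h4 i j (by rintro rfl; exact hpq rfl))

lemma orient_ne_zero {a b c : E2} (h : AffineIndependent ℝ ![a, b, c]) : orient a b c ≠ 0 := by
  intro h0
  rw [affineIndependent_iff_not_collinear_set] at h
  apply h
  by_cases hab : b = a
  · subst hab
    simpa using collinear_pair ℝ b c
  have hn := nsq_pos (sub_ne_zero.2 hab)
  rw [collinear_iff_of_mem (p₀ := a) (by simp)]
  refine ⟨b - a, ?_⟩
  rintro p (rfl | rfl | rfl)
  · exact ⟨0, by simp⟩
  · exact ⟨1, by simp⟩
  · refine ⟨dot2 (b - a) (p - a) / nsq (b - a), ?_⟩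
    have key : ∀ i : Fin 2, nsq (b - a) * (p i - a i) = dot2 (b - a) (p - a) * (b i - a i) := by
      simp only [orient, det2, PiLp.sub_apply] at h0
      intro i
      fin_cases i
      · simp only [nsq, dot2, PiLp.sub_apply, Fin.zero_eta]
        linear_combination -(b 1 - a 1) * h0
      · simp only [nsq, dot2, PiLp.sub_apply, Fin.mk_one]
        linear_combination (b 0 - a 0) * h0
    ext i
    rw [vadd_eq_add, PiLp.add_apply, PiLp.smul_apply, PiLp.sub_apply, smul_eq_mul,
      div_mul_eq_mul_div, ← key, mul_div_cancel_left₀ _ hn.ne', sub_add_cancel]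

end Main

/-- piecewise affine Schoenflies extension from the boundary of a
triangle, with explicit control on angles and edge lengths of the triangulation. -/
theorem statement6 (p₁ p₂ p₃ : E2) (hind : AffineIndependent ℝ ![p₁, p₂, p₃])
    (Δ : Set E2) (hΔ : Δ = convexHull ℝ {p₁, p₂, p₃})
    (θ : ℝ) (hθ0 : 0 < θ) (hθ1 : θ ≤ π / 3)
    (hangle : Real.sin θ ≤ Real.sin (∠ p₂ p₁ p₃) ∧
      Real.sin θ ≤ Real.sin (∠ p₁ p₂ p₃) ∧ Real.sin θ ≤ Real.sin (∠ p₁ p₃ p₂))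
    (m₁ m₂ : ℝ) (hm₁ : 0 < m₁) (hm12 : m₁ ≤ m₂)
    (hm : ∀ x ∈ ({(p₁, p₂), (p₂, p₃), (p₃, p₁)} : Set (E2 × E2)),
      m₁ ≤ dist x.1 x.2 ∧ dist x.1 x.2 ≤ m₂)
    (l₁ l₂ : ℝ) (hl₁ : 0 < l₁) (hl12 : l₁ ≤ l₂)
    (M : SimplicialComplex ℝ E2) (hMfin : M.faces.Finite)
    (hMdim : ∀ s ∈ M.faces, s.card ≤ 2)
    (hMspace : M.space = frontier Δ)
    (hMedge : ∀ e ∈ M.faces, e.card = 2 → l₁ ≤ edgeLen e ∧ edgeLen e ≤ l₂)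
    (h : E2 → E2) (hhom : IsHomeoOn h (frontier Δ)) (hpa : PiecewiseAffineOn h M) :
    ∃ (K : SimplicialComplex ℝ E2) (f : E2 → E2),
      IsTriangulation K Δ ∧ IsHomeoOn f Δ ∧ PiecewiseAffineOn f K ∧
      M.faces ⊆ K.faces ∧
      (∀ v : E2, ({v} : Finset E2) ∈ K.faces →
        (v ∈ frontier Δ ↔ ({v} : Finset E2) ∈ M.faces)) ∧
      (∀ e : Finset E2, e.card = 2 →
        ((e ∈ K.faces ∧ convexHull ℝ (e : Set E2) ⊆ frontier Δ) ↔ e ∈ M.faces)) ∧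
      (∀ x ∈ frontier Δ, f x = h x) ∧
      AngleLB K ((1 / 144) * l₁ ^ 2 * m₁ ^ 2 * (Real.sin θ) ^ 4 / m₂ ^ 4) ∧
      (∀ e ∈ K.faces, e.card = 2 →
        (1 / 12) * l₁ * m₁ * (Real.sin θ) ^ 2 / m₂ ≤ edgeLen e ∧ edgeLen e ≤ m₂) := by
  have hsθ : 0 < Real.sin θ := Real.sin_pos_of_pos_of_lt_pi hθ0 (by linarith [Real.pi_pos])
  have hsθ1 := Real.sin_le_one θ
  obtain ⟨ha, hb, hc⟩ := hangle
  have h12 := (hm (p₁, p₂) (by simp)).2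
  have h23 := (hm (p₂, p₃) (by simp)).2
  have h31 := (hm (p₃, p₁) (by simp)).2
  have hedge : ∀ e ∈ M.faces, e.card = 2 → l₁ ≤ edgeLen e := fun e he h2 => (hMedge e he h2).1
  rcases lt_or_gt_of_ne (orient_ne_zero hind) with hO | hO
  · have hO' : 0 < orient p₁ p₃ p₂ := by
      rw [← orient_rotate, orient_swap, orient_rotate]
      linarith
    rw [pair_comm p₂ p₃] at hΔ
    subst hΔ
    rw [angle_comm] at ha
    exact exists_piecewise_affine_extension hO' hsθ hsθ1 ha hc hb hm₁ hm12
      (by rwa [dist_comm]) (by rwa [dist_comm]) (by rwa [dist_comm]) hl₁ M hMfin hMdim hMspace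
      hedge h hhom hpa
  · subst hΔ
    exact exists_piecewise_affine_extension hO hsθ hsθ1 ha hb hc hm₁ hm12 h12 h23 h31 hl₁
      M hMfin hMdim hMspace hedge h hhom hpa

end
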